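/- Let n ≥ 2, let A, B ⊆ ℝⁿ be measurable sets, let 0 < τ ≤ 1/2, t ∈ [τ, 1 − τ], and set S := tA + (1 − t)B. Define M_n(τ) := 2^{3^{n+2}} n^{3^n} |log τ|^{3^n} / τ^{3^n} and ε_n(τ) := τ^{3^n} / (2^{3^{n+1}} n^{3^n} |log τ|^{3^n}). There exists a constant N_n depending only on n such that: if ||A| − 1| + ||B| − 1| + ||S| − 1| ≤ δ for some δ ≤ e^{−M_n(τ)}, then there exist a vector v ∈ ℝⁿ and a convex set 𝒦 ⊆ ℝⁿ such that A ⊆ 𝒦, B + v ⊆ 𝒦, and |𝒦 \ A| + |𝒦 \ (B + v)| ≤ τ^{−N_n} δ^{ε_n(τ)}. -/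

import Mathlib

open MeasureTheory Set Pointwise
set_option linter.unusedSectionVars false


theorem bm1_compact {X Y : Set ℝ} (hX : IsCompact X) (hY : IsCompact Y) (hX0 : X.Nonempty)
    (hY0 : Y.Nonempty) : volume X + volume Y ≤ volume (X + Y) := by
  obtain ⟨x0, hx0, hx⟩ := hX.exists_isGreatest hX0
  obtain ⟨y0, hy0, hy⟩ := hY.exists_isLeast hY0
  have h1 : volume ((fun x => x + y0) '' X ∪ (fun y => x0 + y) '' Y) ≤ volume (X + Y) := by
    apply measure_mono
    rintro z (⟨x, hx, rfl⟩ | ⟨y, hy, rfl⟩)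
    · exact add_mem_add hx hy0
    · exact add_mem_add hx0 hy
  refine le_trans ?_ h1
  rw [measure_union₀]
  · simp
  · exact (hY.image (by fun_prop)).measurableSet.nullMeasurableSet
  · refine measure_mono_null (t := {x0 + y0}) ?_ (by simp)
    rintro z ⟨⟨x, hx', rfl⟩, ⟨y, hy', h⟩⟩
    have := hx hx'
    have := hy hy'
    simp only at h ⊢
    simp only [mem_singleton_iff]
    linarith

theorem bm1 {X Y : Set ℝ} (hX : MeasurableSet X) (hY : MeasurableSet Y) (hX0 : X.Nonempty)
    (hY0 : Y.Nonempty) : volume X + volume Y ≤ volume (X + Y) := by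
  obtain ⟨x0, hx0⟩ := hX0
  obtain ⟨y0, hy0⟩ := hY0
  rcases eq_or_ne (volume X) 0 with h | h
  · rw [h, zero_add]
    calc volume Y = volume ((fun y => x0 + y) '' Y) := by simp
      _ ≤ _ := measure_mono (by rintro _ ⟨y, hy, rfl⟩; exact add_mem_add hx0 hy)
  rcases eq_or_ne (volume Y) 0 with h' | h'
  · rw [h', add_zero]
    calc volume X = volume ((fun y => y + y0) '' X) := by simp
      _ ≤ _ := measure_mono (by rintro _ ⟨y, hy, rfl⟩; exact add_mem_add hy hy0)
  refine le_of_forall_lt fun c hc => ?_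
  obtain ⟨c1, hc1, c2, hc2, h12⟩ := ENNReal.exists_lt_add_of_lt_add hc h h'
  obtain ⟨K1, hK1, hK1c, hK1m⟩ := hX.exists_lt_isCompact hc1
  obtain ⟨K2, hK2, hK2c, hK2m⟩ := hY.exists_lt_isCompact hc2
  calc c < c1 + c2 := h12
    _ ≤ volume K1 + volume K2 := by gcongr
    _ ≤ volume (K1 + K2) := bm1_compact hK1c hK2c
        (nonempty_of_measure_ne_zero (ne_bot_of_gt hK1m))
        (nonempty_of_measure_ne_zero (ne_bot_of_gt hK2m))
    _ ≤ _ := measure_mono (add_subset_add hK1 hK2)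

theorem bm1_t {X Y W : Set ℝ} {t : ℝ} (ht0 : 0 < t) (ht1 : t < 1) (hX : MeasurableSet X)
    (hY : MeasurableSet Y) (hX0 : X.Nonempty) (hY0 : Y.Nonempty)
    (hW : ∀ x ∈ X, ∀ y ∈ Y, t * x + (1 - t) * y ∈ W) :
    ENNReal.ofReal t * volume X + ENNReal.ofReal (1 - t) * volume Y ≤ volume W := by
  have h := bm1 (X := t • X) (Y := (1 - t) • Y) (hX.const_smul₀ t) (hY.const_smul₀ _)
    (hX0.smul_set) (hY0.smul_set)
  rw [Measure.addHaar_smul, Measure.addHaar_smul] at h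
  simp only [Module.finrank_self, pow_one, abs_of_pos ht0, abs_of_pos (sub_pos.2 ht1)] at h
  refine h.trans (measure_mono ?_)
  rintro _ ⟨_, ⟨x, hx, rfl⟩, _, ⟨y, hy, rfl⟩, rfl⟩
  exact hW x hx y hy

theorem pl1 {f g h : ℝ → ℝ} {t : ℝ} (ht0 : 0 < t) (ht1 : t < 1)
    (hf : Measurable f) (hg : Measurable g) (hh : Measurable h)
    (f0 : ∀ x, 0 ≤ f x) (g0 : ∀ x, 0 ≤ g x) (h0 : ∀ x, 0 ≤ h x)
    (fb : BddAbove (range f)) (gb : BddAbove (range g))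
    (fi : ∫⁻ x, ENNReal.ofReal (f x) ≠ ⊤) (gi : ∫⁻ x, ENNReal.ofReal (g x) ≠ ⊤)
    (H : ∀ x y, f x ^ t * g y ^ (1 - t) ≤ h (t * x + (1 - t) * y)) :
    (∫⁻ x, ENNReal.ofReal (f x)) ^ t * (∫⁻ x, ENNReal.ofReal (g x)) ^ (1 - t) ≤
      ∫⁻ x, ENNReal.ofReal (h x) := by
  have ht1' : 0 < 1 - t := sub_pos.2 ht1
  rcases le_or_gt (⨆ x, f x) 0 with hF | hF
  · have : ∀ x, ENNReal.ofReal (f x) = 0 := fun x =>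
      ENNReal.ofReal_eq_zero.2 ((le_ciSup fb x).trans hF)
    simp [this, ENNReal.zero_rpow_of_pos ht0]
  rcases le_or_gt (⨆ x, g x) 0 with hG | hG
  · have : ∀ x, ENNReal.ofReal (g x) = 0 := fun x =>
      ENNReal.ofReal_eq_zero.2 ((le_ciSup gb x).trans hG)
    simp [this, ENNReal.zero_rpow_of_pos ht1']
  set F := ⨆ x, f x with hFdef
  set G := ⨆ x, g x with hGdef
  have hP : 0 < F ^ t * G ^ (1 - t) := by positivity
  have key : ENNReal.ofReal t * (∫⁻ x, ENNReal.ofReal (f x / F)) +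
      ENNReal.ofReal (1 - t) * (∫⁻ x, ENNReal.ofReal (g x / G)) ≤
      ∫⁻ x, ENNReal.ofReal (h x / (F ^ t * G ^ (1 - t))) := by
    rw [lintegral_eq_lintegral_meas_lt _ (Filter.Eventually.of_forall fun x => by
        have := f0 x; simp only [Pi.zero_apply]; positivity) (by fun_prop),
      lintegral_eq_lintegral_meas_lt _ (Filter.Eventually.of_forall fun x => by
        have := g0 x; simp only [Pi.zero_apply]; positivity) (by fun_prop),
      lintegral_eq_lintegral_meas_lt _ (Filter.Eventually.of_forall fun x => by
        have := h0 x; simp only [Pi.zero_apply]; positivity) (by fun_prop),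
      ← lintegral_const_mul' _ _ ENNReal.ofReal_ne_top,
      ← lintegral_const_mul' _ _ ENNReal.ofReal_ne_top, ← lintegral_add_left']
    · refine setLIntegral_mono' measurableSet_Ioi fun l hl => ?_
      have hl0 : 0 < l := hl
      rcases le_or_gt 1 l with h1 | h1
      · have e1 : {a | l < f a / F} = ∅ := by
          ext a; simp only [mem_setOf_eq, mem_empty_iff_false, iff_false, not_lt]
          exact ((div_le_one hF).2 (le_ciSup fb a)).trans h1
        have e2 : {a | l < g a / G} = ∅ := by
          ext a; simp only [mem_setOf_eq, mem_empty_iff_false, iff_false, not_lt]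
          exact ((div_le_one hG).2 (le_ciSup gb a)).trans h1
        simp [e1, e2]
      · apply bm1_t ht0 ht1 (measurableSet_lt measurable_const (by fun_prop))
          (measurableSet_lt measurable_const (by fun_prop))
        · obtain ⟨x, hx⟩ := exists_lt_of_lt_ciSup (show l * F < ⨆ x, f x by
            rw [← hFdef]; nlinarith)
          exact ⟨x, by simpa [lt_div_iff₀ hF] using hx⟩
        · obtain ⟨x, hx⟩ := exists_lt_of_lt_ciSup (show l * G < ⨆ x, g x by
            rw [← hGdef]; nlinarith)
          exact ⟨x, by simpa [lt_div_iff₀ hG] using hx⟩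
        · intro x hx y hy
          simp only [mem_setOf_eq, lt_div_iff₀ hF, lt_div_iff₀ hG, lt_div_iff₀ hP] at *
          refine lt_of_lt_of_le ?_ (H x y)
          calc l * (F ^ t * G ^ (1 - t)) = (l * F) ^ t * (l * G) ^ (1 - t) := by
                rw [Real.mul_rpow hl0.le hF.le, Real.mul_rpow hl0.le hG.le]
                have : l ^ t * l ^ (1 - t) = l := by
                  rw [← Real.rpow_add hl0]; simp
                nth_rw 1 [← this]; ring
            _ < f x ^ t * g y ^ (1 - t) := by
                have := Real.rpow_lt_rpow (by positivity) hx ht0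
                have := Real.rpow_lt_rpow (by positivity) hy ht1'
                gcongr
    · apply Measurable.aemeasurable
      apply Measurable.const_mul
      have : Antitone fun l : ℝ => volume {a | l < f a / F} := fun l1 l2 h12 =>
        measure_mono fun a (ha : l2 < _) => lt_of_le_of_lt h12 ha
      exact this.measurable
  have ef : ∫⁻ x, ENNReal.ofReal (f x) = ENNReal.ofReal F * ∫⁻ x, ENNReal.ofReal (f x / F) := by
    rw [← lintegral_const_mul' _ _ ENNReal.ofReal_ne_top]
    congr with x
    rw [← ENNReal.ofReal_mul hF.le]; congr 1; field_simp
  have eg : ∫⁻ x, ENNReal.ofReal (g x) = ENNReal.ofReal G * ∫⁻ x, ENNReal.ofReal (g x / G) := by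
    rw [← lintegral_const_mul' _ _ ENNReal.ofReal_ne_top]
    congr with x
    rw [← ENNReal.ofReal_mul hG.le]; congr 1; field_simp
  have eh : ∫⁻ x, ENNReal.ofReal (h x) = ENNReal.ofReal (F ^ t * G ^ (1 - t)) *
      ∫⁻ x, ENNReal.ofReal (h x / (F ^ t * G ^ (1 - t))) := by
    rw [← lintegral_const_mul' _ _ ENNReal.ofReal_ne_top]
    congr with x
    rw [← ENNReal.ofReal_mul hP.le]; congr 1; field_simp
  rw [ef, eg, eh, ENNReal.ofReal_mul (by positivity), ENNReal.mul_rpow_of_nonneg _ _ ht0.le,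
    ENNReal.mul_rpow_of_nonneg _ _ ht1'.le, ENNReal.ofReal_rpow_of_pos hF,
    ENNReal.ofReal_rpow_of_pos hG]
  have h1 : ∫⁻ x, ENNReal.ofReal (f x / F) ≠ ⊤ := by
    intro h; rw [ef, h, ENNReal.mul_top (by simpa using hF)] at fi; exact fi rfl
  have h2 : ∫⁻ x, ENNReal.ofReal (g x / G) ≠ ⊤ := by
    intro h; rw [eg, h, ENNReal.mul_top (by simpa using hG)] at gi; exact gi rfl
  have amgm : (∫⁻ x, ENNReal.ofReal (f x / F)) ^ t * (∫⁻ x, ENNReal.ofReal (g x / G)) ^ (1 - t)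
      ≤ ENNReal.ofReal t * (∫⁻ x, ENNReal.ofReal (f x / F)) +
      ENNReal.ofReal (1 - t) * (∫⁻ x, ENNReal.ofReal (g x / G)) := by
    lift (∫⁻ x, ENNReal.ofReal (f x / F)) to NNReal using h1 with u
    lift (∫⁻ x, ENNReal.ofReal (g x / G)) to NNReal using h2 with v
    have := Real.geom_mean_le_arith_mean2_weighted ht0.le ht1'.le u.coe_nonneg v.coe_nonneg (by ring)
    have h3 := ENNReal.ofReal_le_ofReal this
    rw [ENNReal.ofReal_add (by positivity) (by positivity), ENNReal.ofReal_mul (by positivity),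
      ENNReal.ofReal_mul ht0.le, ENNReal.ofReal_mul ht1'.le,
      ← ENNReal.ofReal_rpow_of_nonneg u.coe_nonneg ht0.le, ← ENNReal.ofReal_rpow_of_nonneg v.coe_nonneg ht1'.le] at h3
    simpa using h3
  calc _ = ENNReal.ofReal (F ^ t) * ENNReal.ofReal (G ^ (1 - t)) *
      ((∫⁻ x, ENNReal.ofReal (f x / F)) ^ t * (∫⁻ x, ENNReal.ofReal (g x / G)) ^ (1 - t)) := by ring
    _ ≤ _ := by gcongr; exact amgm.trans key


theorem decomp {E : Type*} [NormedAddCommGroup E] [NormedSpace ℝ E] [FiniteDimensional ℝ E]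
    [MeasurableSpace E] [BorelSpace E] (μ : Measure E) [μ.IsAddHaarMeasure]
    (f : E →L[ℝ] ℝ) (h : E) (hf : f h = 1) :
    ∃ ν : Measure (f : E →ₗ[ℝ] ℝ).ker, ν.IsAddHaarMeasure ∧
      ∃ L : E ≃L[ℝ] ℝ × (f : E →ₗ[ℝ] ℝ).ker, MeasurePreserving L μ (volume.prod ν) ∧
        (∀ x, (L x).1 = f x) ∧ (∀ x, ((L x).2 : E) = x - f x • h) := by
  let f2 : ℝ →L[ℝ] E := ContinuousLinearMap.toSpanSingleton ℝ h
  have hr : Function.RightInverse f2 f := fun r => by simp [f2, hf]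
  let L := ContinuousLinearEquiv.equivOfRightInverse f f2 hr
  let ν0 : Measure (f : E →ₗ[ℝ] ℝ).ker := Measure.addHaar
  have : (Measure.map L μ).IsAddHaarMeasure := L.isAddHaarMeasure_map μ
  have e := Measure.isAddLeftInvariant_eq_smul (Measure.map L μ)
    ((volume : Measure ℝ).prod ν0)
  set c := (Measure.map L μ).addHaarScalarFactor ((volume : Measure ℝ).prod ν0) with hc
  have hc0 : c ≠ 0 := by
    have := Measure.addHaarScalarFactor_pos_of_isAddHaarMeasure (Measure.map L μ)
      ((volume : Measure ℝ).prod ν0)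
    exact this.ne'
  refine ⟨(c : ENNReal) • ν0, Measure.IsAddHaarMeasure.smul ν0 (by simpa using hc0)
    ENNReal.coe_ne_top, L, ⟨L.continuous.measurable, ?_⟩, fun x => rfl, fun x => ?_⟩
  · rw [e, Measure.prod_smul_right]; rfl
  · rw [ContinuousLinearEquiv.snd_equivOfRightInverse]; simp [f2]

theorem finrank_ker_f {E : Type*} [NormedAddCommGroup E] [NormedSpace ℝ E]
    [FiniteDimensional ℝ E] (f : E →L[ℝ] ℝ) (h : E) (hf : f h = 1) :
    Module.finrank ℝ (f : E →ₗ[ℝ] ℝ).ker + 1 = Module.finrank ℝ E := by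
  have := (f : E →ₗ[ℝ] ℝ).finrank_range_add_finrank_ker
  have h2 : (f : E →ₗ[ℝ] ℝ).range = ⊤ := by
    rw [LinearMap.range_eq_top]
    intro r
    exact ⟨r • h, by simp [hf]⟩
  rw [h2, finrank_top, Module.finrank_self] at this
  omega

section prod
variable {F : Type*} [NormedAddCommGroup F] [NormedSpace ℝ F] [FiniteDimensional ℝ F]
    [MeasurableSpace F] [BorelSpace F] (ν : Measure F) [ν.IsAddHaarMeasure]

theorem bm_prod_compact {t : ℝ} (ht0 : 0 < t) (ht1 : t < 1)
    (ih : ∀ {A B S : Set F}, IsCompact A → IsCompact B → IsCompact S →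
      (∀ a ∈ A, ∀ b ∈ B, t • a + (1 - t) • b ∈ S) → ν A ^ t * ν B ^ (1 - t) ≤ ν S)
    {A B S : Set (ℝ × F)} (hA : IsCompact A) (hB : IsCompact B) (hS : IsCompact S)
    (H : ∀ a ∈ A, ∀ b ∈ B, t • a + (1 - t) • b ∈ S) :
    (volume.prod ν) A ^ t * (volume.prod ν) B ^ (1 - t) ≤ (volume.prod ν) S := by
  have sl : ∀ {A : Set (ℝ × F)}, IsCompact A → ∀ r, IsCompact (Prod.mk r ⁻¹' A) := by
    intro A hA r
    have : Prod.mk r ⁻¹' A = Prod.snd '' (A ∩ Prod.fst ⁻¹' {r}) := by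
      ext y; simp
    rw [this]
    exact (hA.inter_right (isClosed_singleton.preimage continuous_fst)).image continuous_snd
  have nt : ∀ {A : Set (ℝ × F)}, IsCompact A → ∀ r, ν (Prod.mk r ⁻¹' A) ≠ ⊤ := fun hA r =>
    (sl hA r).measure_lt_top.ne
  have e : ∀ {A : Set (ℝ × F)}, IsCompact A →
      ∫⁻ r, ENNReal.ofReal (ν.real (Prod.mk r ⁻¹' A)) = (volume.prod ν) A := by
    intro A hA
    rw [Measure.prod_apply hA.measurableSet]
    congr with r
    exact ENNReal.ofReal_toReal (nt hA r)
  have m : ∀ {A : Set (ℝ × F)}, IsCompact A → Measurable fun r => ν.real (Prod.mk r ⁻¹' A) :=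
    fun hA => (measurable_measure_prodMk_left hA.measurableSet).ennreal_toReal
  have bd : ∀ {A : Set (ℝ × F)}, IsCompact A →
      BddAbove (range fun r => ν.real (Prod.mk r ⁻¹' A)) := by
    intro A hA
    refine ⟨ν.real (Prod.snd '' A), ?_⟩
    rintro _ ⟨r, rfl⟩
    apply measureReal_mono _ (hA.image continuous_snd).measure_lt_top.ne
    intro y hy
    exact ⟨_, hy, rfl⟩
  rw [← e hA, ← e hB, ← e hS]
  apply pl1 ht0 ht1 (m hA) (m hB) (m hS) (fun _ => measureReal_nonneg) (fun _ => measureReal_nonneg)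
    (fun _ => measureReal_nonneg) (bd hA) (bd hB)
  · rw [e hA]; exact hA.measure_lt_top.ne
  · rw [e hB]; exact hB.measure_lt_top.ne
  · intro x y
    have := ih (sl hA x) (sl hB y) (sl hS (t * x + (1 - t) * y)) (fun a ha b hb => by
      simpa using H _ ha _ hb)
    have h2 := ENNReal.toReal_mono (nt hS _) this
    simpa [ENNReal.toReal_mul, ← ENNReal.toReal_rpow, Measure.real] using h2
end prod

theorem bm_compact.{u} {t : ℝ} (ht0 : 0 < t) (ht1 : t < 1) (n : ℕ) : ∀ {E : Type u}
    [NormedAddCommGroup E] [NormedSpace ℝ E] [FiniteDimensional ℝ E]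
    [MeasurableSpace E] [BorelSpace E] (μ : Measure E) [μ.IsAddHaarMeasure]
    (_ : Module.finrank ℝ E = n)
    {A B S : Set E}, IsCompact A → IsCompact B → IsCompact S →
      (∀ a ∈ A, ∀ b ∈ B, t • a + (1 - t) • b ∈ S) → μ A ^ t * μ B ^ (1 - t) ≤ μ S := by
  have ht1' : 0 < 1 - t := sub_pos.2 ht1
  induction n with
  | zero =>
    intro E _ _ _ _ _ μ _ hn A B S hA hB hS H
    have : Subsingleton E := Module.finrank_zero_iff.1 hn
    rcases A.eq_empty_or_nonempty with rfl | ⟨a, ha⟩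
    · simp [ENNReal.zero_rpow_of_pos ht0]
    rcases B.eq_empty_or_nonempty with rfl | ⟨b, hb⟩
    · simp [ENNReal.zero_rpow_of_pos ht1']
    have hu : ∀ {T : Set E} {x}, x ∈ T → T = univ := fun {T x} hx => by
      ext y; simp [Subsingleton.elim y x, hx]
    rw [hu ha, hu hb, hu (H a ha b hb)]
    have h0 : μ univ ≠ 0 := (isOpen_univ.measure_pos μ ⟨a, trivial⟩).ne'
    have h1 : μ univ ≠ ⊤ := by rw [← hu ha]; exact hA.measure_lt_top.ne
    rw [← ENNReal.rpow_add _ _ h0 h1]; simp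
  | succ n ih =>
    intro E _ _ _ _ _ μ _ hn A B S hA hB hS H
    have : Nontrivial E := Module.nontrivial_of_finrank_pos (R := ℝ) (by omega)
    obtain ⟨h, hh⟩ := exists_ne (0 : E)
    obtain ⟨f, hf⟩ := SeparatingDual.exists_eq_one (R := ℝ) hh
    obtain ⟨ν, hν, L, hL, -, -⟩ := decomp μ f h hf
    have hfr := finrank_ker_f f h hf
    have me : ∀ T : Set E, μ T = (volume.prod ν) (L '' T) := fun T => by
      rw [← hL.measure_preimage_equiv (f := L.toHomeomorph.toMeasurableEquiv)]
      congr 1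
      exact (L.injective.preimage_image T).symm
    rw [me A, me B, me S]
    apply bm_prod_compact ν ht0 ht1 (fun hA hB hS => ih ν (by omega) hA hB hS)
      (hA.image L.continuous) (hB.image L.continuous) (hS.image L.continuous)
    rintro _ ⟨a, ha, rfl⟩ _ ⟨b, hb, rfl⟩
    exact ⟨_, H a ha b hb, by simp⟩

/-- Multiplicative Brunn-Minkowski. -/
theorem bm {E : Type*} [NormedAddCommGroup E] [NormedSpace ℝ E] [FiniteDimensional ℝ E]
    [MeasurableSpace E] [BorelSpace E] (μ : Measure E) [μ.IsAddHaarMeasure]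
    {t : ℝ} (ht0 : 0 < t) (ht1 : t < 1) {A B S : Set E} (hA : MeasurableSet A)
    (hB : MeasurableSet B) (H : ∀ a ∈ A, ∀ b ∈ B, t • a + (1 - t) • b ∈ S) :
    μ A ^ t * μ B ^ (1 - t) ≤ μ S := by
  have ht1' : 0 < 1 - t := sub_pos.2 ht1
  have step : ∀ K1 ⊆ A, IsCompact K1 → ∀ K2 ⊆ B, IsCompact K2 →
      μ K1 ^ t * μ K2 ^ (1 - t) ≤ μ S := by
    intro K1 h1 c1 K2 h2 c2
    have := bm_compact ht0 ht1 _ μ rfl c1 c2 ((c1.smul t).add (c2.smul (1 - t)))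
      (fun a ha b hb => add_mem_add (smul_mem_smul_set ha) (smul_mem_smul_set hb))
    refine this.trans (measure_mono ?_)
    rintro _ ⟨_, ⟨x, hx, rfl⟩, _, ⟨y, hy, rfl⟩, rfl⟩
    exact H x (h1 hx) y (h2 hy)
  rcases eq_or_ne (μ A) 0 with h | h
  · simp [h, ENNReal.zero_rpow_of_pos ht0]
  rcases eq_or_ne (μ B) 0 with h' | h'
  · simp [h', ENNReal.zero_rpow_of_pos ht1']
  refine ENNReal.mul_le_of_forall_lt fun a ha b hb => ?_
  have ha' : a ^ (1 / t) < μ A := by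
    have := ENNReal.rpow_lt_rpow ha (z := 1 / t) (by positivity)
    rwa [← ENNReal.rpow_mul, mul_one_div_cancel ht0.ne', ENNReal.rpow_one] at this
  have hb' : b ^ (1 / (1 - t)) < μ B := by
    have := ENNReal.rpow_lt_rpow hb (z := 1 / (1 - t)) (by positivity)
    rwa [← ENNReal.rpow_mul, mul_one_div_cancel ht1'.ne', ENNReal.rpow_one] at this
  obtain ⟨K1, hK1, hK1c, hK1m⟩ := hA.exists_lt_isCompact ha'
  obtain ⟨K2, hK2, hK2c, hK2m⟩ := hB.exists_lt_isCompact hb'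
  refine le_trans ?_ (step K1 hK1 hK1c K2 hK2 hK2c)
  gcongr
  · have := ENNReal.rpow_le_rpow hK1m.le ht0.le
    rwa [← ENNReal.rpow_mul, one_div_mul_cancel ht0.ne', ENNReal.rpow_one] at this
  · have := ENNReal.rpow_le_rpow hK2m.le ht1'.le
    rwa [← ENNReal.rpow_mul, one_div_mul_cancel ht1'.ne', ENNReal.rpow_one] at this

theorem sub_bm {F : Type*} [NormedAddCommGroup F] [NormedSpace ℝ F] [FiniteDimensional ℝ F]
    [MeasurableSpace F] [BorelSpace F] (ν : Measure F) [ν.IsAddHaarMeasure]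
    {t : ℝ} (ht0 : 0 < t) (ht1 : t < 1) {U V W : Set F} (hU : MeasurableSet U)
    (hV : MeasurableSet V) (hW : MeasurableSet W) {p q r : F → ℝ} (hp : Measurable p)
    (hq : Measurable q) (hr : Measurable r)
    (H : ∀ y ∈ U, ∀ y' ∈ V, t • y + (1 - t) • y' ∈ W ∧
      t * p y + (1 - t) * q y' ≤ r (t • y + (1 - t) • y')) :
    (∫⁻ y in U, ENNReal.ofReal (p y) ∂ν) ^ t * (∫⁻ y in V, ENNReal.ofReal (q y) ∂ν) ^ (1 - t) ≤
      ∫⁻ y in W, ENNReal.ofReal (r y) ∂ν := by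
  have e : ∀ {p : F → ℝ} {U : Set F}, Measurable p → MeasurableSet U →
      ∫⁻ y in U, ENNReal.ofReal (p y) ∂ν = (ν.prod volume) (regionBetween (fun _ => 0) p U) := by
    intro p U hp hU
    rw [volume_regionBetween_eq_lintegral measurable_const.aemeasurable hp.aemeasurable hU]
    simp
  rw [e hp hU, e hq hV, e hr hW]
  apply bm (ν.prod volume) ht0 ht1 (measurableSet_regionBetween measurable_const hp hU)
    (measurableSet_regionBetween measurable_const hq hV)
  rintro ⟨y, a⟩ ⟨hy, ha0, ha⟩ ⟨y', b⟩ ⟨hy', hb0, hb⟩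
  obtain ⟨h1, h2⟩ := H y hy y' hy'
  have ht1' : 0 < 1 - t := sub_pos.2 ht1
  simp only at ha0 ha hb0 hb hy hy'
  refine ⟨by simpa using h1, ?_, ?_⟩
  · simp; positivity
  · simp only [Prod.smul_mk, Prod.mk_add_mk, smul_eq_mul]
    refine lt_of_lt_of_le ?_ h2
    gcongr

theorem conv_int {G : Type*} [AddCommGroup G] [MeasurableSpace G] [MeasurableAdd₂ G]
    [MeasurableNeg G] (μ : Measure G) [SFinite μ] [μ.IsAddLeftInvariant] [μ.IsNegInvariant]
    {X Y : Set G} (hX : MeasurableSet X)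
    (hY : MeasurableSet Y) : ∫⁻ s, μ {x | x ∈ X ∧ x - s ∈ Y} ∂μ = μ X * μ Y := by
  have hm : MeasurableSet {p : G × G | p.2 ∈ X ∧ p.2 - p.1 ∈ Y} := by
    refine (hX.preimage measurable_snd).inter (hY.preimage ?_)
    exact measurable_snd.sub measurable_fst
  have h1 := Measure.prod_apply (μ := μ) (ν := μ) hm
  have h2 := Measure.prod_apply_symm (μ := μ) (ν := μ) hm
  rw [h1] at h2
  simp only [preimage_ofPred_eq] at h2
  rw [h2]
  have : ∀ x, μ {s | x ∈ X ∧ x - s ∈ Y} = X.indicator (fun _ => μ Y) x := by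
    intro x
    by_cases hx : x ∈ X
    · simp only [hx, true_and, indicator_of_mem]
      exact (Measure.measurePreserving_sub_left μ x).measure_preimage hY.nullMeasurableSet
    · simp [hx]
  simp only [this]
  rw [lintegral_indicator_const hX, mul_comm]


abbrev TT := AddCircle (1 : ℝ)

theorem circ_case1 {X Y : Set TT} (hX : IsCompact X) (hY : IsCompact Y) (hX0 : X.Nonempty)
    (hY0 : Y.Nonempty) (hne : X - Y ≠ univ) : ∃ s : TT, (X ∩ (s +ᵥ Y)).Nonempty ∧
      volume (X ∩ (s +ᵥ Y)) = 0 := by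
  have hD : IsClosed (X - Y) := by
    rw [sub_eq_add_neg]; exact (hX.add hY.neg).isClosed
  have : ∃ s ∈ X - Y, s ∈ closure (X - Y)ᶜ := by
    by_contra! hcon
    have ho : IsOpen (X - Y) := by
      rw [← compl_compl (X - Y), isOpen_compl_iff]
      apply isClosed_of_closure_subset
      intro s hs hs'
      exact hcon s hs' hs
    rcases isClopen_iff.1 ⟨hD, ho⟩ with h | h
    · exact (hX0.sub hY0).ne_empty h
    · exact hne h
  obtain ⟨s, hs, hsc⟩ := this
  refine ⟨s, ?_, ?_⟩
  · obtain ⟨x, hx, y, hy, rfl⟩ := hs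
    exact ⟨x, hx, y, hy, by simp⟩
  refine le_antisymm (ENNReal.le_of_forall_pos_le_add fun ε hε _ => ?_) zero_le
  rw [zero_add]
  obtain ⟨U, hU, hUo, hUm⟩ := (hY.vadd s).exists_isOpen_lt_add (μ := volume)
    (ε := (ε : ENNReal)) (by simpa using hε.ne')
  obtain ⟨V, hV, hVU⟩ := compact_open_separated_add_left (hY.vadd s) hUo hU
  have : (fun z => z - s) ⁻¹' V ∈ nhds s := by
    apply (continuous_sub_right s).continuousAt.preimage_mem_nhds
    simpa using hV
  obtain ⟨s', hs'V, hs'⟩ := mem_closure_iff_nhds.1 hsc _ this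
  have h1 : s' +ᵥ Y ⊆ U := by
    rintro _ ⟨y, hy, rfl⟩
    apply hVU
    refine ⟨s' - s, hs'V, s + y, ⟨y, hy, rfl⟩, ?_⟩
    simp only [vadd_eq_add]; abel
  have h2 : Disjoint (X ∩ (s +ᵥ Y)) (s' +ᵥ Y) := by
    rw [disjoint_left]
    rintro x ⟨hx, -⟩ ⟨y, hy, rfl⟩
    exact hs' ⟨_, hx, y, hy, by simp⟩
  have h3 : volume (X ∩ (s +ᵥ Y)) + volume Y ≤ volume Y + ε := by
    calc _ = volume (X ∩ (s +ᵥ Y)) + volume (s' +ᵥ Y) := by rw [measure_vadd]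
      _ = volume ((X ∩ (s +ᵥ Y)) ∪ (s' +ᵥ Y)) :=
        (measure_union h2 (hY.vadd s').measurableSet).symm
      _ ≤ volume U := measure_mono (union_subset (inter_subset_right.trans hU) h1)
      _ ≤ _ := by rw [measure_vadd] at hUm; exact hUm.le
  rw [add_comm] at h3
  exact (ENNReal.add_le_add_iff_left hY.measure_lt_top.ne).1 h3

theorem circ_case2 {X Y : Set TT} (hX : IsCompact X) (hY : IsCompact Y) :
    ∃ s : TT, volume (X ∩ (s +ᵥ Y)) ≤ volume X * volume Y := by
  have h := conv_int volume hX.measurableSet hY.measurableSet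
  by_contra! hcon
  have e : ∀ s : TT, {x | x ∈ X ∧ x - s ∈ Y} = X ∩ (s +ᵥ Y) := by
    intro s; ext x
    simp only [mem_ofPred_eq, mem_inter_iff, mem_vadd_set_iff_neg_vadd_mem, vadd_eq_add]
    rw [neg_add_eq_sub]
  simp only [e] at h
  have h1 : ∫⁻ s : TT, (volume X * volume Y) = volume X * volume Y := by
    rw [lintegral_const]; simp
  have h2 : ∫⁻ s : TT, (volume X * volume Y) < ∫⁻ s : TT, volume (X ∩ (s +ᵥ Y)) := by
    apply lintegral_strict_mono (NeZero.ne _) ?_ ?_ (Filter.Eventually.of_forall hcon)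
    · have hm : MeasurableSet {p : TT × TT | p.2 ∈ X ∧ p.2 - p.1 ∈ Y} :=
        (hX.measurableSet.preimage measurable_snd).inter
          (hY.measurableSet.preimage (measurable_snd.sub measurable_fst))
      have := measurable_measure_prodMk_left (ν := (volume : Measure TT)) hm
      simp only [preimage_ofPred_eq, e] at this
      exact this.aemeasurable
    · rw [h1]
      exact ENNReal.mul_ne_top hX.measure_lt_top.ne hY.measure_lt_top.ne
  rw [h1, h] at h2
  exact lt_irrefl _ h2

theorem circ_triv {X Y : Set TT} {x : TT} (hx : x ∈ X) :
    volume.real Y ≤ volume.real (X + Y) := by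
  have : volume.real (x +ᵥ Y) = volume.real Y := by simp [Measure.real]
  rw [← this]
  refine measureReal_mono ?_
  rintro _ ⟨y, hy, rfl⟩; exact add_mem_add hx hy

theorem circ_shift {X Y : Set TT} (s : TT) :
    volume.real ((X ∩ (s +ᵥ Y)) + (X ∪ (s +ᵥ Y))) ≤ volume.real (X + Y) := by
  have : volume.real (s +ᵥ (X + Y)) = volume.real (X + Y) := by simp [Measure.real]
  rw [← this]
  refine measureReal_mono ?_
  rintro _ ⟨u, ⟨hu1, y, hy, rfl⟩, v, hv | ⟨y', hy', rfl⟩, rfl⟩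
  · exact ⟨v + y, add_mem_add hv hy, by simp only [vadd_eq_add]; abel⟩
  · exact ⟨(s +ᵥ y) + y', add_mem_add hu1 hy', by simp only [vadd_eq_add]; abel⟩

theorem circ_sum {X Y : Set TT} (hY : IsCompact Y) (s : TT) :
    volume.real (X ∩ (s +ᵥ Y)) + volume.real (X ∪ (s +ᵥ Y)) = volume.real X + volume.real Y := by
  have : volume.real (s +ᵥ Y) = volume.real Y := by simp [Measure.real]
  rw [← this, add_comm, measureReal_union_add_inter (hY.vadd s).measurableSet]

theorem circ_aux {ε : ℝ} (hε : 0 < ε) (hε1 : ε < 1) (k : ℕ) : ∀ {X Y : Set TT}, IsCompact X →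
    IsCompact Y → X.Nonempty → Y.Nonempty → volume.real X + volume.real Y ≤ 1 →
    volume.real X + volume.real Y - max ε ((1 - ε) ^ k * volume.real X) ≤ volume.real (X + Y) := by
  induction k with
  | zero =>
    intro X Y hX hY ⟨x, hx⟩ hY0 hm
    have h1 := circ_triv (Y := Y) hx
    have := le_max_right ε ((1 - ε) ^ 0 * volume.real X)
    simp only [pow_zero, one_mul] at this ⊢
    linarith
  | succ k ih =>
    intro X Y hX hY hX0 hY0 hm
    have hpos : 0 ≤ max ε ((1 - ε) ^ (k + 1) * volume.real X) := le_max_of_le_left hε.le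
    by_cases hne : X - Y = univ
    · rcases le_or_gt (volume.real X) ε with hx | hx
      · obtain ⟨x, hx'⟩ := hX0
        have h1 := circ_triv (Y := Y) hx'
        have := le_max_left ε ((1 - ε) ^ (k + 1) * volume.real X)
        linarith
      obtain ⟨s, hs⟩ := circ_case2 hX hY
      have hs' : volume.real (X ∩ (s +ᵥ Y)) ≤ volume.real X * volume.real Y := by
        have := ENNReal.toReal_mono
          (ENNReal.mul_ne_top hX.measure_lt_top.ne hY.measure_lt_top.ne) hs
        simpa [ENNReal.toReal_mul, Measure.real] using this
      have hn : (X ∩ (s +ᵥ Y)).Nonempty := by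
        have : s ∈ X - Y := hne ▸ mem_univ s
        obtain ⟨x, hx, y, hy, rfl⟩ := this
        exact ⟨x, hx, y, hy, by simp⟩
      have h3 := ih (hX.inter (hY.vadd s)) (hX.union (hY.vadd s)) hn (hX0.mono subset_union_left)
        (by rw [circ_sum hY]; exact hm)
      rw [circ_sum hY] at h3
      have h4 := circ_shift (X := X) (Y := Y) s
      have h5 : max ε ((1 - ε) ^ k * volume.real (X ∩ (s +ᵥ Y))) ≤
          max ε ((1 - ε) ^ (k + 1) * volume.real X) := by
        apply max_le_max le_rfl
        rw [pow_succ, mul_assoc]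
        have : 0 ≤ (1 - ε) ^ k := pow_nonneg (by linarith) _
        refine mul_le_mul_of_nonneg_left (hs'.trans ?_) this
        have h0 : 0 ≤ volume.real X := measureReal_nonneg
        nlinarith
      linarith
    · obtain ⟨s, ⟨x, hx⟩, hs⟩ := circ_case1 hX hY hX0 hY0 hne
      have h1 := circ_shift (X := X) (Y := Y) s
      have h2 := circ_triv (Y := X ∪ (s +ᵥ Y)) hx
      have h3 := circ_sum (X := X) hY s
      have : volume.real (X ∩ (s +ᵥ Y)) = 0 := by simp [Measure.real, hs]
      linarith

theorem circ {X Y : Set TT} (hX : IsCompact X) (hY : IsCompact Y) (hX0 : X.Nonempty)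
    (hY0 : Y.Nonempty) : min 1 (volume.real X + volume.real Y) ≤ volume.real (X + Y) := by
  rcases le_or_gt (volume.real X + volume.real Y) 1 with hm | hm
  · rw [min_eq_right hm]
    refine le_of_forall_pos_le_add fun ε hε => ?_
    set e := min ε (1 / 2)
    have he0 : 0 < e := by positivity
    have he1 : e < 1 := lt_of_le_of_lt (min_le_right _ _) (by norm_num)
    obtain ⟨k, hk⟩ := exists_pow_lt_of_lt_one he0 (show 1 - e < 1 by linarith)
    have := circ_aux he0 he1 k hX hY hX0 hY0 hm
    have h1 : max e ((1 - e) ^ k * volume.real X) ≤ e := by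
      apply max_le le_rfl
      have h0 : 0 ≤ volume.real X := measureReal_nonneg
      have h0' : 0 ≤ volume.real Y := measureReal_nonneg
      have : 0 ≤ (1 - e) ^ k := pow_nonneg (by linarith) _
      nlinarith
    have h2 : e ≤ ε := min_le_left _ _
    linarith
  · have : X + Y = univ := by
      ext z
      simp only [mem_univ, iff_true]
      by_contra hz
      have hd : Disjoint X ((fun y => z - y) '' Y) := by
        rw [disjoint_left]
        rintro x hx ⟨y, hy, rfl⟩
        exact hz ⟨_, hx, y, hy, by simp⟩
      have hc : IsCompact ((fun y => z - y) '' Y) := hY.image (by fun_prop)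
      have h1 := measureReal_union (μ := (volume : Measure TT)) hd hc.measurableSet
      have h2 : volume.real ((fun y => z - y) '' Y) = volume.real Y := by
        have := (Measure.measurePreserving_sub_left (volume : Measure TT) z).measure_preimage
          hc.measurableSet.nullMeasurableSet
        rw [preimage_image_eq _ (sub_right_injective)] at this
        simp [Measure.real, this]
      have h3 : volume.real (X ∪ (fun y => z - y) '' Y) ≤ 1 := by
        have : volume.real (univ : Set TT) = 1 := by simp [Measure.real]
        exact (measureReal_mono (subset_univ _)).trans this.le
      linarith
    rw [this]
    simp [Measure.real]

theorem fr_core {X Y : Set ℝ} (hX : IsCompact X) (hY : IsCompact Y) (hX1 : X ⊆ Icc 0 1)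
    (hY1 : Y ⊆ Icc 0 1) (h0 : (0 : ℝ) ∈ X) (h1 : (1 : ℝ) ∈ X) (hy0 : (0 : ℝ) ∈ Y) :
    min 1 (volume.real X + volume.real Y) + volume.real Y ≤ volume.real (X + Y) := by
  have hZ : IsCompact (X + Y) := hX.add hY
  have ic : ∀ {X : Set ℝ}, X ⊆ Icc 0 1 → volume.real (X ∩ Ioc 0 1) = volume.real X := by
    intro X hX
    have h : (X ∩ Ioc 0 1 : Set ℝ) =ᵐ[volume] (X ∩ Icc 0 1 : Set ℝ) :=
      (ae_eq_refl X).inter Ioc_ae_eq_Icc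
    rw [Measure.real, Measure.real, measure_congr h, inter_eq_left.2 hX]
  let π : ℝ → TT := QuotientAddGroup.mk
  have hπ : Continuous π := AddCircle.continuous_mk' 1
  have hmp := AddCircle.measurePreserving_mk 1 0
  rw [zero_add] at hmp
  have pm : ∀ {X : Set ℝ}, IsCompact X → volume (π '' X) = volume (π ⁻¹' (π '' X) ∩ Ioc 0 1) := by
    intro X hX
    have hm := (hX.image hπ).measurableSet
    rw [← hmp.measure_preimage hm.nullMeasurableSet, Measure.restrict_apply]
    exact hm.preimage hπ.measurable
  have pl : ∀ {X : Set ℝ}, IsCompact X → X ⊆ Icc 0 1 → volume.real X ≤ volume.real (π '' X) := by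
    intro X hX hX1
    rw [← ic hX1]
    unfold Measure.real
    rw [pm hX]
    apply ENNReal.toReal_mono
    · exact (measure_mono inter_subset_right |>.trans_lt (by simp)).ne
    · exact measure_mono (inter_subset_inter_left _ (subset_preimage_image _ _))
  have hc := circ (hX.image hπ) (hY.image hπ) ⟨_, 0, h0, rfl⟩ ⟨_, 0, hy0, rfl⟩
  have hsum : π '' X + π '' Y = π '' (X + Y) := by
    exact (image_add (QuotientAddGroup.mk' (AddSubgroup.zmultiples (1 : ℝ)))).symm
  rw [hsum] at hc
  set Z := X + Y with hZdef
  set Z0 := Z ∩ Ioc 0 1 with hZ0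
  set W1 := (fun z => z + 1) ⁻¹' Z ∩ Ioc 0 1 with hW1
  have hm0 : MeasurableSet Z0 := hZ.measurableSet.inter measurableSet_Ioc
  have hm1 : MeasurableSet W1 :=
    (hZ.measurableSet.preimage (by fun_prop)).inter measurableSet_Ioc
  have fin0 : volume Z0 ≠ ⊤ := (measure_mono inter_subset_right |>.trans_lt (by simp)).ne
  have fin1 : volume W1 ≠ ⊤ := (measure_mono inter_subset_right |>.trans_lt (by simp)).ne
  have a1 : volume.real (π '' Z) ≤ volume.real (Z0 ∪ W1) := by
    unfold Measure.real
    rw [pm hZ]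
    apply ENNReal.toReal_mono (measure_union_lt_top fin0.lt_top fin1.lt_top).ne
    apply measure_mono
    rintro r ⟨⟨z, hz, hzr⟩, hr⟩
    have hz2 : 0 ≤ z ∧ z ≤ 2 := by
      obtain ⟨x, hx, y, hy, rfl⟩ := hz
      have := hX1 hx; have := hY1 hy
      simp only [mem_Icc] at *
      constructor <;> linarith
    have hzr' : ((z - r : ℝ) : TT) = 0 := by
      rw [AddCircle.coe_sub, sub_eq_zero]; exact hzr
    obtain ⟨m, hm⟩ := AddCircle.coe_eq_zero_iff (1 : ℝ) |>.1 hzr'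
    rw [zsmul_eq_mul, mul_one] at hm
    simp only [mem_Ioc] at hr
    have m1 : (m : ℝ) < 2 := by linarith
    have m2 : (-2 : ℝ) < m := by linarith
    have m1' : m < 2 := by exact_mod_cast m1
    have m2' : -2 < m := by exact_mod_cast m2
    have m3 : m = -1 ∨ m = 0 ∨ m = 1 := by omega
    rcases m3 with rfl | rfl | rfl
    · push_cast at hm
      have : r = 1 := by linarith
      subst this
      exact Or.inl ⟨⟨1, h1, 0, hy0, by simp⟩, by simp⟩
    · push_cast at hm
      have : r = z := by linarith
      subst this
      exact Or.inl ⟨hz, hr⟩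
    · push_cast at hm
      have : r + 1 = z := by linarith
      refine Or.inr ⟨?_, hr⟩
      show r + 1 ∈ Z
      rw [this]; exact hz
  have a2 : volume.real Y ≤ volume.real (Z0 ∩ W1) := by
    rw [← ic hY1]
    refine measureReal_mono ?_ (measure_mono inter_subset_left |>.trans_lt fin0.lt_top).ne
    rintro y ⟨hy, hy1⟩
    exact ⟨⟨⟨0, h0, y, hy, by simp⟩, hy1⟩, ⟨1, h1, y, hy, by simp [add_comm]⟩, hy1⟩
  have a3 : volume.real Z0 + volume.real W1 ≤ volume.real Z := by
    have e : volume.real W1 = volume.real ((fun z => z + 1) '' W1) := by simp [Measure.real]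
    rw [e, ← measureReal_union (h₁ := fin0) (h₂ := by simpa using fin1)]
    · refine measureReal_mono ?_ hZ.measure_lt_top.ne
      rintro z (⟨hz, -⟩ | ⟨w, ⟨hw, -⟩, rfl⟩)
      · exact hz
      · exact hw
    · rw [disjoint_left]
      rintro z ⟨-, hz⟩ ⟨w, ⟨-, hw⟩, rfl⟩
      simp only [mem_Ioc] at *
      linarith
    · rw [image_add_right]
      exact hm1.preimage (by fun_prop)
  have a4 := measureReal_union_add_inter (μ := (volume : Measure ℝ)) (s := Z0) hm1 fin0 fin1
  have a5 : min 1 (volume.real X + volume.real Y) ≤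
      min 1 (volume.real (π '' X) + volume.real (π '' Y)) :=
    min_le_min le_rfl (add_le_add (pl hX hX1) (pl hY hY1))
  linarith


theorem fr1 {X Y : Set ℝ} (hX : IsCompact X) (hY : IsCompact Y) {x0 x1 y0 y1 : ℝ}
    (hX1 : X ⊆ Icc x0 x1) (hY1 : Y ⊆ Icc y0 y1) (h0 : x0 ∈ X) (h1 : x1 ∈ X) (hy0 : y0 ∈ Y)
    (hD : y1 - y0 ≤ x1 - x0) :
    min (x1 - x0) (volume.real X + volume.real Y) + volume.real Y ≤ volume.real (X + Y) := by
  have hx01 : x0 ≤ x1 := (hX1 h0).2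
  rcases hx01.eq_or_lt with he | hlt
  · have hYz : volume.real Y = 0 := by
      have : Y ⊆ Icc y0 y0 := hY1.trans (Icc_subset_Icc_right (by linarith))
      have h := measureReal_mono (μ := (volume : Measure ℝ)) this (by simp)
      have h2 : volume.real (Icc y0 y0) = 0 := by simp [Measure.real]
      linarith [measureReal_nonneg (μ := (volume : Measure ℝ)) (s := Y)]
    have := min_le_left (x1 - x0) (volume.real X + volume.real Y)
    have := measureReal_nonneg (μ := (volume : Measure ℝ)) (s := X + Y)
    linarith
  set D := x1 - x0 with hDd
  have hD0 : 0 < D := by linarith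
  have sc : ∀ (X : Set ℝ) (c : ℝ), volume.real (D⁻¹ • (c +ᵥ X)) = D⁻¹ * volume.real X := by
    intro X c
    unfold Measure.real
    rw [Measure.addHaar_smul, measure_vadd]
    simp [ENNReal.toReal_mul, abs_of_pos hD0, hD0.le]
  have key := fr_core (X := D⁻¹ • (-x0 +ᵥ X)) (Y := D⁻¹ • (-y0 +ᵥ Y)) ((hX.vadd _).smul _)
    ((hY.vadd _).smul _) ?_ ?_ ?_ ?_ ?_
  · have e : D⁻¹ • (-x0 +ᵥ X) + D⁻¹ • (-y0 +ᵥ Y) = D⁻¹ • ((-x0-y0) +ᵥ (X + Y)) := by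
      rw [← smul_add, ← add_vadd_add_comm, sub_eq_add_neg]
    rw [e, sc, sc, sc] at key
    have : min D (volume.real X + volume.real Y) =
        D * min 1 (D⁻¹ * volume.real X + D⁻¹ * volume.real Y) := by
      rw [mul_min_of_nonneg _ _ hD0.le]
      congr 1
      · ring
      · field_simp
    rw [this]
    have k2 := mul_le_mul_of_nonneg_left key hD0.le
    have e3 : D * (D⁻¹ * volume.real (X + Y)) = volume.real (X + Y) := by field_simp
    have e4 : D * (D⁻¹ * volume.real Y) = volume.real Y := by field_simp
    rw [e3, mul_add, e4] at k2
    exact k2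
  · rintro _ ⟨_, ⟨x, hx, rfl⟩, rfl⟩
    have := hX1 hx
    simp only [mem_Icc, vadd_eq_add, smul_eq_mul] at *
    constructor
    · apply mul_nonneg (by positivity); linarith
    · rw [inv_mul_le_iff₀ hD0]; linarith
  · rintro _ ⟨_, ⟨x, hx, rfl⟩, rfl⟩
    have := hY1 hx
    simp only [mem_Icc, vadd_eq_add, smul_eq_mul] at *
    constructor
    · apply mul_nonneg (by positivity); linarith
    · rw [inv_mul_le_iff₀ hD0]; linarith
  · exact ⟨_, ⟨x0, h0, rfl⟩, by simp⟩
  · exact ⟨_, ⟨x1, h1, rfl⟩, by simp [add_comm]; rw [← sub_eq_add_neg]; field_simp; exact hDd.symm⟩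
  · exact ⟨_, ⟨y0, hy0, rfl⟩, by simp⟩

theorem fr {X Y : Set ℝ} (hX : IsCompact X) (hY : IsCompact Y) (hX0 : X.Nonempty)
    (hY0 : Y.Nonempty) {x0 x1 g : ℝ} (hX1 : X ⊆ Icc x0 x1) (h0 : x0 ∈ X) (h1 : x1 ∈ X)
    (g1 : 2 * g ≤ x1 - x0 - volume.real X) (g2 : g ≤ volume.real X) (g3 : g ≤ volume.real Y) :
    volume.real X + volume.real Y + g ≤ volume.real (X + Y) := by
  obtain ⟨y0, hy0⟩ := hY.exists_isLeast hY0
  obtain ⟨y1, hy1⟩ := hY.exists_isGreatest hY0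
  have hY1 : Y ⊆ Icc y0 y1 := fun y hy => ⟨hy0.2 hy, hy1.2 hy⟩
  have nX := measureReal_nonneg (μ := (volume : Measure ℝ)) (s := X)
  have nY := measureReal_nonneg (μ := (volume : Measure ℝ)) (s := Y)
  by_cases hD : y1 - y0 ≤ x1 - x0
  · have := fr1 hX hY hX1 hY1 h0 h1 hy0.1 hD
    rcases min_cases (x1 - x0) (volume.real X + volume.real Y) with h | h
    · rcases le_or_gt g 0 with hg | hg
      · have b := bm1_compact hX hY hX0 hY0
        have b' := ENNReal.toReal_mono (hX.add hY).measure_lt_top.ne b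
        rw [ENNReal.toReal_add hX.measure_lt_top.ne hY.measure_lt_top.ne] at b'
        unfold Measure.real
        linarith
      · rw [h.1] at this
        linarith
    · rw [h.1] at this
      linarith
  · push Not at hD
    have f1 := fr1 hY hX hY1 hX1 hy0.1 hy1.1 h0 hD.le
    rw [add_comm Y X] at f1
    rcases min_cases (y1 - y0) (volume.real Y + volume.real X) with h | h
    swap
    · rw [h.1] at f1; linarith
    rw [h.1] at f1
    -- second bound
    have hx01 : x0 ≤ x1 := (hX1 h0).2
    have c : volume.real (Icc (y0 + x0) (y1 + x1)) ≤
        volume.real (X + Y) + 2 * (y1 - y0 - volume.real Y) := by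
      have cov : Icc (y0 + x0) (y1 + x1) ⊆
          (X + Y) ∪ ((x0 +ᵥ (Icc y0 y1 \ Y)) ∪ (x1 +ᵥ (Icc y0 y1 \ Y))) := by
        intro z hz
        simp only [mem_Icc] at hz
        by_contra hc
        simp only [mem_union, not_or] at hc
        obtain ⟨c1, c2, c3⟩ := hc
        rcases le_or_gt z (y1 + x0) with hz1 | hz1
        · apply c2
          refine ⟨z - x0, ⟨⟨by linarith, by linarith⟩, fun hy => c1 ⟨x0, h0, _, hy, by simp⟩⟩, by simp⟩
        · apply c3
          refine ⟨z - x1, ⟨⟨by linarith, by linarith⟩, fun hy => c1 ⟨x1, h1, _, hy, by simp⟩⟩, by simp⟩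
      have d : volume.real (Icc y0 y1 \ Y) = y1 - y0 - volume.real Y := by
        rw [measureReal_sdiff hY1 hY.measurableSet (by simp)]
        simp [Measure.real, (hY1 hy0.1).2]
      have dv : ∀ x : ℝ, volume.real (x +ᵥ (Icc y0 y1 \ Y)) = y1 - y0 - volume.real Y := by
        intro x; rw [← d]; unfold Measure.real; rw [measure_vadd]
      have fin : volume (Icc y0 y1 \ Y) < ⊤ := (measure_mono sdiff_subset).trans_lt (by simp)
      have m1 := measureReal_mono (μ := (volume : Measure ℝ)) cov (by
        refine (measure_union_lt_top (hX.add hY).measure_lt_top (measure_union_lt_top ?_ ?_)).ne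
        · rw [measure_vadd]; exact fin
        · rw [measure_vadd]; exact fin)
      have m2 := measureReal_union_le (μ := (volume : Measure ℝ)) (X + Y)
        ((x0 +ᵥ (Icc y0 y1 \ Y)) ∪ (x1 +ᵥ (Icc y0 y1 \ Y)))
      have m3 := measureReal_union_le (μ := (volume : Measure ℝ))
        (x0 +ᵥ (Icc y0 y1 \ Y)) (x1 +ᵥ (Icc y0 y1 \ Y))
      rw [dv, dv] at m3
      linarith
    have c2 : volume.real (Icc (y0 + x0) (y1 + x1)) = y1 + x1 - (y0 + x0) := by
      rw [Real.volume_real_Icc_of_le]; linarith [(hY1 hy0.1).2]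
    rw [c2] at c
    linarith

/-- The form used later. -/
theorem fr_beta {X Y : Set ℝ} (hX : IsCompact X) (hY : IsCompact Y) (hX0 : X.Nonempty)
    (hY0 : Y.Nonempty) {t c ℓ s : ℝ} (ht0 : 0 < t) (ht1 : t < 1) (hs0 : 0 ≤ s) (hs1 : s ≤ 1)
    (hc0 : 0 ≤ c) (hc : c ≤ 1 / 2)
    (hb : c * volume.real {r | r ∈ X ∧ r + ℓ ∈ X ∧ r + s * ℓ ∉ X} ≤ (1 - t) * volume.real Y) :
    t * (volume.real X + c * volume.real {r | r ∈ X ∧ r + ℓ ∈ X ∧ r + s * ℓ ∉ X}) +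
      (1 - t) * volume.real Y ≤ volume.real (t • X + (1 - t) • Y) := by
  obtain ⟨x0, hx0⟩ := hX.exists_isLeast hX0
  obtain ⟨x1, hx1⟩ := hX.exists_isGreatest hX0
  have hX1 : X ⊆ Icc x0 x1 := fun y hy => ⟨hx0.2 hy, hx1.2 hy⟩
  set T := {r | r ∈ X ∧ r + ℓ ∈ X ∧ r + s * ℓ ∉ X} with hT
  have b1 : volume.real T ≤ volume.real X :=
    measureReal_mono (fun r hr => hr.1) hX.measure_lt_top.ne
  have d : volume.real (Icc x0 x1 \ X) = x1 - x0 - volume.real X := by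
    rw [measureReal_sdiff hX1 hX.measurableSet (by simp)]
    simp [Measure.real, (hX1 hx0.1).2]
  have b2 : volume.real T ≤ x1 - x0 - volume.real X := by
    rw [← d]
    have e : volume.real T = volume.real ((s * ℓ) +ᵥ T) := by
      unfold Measure.real; rw [measure_vadd]
    rw [e]
    refine measureReal_mono ?_ ((measure_mono sdiff_subset).trans_lt (by simp)).ne
    rintro _ ⟨r, ⟨h1, h2, h3⟩, rfl⟩
    have := hX1 h1; have := hX1 h2
    simp only [mem_Icc, vadd_eq_add] at *
    refine ⟨?_, by rw [add_comm]; exact h3⟩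
    simp only [mem_Icc]
    constructor <;> nlinarith
  have nT := measureReal_nonneg (μ := (volume : Measure ℝ)) (s := T)
  have sc : ∀ (c : ℝ) (hc : 0 < c) (X : Set ℝ), volume.real (c • X) = c * volume.real X := by
    intro c hc X
    unfold Measure.real
    rw [Measure.addHaar_smul]
    simp [ENNReal.toReal_mul, abs_of_pos hc, hc.le]
  have ht1' : 0 < 1 - t := by linarith
  have hcT : c * volume.real T ≤ volume.real T / 2 := by nlinarith
  have hm := fr (X := t • X) (Y := (1 - t) • Y) (hX.smul t) (hY.smul _) hX0.smul_set hY0.smul_set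
    (x0 := t * x0) (x1 := t * x1) (g := t * (c * volume.real T)) ?_ ⟨x0, hx0.1, rfl⟩
    ⟨x1, hx1.1, rfl⟩ ?_ ?_ ?_
  · rw [sc t ht0, sc _ ht1'] at hm
    linarith
  · rintro _ ⟨x, hx, rfl⟩
    have := hX1 hx
    simp only [mem_Icc, smul_eq_mul] at *
    constructor <;> nlinarith
  · rw [sc t ht0]
    nlinarith
  · rw [sc t ht0]
    apply mul_le_mul_of_nonneg_left _ ht0.le
    linarith
  · rw [sc _ ht1']
    have : 0 ≤ c * volume.real T := by positivity
    nlinarith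



section fibers
variable {F : Type*} [NormedAddCommGroup F] [NormedSpace ℝ F] [FiniteDimensional ℝ F]
    [MeasurableSpace F] [BorelSpace F] (ν : Measure F) [ν.IsAddHaarMeasure]

/-- Fiber of `A` over `y`. -/
def fib (A : Set (ℝ × F)) (y : F) : Set ℝ := {r | (r, y) ∈ A}

/-- Length of the fiber. -/
noncomputable def fl (A : Set (ℝ × F)) (y : F) : ℝ := volume.real (fib A y)

theorem fib_compact {A : Set (ℝ × F)} (hA : IsCompact A) (y : F) : IsCompact (fib A y) := by
  have : fib A y = Prod.fst '' (A ∩ Prod.snd ⁻¹' {y}) := by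
    ext r; simp [fib]
  rw [this]
  exact (hA.inter_right (isClosed_singleton.preimage continuous_snd)).image continuous_fst

theorem fl_nonneg (A : Set (ℝ × F)) (y : F) : 0 ≤ fl A y := measureReal_nonneg

theorem fl_zero {A : Set (ℝ × F)} {y : F} (hy : y ∉ Prod.snd '' A) : fl A y = 0 := by
  have : fib A y = ∅ := by
    ext r; simp only [fib, mem_ofPred_eq, mem_empty_iff_false, iff_false]
    exact fun h => hy ⟨_, h, rfl⟩
  simp [fl, this]

theorem fl_meas {A : Set (ℝ × F)} (hA : MeasurableSet A) : Measurable (fl A) :=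
  (measurable_measure_prodMk_right hA).ennreal_toReal

theorem lint_fl {A U : Set (ℝ × F)} (hA : MeasurableSet A) (hU : IsCompact U) (hAU : A ⊆ U) :
    ∫⁻ y in Prod.snd '' U, ENNReal.ofReal (fl A y) ∂ν = (volume.prod ν) A := by
  rw [Measure.prod_apply_symm hA]
  have hm : MeasurableSet (Prod.snd '' U) := (hU.image continuous_snd).measurableSet
  rw [← lintegral_indicator hm]
  apply lintegral_congr
  intro y
  by_cases hy : y ∈ Prod.snd '' U
  · rw [indicator_of_mem hy, fl, Measure.real, ENNReal.ofReal_toReal]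
    · rfl
    · exact ((measure_mono (t := fib U y) (fun r hr => hAU hr)).trans_lt
        (fib_compact hU y).measure_lt_top).ne
  · rw [indicator_of_notMem hy]
    have : ((fun x => (x, y)) ⁻¹' A) = ∅ := by
      ext r; simp only [mem_preimage, mem_empty_iff_false, iff_false]
      exact fun h => hy ⟨_, hAU h, rfl⟩
    rw [this]; simp

/-- The set of failures. -/
def badT {E : Type*} [AddCommGroup E] [Module ℝ E] (A : Set E) (h : E) (s : ℝ) : Set E :=
  {x | x ∈ A ∧ x + h ∈ A ∧ x + s • h ∉ A}

theorem badT_meas {E : Type*} [NormedAddCommGroup E] [NormedSpace ℝ E] [MeasurableSpace E]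
    [BorelSpace E] {A : Set E} (hA : MeasurableSet A) (h : E) (s : ℝ) :
    MeasurableSet (badT A h s) := by
  refine hA.inter ((hA.preimage (f := fun x => x + h) ?_).inter
    (hA.preimage (f := fun x => x + s • h) ?_).compl)
  · exact (continuous_id.add continuous_const).measurable
  · exact (continuous_id.add continuous_const).measurable

theorem tilt {t κ c ℓ s : ℝ} (ht0 : 0 < t) (ht1 : t < 1) (hκ : 0 ≤ κ) (hs0 : 0 ≤ s) (hs1 : s ≤ 1)
    (hc0 : 0 ≤ c) (hc : c ≤ 1 / 2) {A B : Set (ℝ × F)} (hA : IsCompact A) (hB : IsCompact B)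
    (hb : ∀ y, c * fl (badT A (ℓ, 0) s) y ≤ (1 - t) * κ) :
    ((volume.prod ν) A + ENNReal.ofReal c * (volume.prod ν) (badT A (ℓ, 0) s) +
      ENNReal.ofReal (κ * (1 - t) / t) * ν (Prod.snd '' A)) ^ t *
      ((volume.prod ν) B - ENNReal.ofReal κ * ν (Prod.snd '' B)) ^ (1 - t) ≤
      (volume.prod ν) (t • A + (1 - t) • B) := by
  set T := badT A ((ℓ, 0) : ℝ × F) s with hT
  have ht1' : 0 < 1 - t := by linarith
  have hS : IsCompact (t • A + (1 - t) • B) := (hA.smul t).add (hB.smul (1 - t))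
  have hTm : MeasurableSet T := badT_meas hA.measurableSet _ _
  have mA := fl_meas hA.measurableSet
  have mB := fl_meas hB.measurableSet
  have mT := fl_meas hTm
  have pA : MeasurableSet (Prod.snd '' A) := (hA.image continuous_snd).measurableSet
  have pB : MeasurableSet (Prod.snd '' B) := (hB.image continuous_snd).measurableSet
  set V := Prod.snd '' B ∩ {y | κ ≤ fl B y} with hV
  have hVm : MeasurableSet V := pB.inter (measurableSet_le measurable_const mB)
  have key := sub_bm ν ht0 ht1 (U := Prod.snd '' A) (V := V)
    (W := Prod.snd '' (t • A + (1 - t) • B)) pA hVm (hS.image continuous_snd).measurableSet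
    (p := fun y => fl A y + c * fl T y + κ * (1 - t) / t) (q := fun y => fl B y - κ)
    (r := fl (t • A + (1 - t) • B)) ((mA.add (mT.const_mul c)).add_const _) (mB.sub_const _)
    (fl_meas hS.measurableSet) ?_
  · rw [lint_fl ν hS.measurableSet hS subset_rfl] at key
    refine le_trans ?_ key
    gcongr
    · apply le_of_eq
      have : ∀ y, ENNReal.ofReal (fl A y + c * fl T y + κ * (1 - t) / t) =
          ENNReal.ofReal (fl A y) + ENNReal.ofReal c * ENNReal.ofReal (fl T y) +
            ENNReal.ofReal (κ * (1 - t) / t) := by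
        intro y
        have := fl_nonneg A y; have := fl_nonneg T y
        rw [ENNReal.ofReal_add (by positivity) (by positivity), ENNReal.ofReal_add (by positivity)
          (by positivity), ENNReal.ofReal_mul hc0]
      simp only [this]
      rw [lintegral_add_right _ measurable_const, lintegral_add_left mA.ennreal_ofReal,
        lintegral_const_mul _ mT.ennreal_ofReal, lint_fl ν hA.measurableSet hA subset_rfl,
        lint_fl ν hTm hA (fun x hx => hx.1)]
      simp
    · rw [tsub_le_iff_right]
      calc (volume.prod ν) B = ∫⁻ y in Prod.snd '' B, ENNReal.ofReal (fl B y) ∂ν :=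
            (lint_fl ν hB.measurableSet hB subset_rfl).symm
        _ ≤ ∫⁻ y in Prod.snd '' B, (V.indicator (fun y => ENNReal.ofReal (fl B y - κ)) y +
              ENNReal.ofReal κ) ∂ν := by
            apply setLIntegral_mono' pB
            intro y hy
            by_cases hyV : y ∈ V
            · rw [indicator_of_mem hyV, ← ENNReal.ofReal_add (sub_nonneg.2 hyV.2) hκ]
              simp
            · rw [indicator_of_notMem hyV, zero_add]
              apply ENNReal.ofReal_le_ofReal
              by_contra h
              push Not at h
              exact hyV ⟨hy, h.le⟩
        _ = _ := by
            rw [lintegral_add_right _ measurable_const, lintegral_indicator hVm,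
              Measure.restrict_restrict hVm, inter_eq_left.2 inter_subset_left, lintegral_const]
            simp only [Measure.restrict_apply_univ, hV]
  · rintro _ ⟨⟨r, y⟩, hy, rfl⟩ _ ⟨⟨⟨r', y'⟩, hy', rfl⟩, hκy⟩
    simp only [mem_ofPred_eq] at hκy ⊢
    refine ⟨⟨_, add_mem_add (smul_mem_smul_set hy) (smul_mem_smul_set hy'), by simp⟩, ?_⟩
    have hTf : fl T y = volume.real {r | r ∈ fib A y ∧ r + ℓ ∈ fib A y ∧ r + s * ℓ ∉ fib A y} := by
      rw [fl]
      congr 1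
      ext r
      simp only [fib, hT, badT, mem_ofPred_eq, Prod.mk_add_mk, Prod.smul_mk, smul_zero, add_zero,
        smul_eq_mul]
    have f1 := fr_beta (fib_compact hA y) (fib_compact hB y') ⟨r, hy⟩ ⟨r', hy'⟩ ht0 ht1 hs0 hs1
      hc0 hc (ℓ := ℓ) (by
        rw [← hTf]
        refine (hb y).trans ?_
        gcongr
        exact hκy)
    rw [← hTf] at f1
    have f2 : volume.real (t • fib A y + (1 - t) • fib B y') ≤
        fl (t • A + (1 - t) • B) (t • y + (1 - t) • y') := by
      refine measureReal_mono ?_ (fib_compact hS _).measure_lt_top.ne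
      rintro _ ⟨_, ⟨u, hu, rfl⟩, _, ⟨w, hw, rfl⟩, rfl⟩
      exact ⟨_, smul_mem_smul_set hu, _, smul_mem_smul_set hw, by simp⟩
    have e : t * (fl A y + c * fl T y + κ * (1 - t) / t) + (1 - t) * (fl B y' - κ) =
      t * (fl A y + c * fl T y) + (1 - t) * fl B y' := by field_simp; ring
    rw [e]
    exact f1.trans f2
end fibers


theorem log_lb {u : ℝ} (hu : -(1 / 2) ≤ u) : u - 2 * u ^ 2 ≤ Real.log (1 + u) := by
  have h1 : 0 < 1 + u := by linarith
  have h := Real.one_sub_inv_le_log_of_pos h1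
  refine le_trans ?_ h
  have : 1 - (1 + u)⁻¹ = u / (1 + u) := by field_simp; ring
  rw [this, le_div_iff₀ h1]
  nlinarith [sq_nonneg u, mul_nonneg (sq_nonneg u) (by linarith : (0:ℝ) ≤ 1 + 2 * u)]

theorem log_tilt {t u w e d : ℝ} (ht0 : 0 < t) (ht1 : t < 1) (he : e ≤ 1 / 2)
    (hu : |u| ≤ e) (hw : |w| ≤ e) (hd : 0 ≤ d)
    (H : (1 + u) ^ t * (1 + w) ^ (1 - t) ≤ 1 + d) : t * u + (1 - t) * w ≤ d + 2 * e ^ 2 := by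
  have hu' := abs_le.1 hu
  have hw' := abs_le.1 hw
  have pu : 0 < 1 + u := by linarith
  have pw : 0 < 1 + w := by linarith
  have hl := Real.log_le_log (by positivity) H
  rw [Real.log_mul (by positivity) (by positivity), Real.log_rpow pu, Real.log_rpow pw] at hl
  have hd2 : Real.log (1 + d) ≤ d := by
    have := Real.log_le_sub_one_of_pos (by linarith : 0 < 1 + d); linarith
  have l1 := log_lb (u := u) (by linarith)
  have l2 := log_lb (u := w) (by linarith)
  have q1 : u ^ 2 ≤ e ^ 2 := sq_le_sq' hu'.1 hu'.2
  have q2 : w ^ 2 ≤ e ^ 2 := sq_le_sq' hw'.1 hw'.2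
  have k1 := mul_le_mul_of_nonneg_left l1 ht0.le
  have k2 := mul_le_mul_of_nonneg_left l2 (by linarith : 0 ≤ 1 - t)
  have k3 := mul_le_mul_of_nonneg_left q1 ht0.le
  have k4 := mul_le_mul_of_nonneg_left q2 (by linarith : 0 ≤ 1 - t)
  nlinarith

theorem ennreal_bm {X Y Z : ENNReal} {x y z t : ℝ} (ht0 : 0 < t) (ht1 : t < 1) (hx : 0 < x)
    (hy : 0 < y) (h : X ^ t * Y ^ (1 - t) ≤ Z)
    (hX : ENNReal.ofReal x ≤ X) (hY : ENNReal.ofReal y ≤ Y) (hZ : Z ≤ ENNReal.ofReal z)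
    (hz : 0 ≤ z) : x ^ t * y ^ (1 - t) ≤ z := by
  have h1 : ENNReal.ofReal x ^ t * ENNReal.ofReal y ^ (1 - t) ≤ ENNReal.ofReal z := by
    refine le_trans ?_ (h.trans hZ)
    have : 0 ≤ 1 - t := by linarith
    gcongr
  rw [ENNReal.ofReal_rpow_of_pos hx, ENNReal.ofReal_rpow_of_pos hy,
    ← ENNReal.ofReal_mul (by positivity)] at h1
  exact (ENNReal.ofReal_le_ofReal_iff hz).1 h1

section
variable {F : Type*} [NormedAddCommGroup F] [NormedSpace ℝ F] [FiniteDimensional ℝ F]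
    [MeasurableSpace F] [BorelSpace F] (ν : Measure F) [ν.IsAddHaarMeasure]

set_option maxHeartbeats 800000 in
theorem tilt_real {t τ x κ c ℓ s : ℝ} (hτ : 0 < τ) (hτt : τ ≤ t) (hτt' : τ ≤ 1 - t)
    (hx : 0 < x) (hx1 : x ≤ τ / 4) (hs0 : 0 ≤ s) (hs1 : s ≤ 1) (hκ : 0 ≤ κ)
    (hc0 : 0 ≤ c) (hc : c ≤ x / 2) {A B : Set (ℝ × F)} (hA : IsCompact A) (hB : IsCompact B)
    (hb : ∀ y, c * fl (badT A (ℓ, 0) s) y ≤ (1 - t) * κ)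
    (hα : 1 - x ^ 2 ≤ (volume.prod ν).real A) (hα' : (volume.prod ν).real A ≤ 1 + x ^ 2)
    (hβ : 1 - x ^ 2 ≤ (volume.prod ν).real B)
    (hS : (volume.prod ν).real (t • A + (1 - t) • B) ≤ 1 + x ^ 2)
    (hP : κ * ν.real (Prod.snd '' A) ≤ x) (hQ : κ * ν.real (Prod.snd '' B) ≤ x) :
    t * (c * (volume.prod ν).real (badT A (ℓ, 0) s)) +
      (1 - t) * (κ * (ν.real (Prod.snd '' A) - ν.real (Prod.snd '' B))) ≤ 10 * x ^ 2 / τ ^ 2 := by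
  have ht0 : 0 < t := by linarith
  have ht1 : t < 1 := by linarith
  have ht1' : 0 < 1 - t := by linarith
  have hτ2 : τ ≤ 1 / 2 := by linarith
  have hScpt : IsCompact (t • A + (1 - t) • B) := (hA.smul t).add (hB.smul (1 - t))
  have key := tilt ν ht0 ht1 hκ hs0 hs1 hc0 (by linarith) hA hB hb
  set T := badT A ((ℓ, 0) : ℝ × F) s with hT
  set I := c * (volume.prod ν).real T with hI
  set P := ν.real (Prod.snd '' A) with hPd
  set Q := ν.real (Prod.snd '' B) with hQd
  have hTle : (volume.prod ν).real T ≤ (volume.prod ν).real A :=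
    measureReal_mono (fun x hx => hx.1) hA.measure_lt_top.ne
  have hTfin : (volume.prod ν) T ≠ ⊤ :=
    ((measure_mono (fun x hx => hx.1)).trans_lt hA.measure_lt_top).ne
  have nT : 0 ≤ (volume.prod ν).real T := measureReal_nonneg
  have nP : 0 ≤ P := measureReal_nonneg
  have nQ : 0 ≤ Q := measureReal_nonneg
  have hx2 : x ^ 2 ≤ x := by nlinarith
  have hI0 : 0 ≤ I := by positivity
  have hI1 : I ≤ x := by nlinarith
  have k1 : κ * (1 - t) / t * P ≤ x / τ := by
    have : κ * (1 - t) / t * P = (κ * P) * ((1 - t) / t) := by ring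
    rw [this, div_eq_mul_one_div x]
    gcongr
    linarith
  have k0 : 0 ≤ κ * (1 - t) / t * P := by positivity
  have xτ : 2 * x / τ ≤ 1 / 2 := by rw [div_le_iff₀ hτ]; linarith
  have xτ2 : x ≤ x / τ := by rw [le_div_iff₀ hτ]; nlinarith
  have r2 : 2 * x / τ = x / τ + x / τ := by ring
  have kQ0 : 0 ≤ κ * Q := by positivity
  have hu : |I - x ^ 2 + κ * (1 - t) / t * P| ≤ 2 * x / τ := by
    rw [abs_le, r2]; constructor <;> linarith [sq_nonneg x]
  have hw : |-x ^ 2 - κ * Q| ≤ 2 * x / τ := by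
    rw [abs_le, r2]; constructor <;> linarith [sq_nonneg x]
  have hu' := abs_le.1 hu
  have hw' := abs_le.1 hw
  have H := ennreal_bm ht0 ht1 (x := 1 + (I - x ^ 2 + κ * (1 - t) / t * P))
    (y := 1 + (-x ^ 2 - κ * Q)) (z := 1 + x ^ 2) (by linarith) (by linarith) key ?_ ?_ ?_
    (by positivity)
  · have := log_tilt ht0 ht1 xτ hu hw (by positivity) H
    have e1 : t * (I - x ^ 2 + κ * (1 - t) / t * P) + (1 - t) * (-x ^ 2 - κ * Q) =
      t * I + (1 - t) * (κ * (P - Q)) - x ^ 2 := by field_simp; ring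
    rw [e1] at this
    have e2 : (2 * x / τ) ^ 2 = 4 * (x ^ 2 / τ ^ 2) := by ring
    have e3 : x ^ 2 ≤ x ^ 2 / τ ^ 2 := by
      have h1 : τ ^ 2 ≤ 1 := pow_le_one₀ hτ.le (by linarith)
      exact le_div_self (sq_nonneg x) (by positivity) h1
    have e4 : 10 * x ^ 2 / τ ^ 2 = 10 * (x ^ 2 / τ ^ 2) := by ring
    rw [e4]
    rw [e2] at this
    linarith
  · have e : (volume.prod ν) A + ENNReal.ofReal c * (volume.prod ν) T +
        ENNReal.ofReal (κ * (1 - t) / t) * ν (Prod.snd '' A) =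
        ENNReal.ofReal ((volume.prod ν).real A + I + κ * (1 - t) / t * P) := by
      rw [ENNReal.ofReal_add (by positivity) k0, ENNReal.ofReal_add (by positivity) hI0, hI,
        ENNReal.ofReal_mul hc0, ENNReal.ofReal_mul (by positivity), hPd,
        ofReal_measureReal hA.measure_lt_top.ne, ofReal_measureReal hTfin,
        ofReal_measureReal (hA.image continuous_snd).measure_lt_top.ne]
    rw [e]
    apply ENNReal.ofReal_le_ofReal
    linarith
  · have e : (volume.prod ν) B - ENNReal.ofReal κ * ν (Prod.snd '' B) =
        ENNReal.ofReal ((volume.prod ν).real B - κ * Q) := by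
      rw [ENNReal.ofReal_sub _ kQ0, ENNReal.ofReal_mul hκ, hQd,
        ofReal_measureReal hB.measure_lt_top.ne,
        ofReal_measureReal (hB.image continuous_snd).measure_lt_top.ne]
    rw [e]
    apply ENNReal.ofReal_le_ofReal
    linarith
  · rw [← ofReal_measureReal hScpt.measure_lt_top.ne]
    exact ENNReal.ofReal_le_ofReal hS

theorem crude {t : ℝ} (ht0 : 0 < t) (ht1 : t < 1) {A B : Set (ℝ × F)} (hA : IsCompact A)
    (hB : IsCompact B) (y : F) :
    t * fl A y * ((1 - t) ^ Module.finrank ℝ F * ν.real (Prod.snd '' B)) ≤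
      (volume.prod ν).real (t • A + (1 - t) • B) := by
  have ht1' : 0 < 1 - t := by linarith
  have hS : IsCompact (t • A + (1 - t) • B) := (hA.smul t).add (hB.smul (1 - t))
  by_cases hy : y ∈ Prod.snd '' A
  swap
  · rw [fl_zero hy]; simp
  set G : Set F := (t • y) +ᵥ ((1 - t) • (Prod.snd '' B)) with hG
  have hGm : ν.real G = (1 - t) ^ Module.finrank ℝ F * ν.real (Prod.snd '' B) := by
    unfold Measure.real
    rw [hG, measure_vadd, Measure.addHaar_smul]
    simp [ENNReal.toReal_mul, abs_of_pos ht1', ht1'.le]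
  have pB : IsCompact (Prod.snd '' B) := hB.image continuous_snd
  have hGc : IsCompact G := (pB.smul _).vadd _
  rw [← hGm]
  have h1 : ENNReal.ofReal (t * fl A y) * ν G ≤ (volume.prod ν) (t • A + (1 - t) • B) := by
    rw [← lint_fl ν hS.measurableSet hS subset_rfl]
    calc ENNReal.ofReal (t * fl A y) * ν G = ∫⁻ _ in G, ENNReal.ofReal (t * fl A y) ∂ν := by simp
      _ ≤ ∫⁻ z in G, ENNReal.ofReal (fl (t • A + (1 - t) • B) z) ∂ν := by
        apply setLIntegral_mono' hGc.measurableSet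
        rintro _ ⟨_, ⟨_, ⟨⟨r', y'⟩, hy', rfl⟩, rfl⟩, rfl⟩
        apply ENNReal.ofReal_le_ofReal
        have : t * fl A y = volume.real (((1 - t) * r') +ᵥ (t • fib A y)) := by
          rw [fl]; unfold Measure.real
          rw [measure_vadd, Measure.addHaar_smul]
          simp [ENNReal.toReal_mul, abs_of_pos ht0, ht0.le]
        rw [this, fl]
        refine measureReal_mono ?_ (fib_compact hS _).measure_lt_top.ne
        rintro _ ⟨_, ⟨r, hr, rfl⟩, rfl⟩
        exact ⟨_, smul_mem_smul_set hr, _, smul_mem_smul_set hy', by simp [add_comm]⟩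
      _ ≤ _ := by
        apply lintegral_mono_set
        rintro _ ⟨_, ⟨_, ⟨⟨r', y'⟩, hy', rfl⟩, rfl⟩, rfl⟩
        obtain ⟨⟨r, y⟩, hr, rfl⟩ := hy
        exact ⟨_, add_mem_add (smul_mem_smul_set hr) (smul_mem_smul_set hy'), by simp⟩
  have h2 := ENNReal.toReal_mono hS.measure_lt_top.ne h1
  rw [ENNReal.toReal_mul, ENNReal.toReal_ofReal (mul_nonneg ht0.le (fl_nonneg _ _))] at h2
  exact h2

theorem meas_le_sup {A : Set (ℝ × F)} (hA : IsCompact A) {M : ℝ}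
    (h : ∀ y, fl A y ≤ M) : (volume.prod ν).real A ≤ M * ν.real (Prod.snd '' A) := by
  have hM : 0 ≤ M := (fl_nonneg A 0).trans (h 0)
  have h1 : (volume.prod ν) A ≤ ENNReal.ofReal M * ν (Prod.snd '' A) := by
    rw [← lint_fl ν hA.measurableSet hA subset_rfl]
    calc _ ≤ ∫⁻ _ in Prod.snd '' A, ENNReal.ofReal M ∂ν :=
          lintegral_mono fun y => ENNReal.ofReal_le_ofReal (h y)
      _ = _ := by simp
  have h2 := ENNReal.toReal_mono (ENNReal.mul_ne_top ENNReal.ofReal_ne_top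
    (hA.image continuous_snd).measure_lt_top.ne) h1
  rw [ENNReal.toReal_mul, ENNReal.toReal_ofReal hM] at h2
  exact h2
end


section
variable {F : Type*} [NormedAddCommGroup F] [NormedSpace ℝ F] [FiniteDimensional ℝ F]
    [MeasurableSpace F] [BorelSpace F] (ν : Measure F) [ν.IsAddHaarMeasure]

theorem proj_pos {A : Set (ℝ × F)} (hA : IsCompact A) (h : 0 < (volume.prod ν).real A) :
    0 < ν.real (Prod.snd '' A) := by
  by_contra hc
  have h0 : ν.real (Prod.snd '' A) = 0 := le_antisymm (not_lt.1 hc) measureReal_nonneg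
  have h1 : ν (Prod.snd '' A) = 0 := by
    rwa [measureReal_eq_zero_iff (hA.image continuous_snd).measure_lt_top.ne] at h0
  have h2 := lint_fl ν hA.measurableSet hA subset_rfl
  rw [setLIntegral_measure_zero _ _ h1] at h2
  rw [Measure.real, ← h2] at h
  simp at h

set_option maxHeartbeats 800000 in
theorem step1_prod {t τ x ℓ s : ℝ} (hτ : 0 < τ) (hτt : τ ≤ t) (hτt' : τ ≤ 1 - t)
    (hx : 0 < x) (hx1 : x ≤ τ / 4) (hs0 : 0 ≤ s) (hs1 : s ≤ 1)
    {A B : Set (ℝ × F)} (hA : IsCompact A) (hB : IsCompact B)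
    (hα : 1 - x ^ 2 ≤ (volume.prod ν).real A) (hα' : (volume.prod ν).real A ≤ 1 + x ^ 2)
    (hβ : 1 - x ^ 2 ≤ (volume.prod ν).real B) (hβ' : (volume.prod ν).real B ≤ 1 + x ^ 2)
    (hS : (volume.prod ν).real (t • A + (1 - t) • B) ≤ 1 + x ^ 2) :
    (volume.prod ν).real (badT A (ℓ, 0) s) ≤
      150 * x / τ ^ (2 * (Module.finrank ℝ F + 1) + 5) := by
  have ht0 : 0 < t := by linarith
  have ht1 : t < 1 := by linarith
  have ht1' : 0 < 1 - t := by linarith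
  have hτ2 : τ ≤ 1 / 2 := by linarith
  have hx2 : x ^ 2 ≤ 1 / 2 := by nlinarith
  have hS' : (volume.prod ν).real ((1 - t) • B + (1 - (1 - t)) • A) ≤ 1 + x ^ 2 := by
    rw [sub_sub_cancel, add_comm]; exact hS
  set m := Module.finrank ℝ F with hm
  set θ := τ ^ (m + 1) with hθ
  have hθ0 : 0 < θ := by positivity
  have hθ1 : θ ≤ 1 := pow_le_one₀ hτ.le (by linarith)
  have c1 : θ ≤ t * (1 - t) ^ m := by
    rw [hθ, pow_succ']
    gcongr
  have c2 : θ ≤ (1 - t) * t ^ m := by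
    rw [hθ, pow_succ']
    gcongr
  set P := ν.real (Prod.snd '' A) with hPd
  set Q := ν.real (Prod.snd '' B) with hQd
  have hP : 0 < P := proj_pos ν hA (by linarith)
  have hQ : 0 < Q := proj_pos ν hB (by linarith)
  have aQ : ∀ y, fl A y * Q ≤ 2 / θ := by
    intro y
    have h := crude ν ht0 ht1 hA hB y
    rw [← hm, ← hQd] at h
    have n := fl_nonneg A y
    rw [le_div_iff₀ hθ0]
    have : fl A y * Q * θ ≤ fl A y * Q * (t * (1 - t) ^ m) := by gcongr
    linarith
  have bP : ∀ y, fl B y * P ≤ 2 / θ := by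
    intro y
    have h := crude ν ht1' (by linarith) hB hA y
    rw [sub_sub_cancel, ← hm, ← hPd] at h
    rw [sub_sub_cancel] at hS'
    have n := fl_nonneg B y
    rw [le_div_iff₀ hθ0]
    have : fl B y * P * θ ≤ fl B y * P * ((1 - t) * t ^ m) := by gcongr
    linarith
  have PQ : P * θ ≤ 4 * Q := by
    have h := meas_le_sup ν hB (M := 2 / θ / P) (fun y => by rw [le_div_iff₀ hP]; exact bP y)
    rw [← hQd] at h
    have h2 : 1 / 2 ≤ 2 / θ / P * Q := by linarith
    have e : 2 / θ / P * Q = 2 * Q / (P * θ) := by field_simp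
    rw [e, le_div_iff₀ (by positivity)] at h2
    linarith
  set R := P + Q with hR
  have hR0 : 0 < R := by positivity
  have aR : ∀ y, fl A y * R ≤ 10 / θ ^ 2 := by
    intro y
    have n := fl_nonneg A y
    have h1 := aQ y
    rw [le_div_iff₀ hθ0] at h1
    have h2 : fl A y * (P * θ) ≤ fl A y * (4 * Q) := by gcongr
    rw [le_div_iff₀ (by positivity)]
    have h3 : fl A y * (P * θ) * θ ≤ 4 * (fl A y * Q * θ) := by
      calc _ ≤ fl A y * (4 * Q) * θ := by gcongr
        _ = _ := by ring
    have h4 : fl A y * Q * θ * θ ≤ 2 * 1 := by gcongr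
    calc fl A y * R * θ ^ 2 = fl A y * (P * θ) * θ + fl A y * Q * θ * θ := by rw [hR]; ring
      _ ≤ _ := by linarith
  set κ := x / R with hκ
  set c := θ ^ 2 * τ * x / 10 with hc
  have hθ2 : θ ^ 2 * τ ≤ 1 := by
    have : θ ^ 2 ≤ 1 := pow_le_one₀ hθ0.le hθ1
    nlinarith
  have hκ0 : 0 < κ := by positivity
  have κP : κ * P ≤ x := by
    rw [hκ, div_mul_eq_mul_div, div_le_iff₀ hR0]; gcongr; linarith
  have κQ : κ * Q ≤ x := by
    rw [hκ, div_mul_eq_mul_div, div_le_iff₀ hR0]; gcongr; linarith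
  have hc0 : 0 < c := by positivity
  have hcx : c ≤ x / 2 := by rw [hc]; nlinarith
  have T1 := tilt_real ν (ℓ := ℓ) hτ hτt hτt' hx hx1 hs0 hs1 hκ0.le hc0.le hcx hA hB (by
      intro y
      have b1 : fl (badT A (ℓ, 0) s) y ≤ fl A y := by
        refine measureReal_mono ?_ (fib_compact hA _).measure_lt_top.ne
        exact fun r hr => hr.1
      have h3 : c * fl A y ≤ τ * κ := by
        rw [hκ, ← mul_div_assoc, le_div_iff₀ hR0]
        have := aR y
        rw [le_div_iff₀ (by positivity)] at this
        calc c * fl A y * R = (fl A y * R * θ ^ 2) * (τ * x / 10) := by rw [hc]; ring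
          _ ≤ 10 * (τ * x / 10) := by gcongr
          _ = _ := by ring
      calc _ ≤ c * fl A y := by gcongr
        _ ≤ τ * κ := h3
        _ ≤ _ := by gcongr) hα hα' hβ hS κP κQ
  have T2 := tilt_real ν (ℓ := ℓ) (t := 1 - t) (c := 0) (s := s) hτ hτt' (by linarith) hx hx1 hs0
    hs1 hκ0.le le_rfl (by positivity) hB hA (by
      intro y
      simp only [zero_mul, sub_sub_cancel]; positivity) hβ hβ' hα hS' κQ κP
  simp only [zero_mul, mul_zero, zero_add, sub_sub_cancel] at T2
  rw [← hPd, ← hQd] at T1 T2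
  set MT := (volume.prod ν).real (badT A ((ℓ, 0) : ℝ × F) s) with hMT
  have nM : 0 ≤ MT := measureReal_nonneg
  have T2' : κ * (Q - P) ≤ 10 * x ^ 2 / τ ^ 3 := by
    rcases le_or_gt (κ * (Q - P)) 0 with h | h
    · exact h.trans (by positivity)
    · have : τ * (κ * (Q - P)) ≤ 10 * x ^ 2 / τ ^ 2 := le_trans (by gcongr) T2
      rw [le_div_iff₀ (by positivity)] at this ⊢
      linarith
  have T3 : t * (c * MT) ≤ 15 * x ^ 2 / τ ^ 3 := by
    have h1 : (1 - t) * (κ * (Q - P)) ≤ 10 * x ^ 2 / τ ^ 3 := by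
      calc _ ≤ (1 - t) * (10 * x ^ 2 / τ ^ 3) := by gcongr
        _ ≤ 1 * (10 * x ^ 2 / τ ^ 3) := by gcongr; linarith
        _ = _ := one_mul _
    have h2 : 10 * x ^ 2 / τ ^ 2 ≤ 5 * x ^ 2 / τ ^ 3 := by
      rw [div_le_div_iff₀ (by positivity) (by positivity)]
      have : x ^ 2 * τ ^ 2 * τ ≤ x ^ 2 * τ ^ 2 * (1 / 2) := by gcongr
      linarith
    have e : 15 * x ^ 2 / τ ^ 3 = 5 * x ^ 2 / τ ^ 3 + 10 * x ^ 2 / τ ^ 3 := by ring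
    rw [e]
    linarith
  have T4 : τ * (c * MT) ≤ 15 * x ^ 2 / τ ^ 3 := le_trans (by gcongr) T3
  have e5 : τ ^ (2 * (m + 1) + 5) = θ ^ 2 * τ ^ 5 := by rw [hθ]; ring
  rw [e5, le_div_iff₀ (by positivity)]
  rw [le_div_iff₀ (by positivity), hc] at T4
  have : x * (MT * (θ ^ 2 * τ ^ 5)) ≤ x * (150 * x) := by linarith
  exact le_of_mul_le_mul_left this hx
end

theorem step1 {E : Type*} [NormedAddCommGroup E] [NormedSpace ℝ E] [FiniteDimensional ℝ E]
    [MeasurableSpace E] [BorelSpace E] (μ : Measure E) [μ.IsAddHaarMeasure]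
    {t τ x s : ℝ} (hτ : 0 < τ) (hτt : τ ≤ t) (hτt' : τ ≤ 1 - t)
    (hx : 0 < x) (hx1 : x ≤ τ / 4) (hs0 : 0 ≤ s) (hs1 : s ≤ 1)
    {A B : Set E} (hA : IsCompact A) (hB : IsCompact B)
    (hα : 1 - x ^ 2 ≤ μ.real A) (hα' : μ.real A ≤ 1 + x ^ 2)
    (hβ : 1 - x ^ 2 ≤ μ.real B) (hβ' : μ.real B ≤ 1 + x ^ 2)
    (hS : μ.real (t • A + (1 - t) • B) ≤ 1 + x ^ 2) (h : E) :
    μ.real (badT A h s) ≤ 150 * x / τ ^ (2 * Module.finrank ℝ E + 5) := by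
  rcases eq_or_ne h 0 with rfl | h0
  · have : badT A 0 s = ∅ := by
      ext y; simp [badT]
    rw [this]; simp; positivity
  obtain ⟨f, hf⟩ := SeparatingDual.exists_eq_one (R := ℝ) h0
  obtain ⟨ν, hν, L, hL, hL1, hL2⟩ := decomp μ f h hf
  have hfr := finrank_ker_f f h hf
  have mr : ∀ X : Set E, (volume.prod ν).real (L '' X) = μ.real X := by
    intro X
    unfold Measure.real
    have me : MeasurableEmbedding L := L.toHomeomorph.measurableEmbedding
    rw [← hL.measure_preimage_emb me, preimage_image_eq _ L.injective]
  have key := step1_prod ν (ℓ := 1) (s := s) hτ hτt hτt' hx hx1 hs0 hs1 (hA.image L.continuous)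
    (hB.image L.continuous) (by rwa [mr]) (by rwa [mr]) (by rwa [mr]) (by rwa [mr]) (by
      have : t • (L '' A) + (1 - t) • (L '' B) = L '' (t • A + (1 - t) • B) := by
        rw [image_add L, image_smul_set, image_smul_set]
      rw [this, mr]; exact hS)
  rw [hfr] at key
  refine le_trans (le_of_eq ?_) key
  rw [← mr]
  congr 1
  have hLh : L h = (1, 0) := by
    apply Prod.ext
    · simp [hL1, hf]
    · apply Subtype.ext; simp [hL2, hf]
  ext y
  simp only [badT, mem_image, mem_ofPred_eq, ← hLh]
  constructor
  · rintro ⟨a, ⟨h1, h2, h3⟩, rfl⟩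
    refine ⟨⟨a, h1, rfl⟩, ⟨a + h, h2, by simp⟩, ?_⟩
    rintro ⟨b, hb, hbe⟩
    rw [← map_smul, ← map_add] at hbe
    rw [L.injective hbe] at hb
    exact h3 hb
  · rintro ⟨⟨a, h1, rfl⟩, ⟨b, h2, h2e⟩, h3⟩
    rw [← map_add] at h2e
    rw [L.injective h2e] at h2
    exact ⟨a, ⟨h1, h2, fun h4 => h3 ⟨_, h4, by simp⟩⟩, rfl⟩


section
variable {E : Type*} [NormedAddCommGroup E] [NormedSpace ℝ E] [FiniteDimensional ℝ E]
    [MeasurableSpace E] [BorelSpace E] (μ : Measure E) [μ.IsAddHaarMeasure]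

theorem smul_real {c : ℝ} (hc : 0 < c) (X : Set E) :
    μ.real (c • X) = c ^ Module.finrank ℝ E * μ.real X := by
  unfold Measure.real
  rw [Measure.addHaar_smul]
  simp [ENNReal.toReal_mul, abs_of_pos hc, hc.le]

theorem vadd_real (v : E) (X : Set E) : μ.real (v +ᵥ X) = μ.real X := by
  unfold Measure.real
  rw [measure_vadd]

/-- Preimage under an affine homothety. -/
theorem pre_real {c : ℝ} (hc : 0 < c) (v : E) (X : Set E) :
    μ {x | v + c • x ∈ X} = ENNReal.ofReal ((c ^ Module.finrank ℝ E)⁻¹) * μ X := by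
  have : {x | v + c • x ∈ X} = c⁻¹ • ((-v) +ᵥ X) := by
    ext x
    rw [mem_inv_smul_set_iff₀ hc.ne', mem_vadd_set_iff_neg_vadd_mem]
    simp
  rw [this, Measure.addHaar_smul, measure_vadd, inv_pow, abs_of_pos (by positivity)]

theorem pre_real' {c : ℝ} (hc : 0 < c) (v : E) (X : Set E) :
    μ.real {x | v + c • x ∈ X} = (c ^ Module.finrank ℝ E)⁻¹ * μ.real X := by
  unfold Measure.real
  rw [pre_real μ hc, ENNReal.toReal_mul, ENNReal.toReal_ofReal (by positivity)]

theorem diff_bound {t : ℝ} (ht0 : 0 < t) (ht1 : t < 1) {A B : Set E} (hA : IsCompact A)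
    (hB : IsCompact B) :
    (t ^ Module.finrank ℝ E * μ.real (A - A)) * ((1 - t) ^ Module.finrank ℝ E * μ.real B) ≤
      μ.real (t • A + (1 - t) • B) ^ 2 := by
  have ht1' : 0 < 1 - t := by linarith
  set S := t • A + (1 - t) • B with hSd
  have hS : IsCompact S := (hA.smul t).add (hB.smul (1 - t))
  have hci := conv_int μ hS.measurableSet hS.measurableSet
  have hD : IsCompact (A - A) := by rw [sub_eq_add_neg]; exact hA.add hA.neg
  have h1 : μ ((1 - t) • B) * μ (t • (A - A)) ≤ μ S * μ S := by
    rw [← hci]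
    calc μ ((1 - t) • B) * μ (t • (A - A)) = ∫⁻ _ in t • (A - A), μ ((1 - t) • B) ∂μ := by simp
      _ ≤ ∫⁻ s in t • (A - A), μ {x | x ∈ S ∧ x - s ∈ S} ∂μ := by
        apply setLIntegral_mono' (hD.smul t).measurableSet
        rintro _ ⟨_, ⟨a, ha, a', ha', rfl⟩, rfl⟩
        rw [← measure_vadd μ (t • a) ((1 - t) • B)]
        apply measure_mono
        rintro _ ⟨b, hb, rfl⟩
        refine ⟨add_mem_add (smul_mem_smul_set ha) hb, ?_⟩
        have : (t • a +ᵥ b) - t • (a - a') = t • a' + b := by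
          simp only [vadd_eq_add, smul_sub]; abel
        show (t • a +ᵥ b) - t • (a - a') ∈ S
        rw [this]
        exact add_mem_add (smul_mem_smul_set ha') hb
      _ ≤ _ := setLIntegral_le_lintegral _ _
  have h2 := ENNReal.toReal_mono (ENNReal.mul_ne_top hS.measure_lt_top.ne hS.measure_lt_top.ne) h1
  rw [ENNReal.toReal_mul, ENNReal.toReal_mul] at h2
  rw [← smul_real μ ht0, ← smul_real μ ht1', sq, mul_comm]
  exact h2

/-- Markov-type lemma. -/
theorem markov_hull {ρ c : ℝ} (hρ1 : ρ < 1) {S W : Set E} (hS : MeasurableSet S)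
    (hSf : μ S ≠ ⊤) (hc : 0 < c)
    (H : ∀ z ∈ W, ENNReal.ofReal c ≤ μ {q | q ∈ S ∧ (1 - ρ) • z + ρ • q ∈ S}) :
    μ W ≠ ⊤ ∧ μ.real W * c * (1 - ρ) ^ Module.finrank ℝ E ≤ μ.real S ^ 2 := by
  have h1ρ : 0 < 1 - ρ := by linarith
  have hm : MeasurableSet {p : E × E | p.2 ∈ S ∧ (1 - ρ) • p.1 + ρ • p.2 ∈ S} := by
    refine (hS.preimage measurable_snd).inter (hS.preimage ?_)
    exact (measurable_fst.const_smul (1 - ρ)).add (measurable_snd.const_smul ρ)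
  have e1 := Measure.prod_apply (μ := μ) (ν := μ) hm
  have e2 := Measure.prod_apply_symm (μ := μ) (ν := μ) hm
  have hmeas := measurable_measure_prodMk_left (ν := μ) hm
  simp only [preimage_ofPred_eq] at e1 e2 hmeas
  rw [e1] at e2
  have hin : ∀ q, μ {z | q ∈ S ∧ (1 - ρ) • z + ρ • q ∈ S} =
      S.indicator (fun _ => ENNReal.ofReal (((1 - ρ) ^ Module.finrank ℝ E)⁻¹) * μ S) q := by
    intro q
    by_cases hq : q ∈ S
    · simp only [hq, true_and, indicator_of_mem]
      rw [← pre_real μ h1ρ (ρ • q) S]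
      simp only [add_comm]
    · simp [hq]
  simp only [hin] at e2
  rw [lintegral_indicator_const hS] at e2
  have mk := mul_meas_ge_le_lintegral (μ := μ) hmeas (ENNReal.ofReal c)
  rw [e2] at mk
  have hW : μ W ≤ μ {x | ENNReal.ofReal c ≤ μ {q | q ∈ S ∧ (1 - ρ) • x + ρ • q ∈ S}} :=
    measure_mono fun z hz => H z hz
  have h3 : ENNReal.ofReal c * μ W ≤
      ENNReal.ofReal (((1 - ρ) ^ Module.finrank ℝ E)⁻¹) * μ S * μ S := le_trans (by gcongr) mk
  have hfin : ENNReal.ofReal (((1 - ρ) ^ Module.finrank ℝ E)⁻¹) * μ S * μ S ≠ ⊤ :=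
    ENNReal.mul_ne_top (ENNReal.mul_ne_top ENNReal.ofReal_ne_top hSf) hSf
  have hWf : μ W ≠ ⊤ := by
    intro hW
    rw [hW, ENNReal.mul_top (by simpa using hc)] at h3
    exact hfin (top_le_iff.1 h3)
  refine ⟨hWf, ?_⟩
  have h4 := ENNReal.toReal_mono hfin h3
  rw [ENNReal.toReal_mul, ENNReal.toReal_mul, ENNReal.toReal_mul, ENNReal.toReal_ofReal hc.le,
    ENNReal.toReal_ofReal (by positivity)] at h4
  have hp : 0 < (1 - ρ) ^ Module.finrank ℝ E := by positivity
  rw [mul_assoc, ← div_eq_inv_mul, le_div_iff₀ hp] at h4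
  unfold Measure.real
  rw [sq]
  linarith

theorem quasi_finset {φ : E → ℝ} {c ε : ℝ}
    (hφ : ∀ z z' (s : ℝ), 0 ≤ s → s ≤ 1 → φ ((1 - s) • z + s • z') ≤ φ z + φ z' + c)
    (s : Finset E) (hs : s.Nonempty) :
    (∀ z ∈ s, φ z ≤ ε) → ∀ z ∈ convexHull ℝ (s : Set E), φ z ≤ s.card * ε + (s.card - 1) * c := by
  classical
  induction hs using Finset.Nonempty.cons_induction with
  | singleton a => intro h z hz; simp at hz h ⊢; rw [hz]; exact h
  | cons a s ha hs ih =>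
    intro h z hz
    rw [Finset.coe_cons, convexHull_insert (by simpa using hs)] at hz
    rw [mem_convexJoin] at hz
    obtain ⟨a', ha', b, hb, hz⟩ := hz
    simp only [mem_singleton_iff] at ha'
    subst ha'
    rw [segment_eq_image] at hz
    obtain ⟨r, hr, rfl⟩ := hz
    have h1 := ih (fun z hz => h z (by simp [hz])) b hb
    have h2 := h a' (by simp)
    have := hφ a' b r hr.1 hr.2
    rw [Finset.card_cons]
    push_cast
    linarith

theorem quasi_hull {φ : E → ℝ} {c ε : ℝ} (hc : 0 ≤ c) (hε : 0 ≤ ε)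
    (hφ : ∀ z z' (s : ℝ), 0 ≤ s → s ≤ 1 → φ ((1 - s) • z + s • z') ≤ φ z + φ z' + c)
    {G : Set E} (hG : ∀ z ∈ G, φ z ≤ ε) :
    ∀ z ∈ convexHull ℝ G, φ z ≤ (Module.finrank ℝ E + 1) * (ε + c) := by
  intro z hz
  rw [convexHull_eq_union] at hz
  simp only [mem_iUnion] at hz
  obtain ⟨s, hsG, hai, hz⟩ := hz
  have hne : s.Nonempty := by
    by_contra h
    rw [Finset.not_nonempty_iff_eq_empty] at h
    simp [h] at hz
  have h1 := quasi_finset hφ s hne (fun z hz => hG z (hsG hz)) z hz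
  have hcard : s.card ≤ Module.finrank ℝ E + 1 := by
    have := hai.card_le_finrank_succ
    simp only [Fintype.card_coe] at this
    exact this.trans (Nat.add_le_add_right (Submodule.finrank_le _) 1)
  have hcard' : (s.card : ℝ) ≤ Module.finrank ℝ E + 1 := by exact_mod_cast hcard
  nlinarith

end


section
variable {E : Type*} [NormedAddCommGroup E] [NormedSpace ℝ E] [FiniteDimensional ℝ E]
    [MeasurableSpace E] [BorelSpace E] (μ : Measure E) [μ.IsAddHaarMeasure]

/-- Points of `A` whose contraction towards `z` leaves `A`. -/
def badS (A : Set E) (ρ : ℝ) (z : E) : Set E := {a | a ∈ A ∧ (1 - ρ) • z + ρ • a ∉ A}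

theorem badS_meas {A : Set E} (hA : MeasurableSet A) (ρ : ℝ) (z : E) :
    MeasurableSet (badS A ρ z) := by
  refine hA.inter (hA.preimage (f := fun a => (1 - ρ) • z + ρ • a) ?_).compl
  exact ((continuous_const).add (continuous_id.const_smul ρ)).measurable

theorem badS_measurable {A : Set E} (hA : MeasurableSet A) (ρ : ℝ) :
    Measurable fun z => μ (badS A ρ z) := by
  have hm : MeasurableSet {p : E × E | p.2 ∈ A ∧ (1 - ρ) • p.1 + ρ • p.2 ∉ A} := by
    refine (hA.preimage measurable_snd).inter
      (hA.preimage (f := fun p : E × E => (1 - ρ) • p.1 + ρ • p.2) ?_).compl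
    exact (measurable_fst.const_smul (1 - ρ)).add (measurable_snd.const_smul ρ)
  exact measurable_measure_prodMk_left hm

theorem badS_int {A : Set E} (hA : IsCompact A) {ρ η : ℝ}
    (hη : ∀ h, μ.real (badT A h ρ) ≤ η) :
    ∫⁻ z in A, μ (badS A ρ z) ∂μ ≤ ENNReal.ofReal η * μ (A - A) := by
  have hAm := hA.measurableSet
  have hD : IsCompact (A - A) := by rw [sub_eq_add_neg]; exact hA.add hA.neg
  have hm : MeasurableSet {p : E × E | p.2 ∈ badT A p.1 ρ} := by
    refine (hAm.preimage measurable_snd).inter ((hAm.preimage (f := fun p : E × E => p.2 + p.1) ?_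
      ).inter (hAm.preimage (f := fun p : E × E => p.2 + ρ • p.1) ?_).compl)
    · exact measurable_snd.add measurable_fst
    · exact measurable_snd.add (measurable_fst.const_smul ρ)
  have e1 := Measure.prod_apply (μ := μ) (ν := μ) hm
  have e2 := Measure.prod_apply_symm (μ := μ) (ν := μ) hm
  simp only [preimage_ofPred_eq] at e1 e2
  rw [e1] at e2
  have hin : ∀ z, μ {h | z ∈ badT A h ρ} = A.indicator (fun z => μ (badS A ρ z)) z := by
    intro z
    by_cases hz : z ∈ A
    · rw [indicator_of_mem hz, ← measure_preimage_add μ z (badS A ρ z)]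
      congr 1
      ext h
      simp only [badT, badS, hz, true_and, mem_ofPred_eq, mem_preimage]
      have : (1 - ρ) • z + ρ • (z + h) = z + ρ • h := by
        rw [sub_smul, smul_add, one_smul]; abel
      rw [this]
    · rw [indicator_of_notMem hz]
      have : {h | z ∈ badT A h ρ} = ∅ := by
        ext h; simp [badT, hz]
      rw [this]; simp
  simp only [hin] at e2
  rw [lintegral_indicator hAm] at e2
  rw [← e2]
  calc ∫⁻ h, μ {x | x ∈ badT A h ρ} ∂μ ≤
      ∫⁻ h, (A - A).indicator (fun _ => ENNReal.ofReal η) h ∂μ := by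
        apply lintegral_mono
        intro h
        by_cases hh : h ∈ A - A
        · simp only [indicator_of_mem hh]
          have hfin : μ (badT A h ρ) ≠ ⊤ :=
            ((measure_mono fun x hx => hx.1).trans_lt hA.measure_lt_top).ne
          show μ (badT A h ρ) ≤ _
          rw [← ofReal_measureReal hfin]
          exact ENNReal.ofReal_le_ofReal (hη h)
        · simp only [indicator_of_notMem hh]
          have : {x | x ∈ badT A h ρ} = ∅ := by
            ext x
            simp only [mem_ofPred_eq, mem_empty_iff_false, iff_false]
            exact fun hx => hh ⟨x + h, hx.2.1, x, hx.1, by simp⟩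
          rw [this]; simp
    _ = _ := by rw [lintegral_indicator_const hD.measurableSet]

theorem badS_fin {A : Set E} (hA : IsCompact A) (ρ : ℝ) (z : E) : μ (badS A ρ z) ≠ ⊤ :=
  ((measure_mono fun _ hx => hx.1).trans_lt hA.measure_lt_top).ne

theorem badS_quasi {A : Set E} (hA : IsCompact A) {ρ η : ℝ} (hρ : 0 < ρ)
    (hη : ∀ h s, 0 ≤ s → s ≤ 1 → μ.real (badT A h s) ≤ η) (z z' : E) (s : ℝ) (hs0 : 0 ≤ s)
    (hs1 : s ≤ 1) :
    μ.real (badS A ρ ((1 - s) • z + s • z')) ≤ μ.real (badS A ρ z) + μ.real (badS A ρ z') +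
      (ρ ^ Module.finrank ℝ E)⁻¹ * η := by
  set h := (1 - ρ) • (z' - z) with hh
  have sub : badS A ρ ((1 - s) • z + s • z') ⊆ (badS A ρ z ∪ badS A ρ z') ∪
      {a | (1 - ρ) • z + ρ • a ∈ badT A h s} := by
    rintro a ⟨ha, hn⟩
    by_cases h1 : (1 - ρ) • z + ρ • a ∈ A
    swap
    · exact Or.inl (Or.inl ⟨ha, h1⟩)
    by_cases h2 : (1 - ρ) • z' + ρ • a ∈ A
    swap
    · exact Or.inl (Or.inr ⟨ha, h2⟩)
    right
    refine ⟨h1, ?_, ?_⟩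
    · convert h2 using 1
      rw [hh, smul_sub]; abel
    · convert hn using 2
      rw [hh]
      module
  have hTf : μ (badT A h s) ≠ ⊤ := ((measure_mono fun x hx => hx.1).trans_lt hA.measure_lt_top).ne
  have hpf : μ {a | (1 - ρ) • z + ρ • a ∈ badT A h s} ≠ ⊤ := by
    rw [pre_real μ hρ]
    exact ENNReal.mul_ne_top ENNReal.ofReal_ne_top hTf
  have m1 := measureReal_mono (μ := μ) sub (measure_union_lt_top (measure_union_lt_top
    (badS_fin μ hA _ _).lt_top (badS_fin μ hA _ _).lt_top) hpf.lt_top).ne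
  have m2 := measureReal_union_le (μ := μ) (badS A ρ z ∪ badS A ρ z')
    {a | (1 - ρ) • z + ρ • a ∈ badT A h s}
  have m3 := measureReal_union_le (μ := μ) (badS A ρ z) (badS A ρ z')
  rw [pre_real' μ hρ] at m2
  have m4 : (ρ ^ Module.finrank ℝ E)⁻¹ * μ.real (badT A h s) ≤ (ρ ^ Module.finrank ℝ E)⁻¹ * η := by
    gcongr
    exact hη h s hs0 hs1
  linarith

theorem step2_one {A : Set E} (hA : IsCompact A) {ρ η ε : ℝ} (hρ : 0 < ρ) (hρ1 : ρ ≤ 1)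
    (hε : 0 < ε) (hη : ∀ h s, 0 ≤ s → s ≤ 1 → μ.real (badT A h s) ≤ η) :
    ∃ A' ⊆ A, IsCompact A' ∧ μ.real A - (η * μ.real (A - A) / ε + ε) ≤ μ.real A' ∧
      ∀ z ∈ convexHull ℝ A', μ.real (badS A ρ z) ≤
        (Module.finrank ℝ E + 1) * (ε + (ρ ^ Module.finrank ℝ E)⁻¹ * η) := by
  have hη0 : 0 ≤ η := le_trans measureReal_nonneg (hη 0 0 le_rfl zero_le_one)
  have hD : IsCompact (A - A) := by rw [sub_eq_add_neg]; exact hA.add hA.neg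
  set G := A ∩ {z | μ (badS A ρ z) ≤ ENNReal.ofReal ε} with hG
  have hGm : MeasurableSet G :=
    hA.measurableSet.inter (measurableSet_le (badS_measurable μ hA.measurableSet ρ)
      measurable_const)
  have hGf : μ G ≠ ⊤ := ((measure_mono inter_subset_left).trans_lt hA.measure_lt_top).ne
  obtain ⟨A', hA'G, hA'c, hA'm⟩ := hGm.exists_isCompact_lt_add hGf
    (ε := ENNReal.ofReal ε) (by simpa using hε)
  have hintg := badS_int μ hA (ρ := ρ) (fun h => hη h ρ hρ.le hρ1)
  have mk := mul_meas_ge_le_lintegral (μ := μ.restrict A)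
    (badS_measurable μ hA.measurableSet ρ) (ENNReal.ofReal ε)
  have hAG : μ (A \ G) ≤ (μ.restrict A) {x | ENNReal.ofReal ε ≤ μ (badS A ρ x)} := by
    rw [Measure.restrict_apply (measurableSet_le measurable_const
      (badS_measurable μ hA.measurableSet ρ))]
    apply measure_mono
    rintro z ⟨hz, hzG⟩
    refine ⟨?_, hz⟩
    by_contra hc
    simp only [mem_ofPred_eq, not_le] at hc
    exact hzG ⟨hz, hc.le⟩
  have h1 : ENNReal.ofReal ε * μ (A \ G) ≤ ENNReal.ofReal η * μ (A - A) :=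
    le_trans (by gcongr) (mk.trans hintg)
  have h2 := ENNReal.toReal_mono (ENNReal.mul_ne_top ENNReal.ofReal_ne_top
    hD.measure_lt_top.ne) h1
  rw [ENNReal.toReal_mul, ENNReal.toReal_mul, ENNReal.toReal_ofReal hε.le,
    ENNReal.toReal_ofReal hη0] at h2
  have h3 : μ.real (A \ G) = μ.real A - μ.real G :=
    measureReal_sdiff inter_subset_left hGm hA.measure_lt_top.ne
  have h4 : μ.real A - μ.real G ≤ η * μ.real (A - A) / ε := by
    rw [← h3, le_div_iff₀ hε, mul_comm]; exact h2
  have h5 : μ.real G ≤ μ.real A' + ε := by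
    have := ENNReal.toReal_mono (ENNReal.add_ne_top.2 ⟨hA'c.measure_lt_top.ne,
      ENNReal.ofReal_ne_top⟩) hA'm.le
    rw [ENNReal.toReal_add hA'c.measure_lt_top.ne ENNReal.ofReal_ne_top,
      ENNReal.toReal_ofReal hε.le] at this
    exact this
  refine ⟨A', hA'G.trans inter_subset_left, hA'c, by linarith, ?_⟩
  refine quasi_hull (by positivity) hε.le (badS_quasi μ hA hρ hη) ?_
  intro z hz
  exact ENNReal.toReal_le_of_le_ofReal hε.le (hA'G hz).2
end


section
variable {E : Type*} [NormedAddCommGroup E] [NormedSpace ℝ E] [FiniteDimensional ℝ E]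
    [MeasurableSpace E] [BorelSpace E] (μ : Measure E) [μ.IsAddHaarMeasure]

theorem bm_min {t c : ℝ} (ht0 : 0 < t) (ht1 : t < 1) {A B S : Set E} (hA : MeasurableSet A)
    (hB : MeasurableSet B) (hc : 0 < c) (hcA : ENNReal.ofReal c ≤ μ A)
    (hcB : ENNReal.ofReal c ≤ μ B) (H : ∀ a ∈ A, ∀ b ∈ B, t • a + (1 - t) • b ∈ S) :
    ENNReal.ofReal c ≤ μ S := by
  refine le_trans ?_ (bm μ ht0 ht1 hA hB H)
  have ht1' : 0 ≤ 1 - t := by linarith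
  calc ENNReal.ofReal c = ENNReal.ofReal c ^ t * ENNReal.ofReal c ^ (1 - t) := by
        rw [← ENNReal.rpow_add _ _ (by simpa using hc) ENNReal.ofReal_ne_top]; simp
    _ ≤ _ := by gcongr

theorem good_lb {A : Set E} (hA : IsCompact A) {ρ b c : ℝ} {z : E} (hb : μ.real (badS A ρ z) ≤ b)
    (hc : c ≤ μ.real A - b) :
    ENNReal.ofReal c ≤ μ (A \ badS A ρ z) := by
  have h1 : μ.real (A \ badS A ρ z) = μ.real A - μ.real (badS A ρ z) :=
    measureReal_sdiff (fun _ h => h.1) (badS_meas hA.measurableSet _ _) hA.measure_lt_top.ne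
  rw [← ofReal_measureReal (((measure_mono sdiff_subset).trans_lt hA.measure_lt_top).ne)]
  apply ENNReal.ofReal_le_ofReal
  linarith

theorem hull_arith {N y c p W s : ℝ} (hN : 1 ≤ N) (hy : 0 < y) (hNy : N * y ≤ 1 / 20)
    (hc : 1 - (2 * N + 1) * y ≤ c) (hp : 1 - N * y ≤ p) (hs0 : 0 ≤ s) (hs : s ≤ 1 + y)
    (hW : 0 ≤ W) (H : W * c * p ≤ s ^ 2) : W ≤ 1 + 20 * N * y := by
  have hyN : y ≤ N * y := by nlinarith
  have h1 : 1 - 4 * (N * y) ≤ c * p := by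
    have : (1 - (2 * N + 1) * y) * (1 - N * y) ≤ c * p := by
      apply mul_le_mul hc hp <;> nlinarith
    nlinarith
  have h2 : s ^ 2 ≤ 1 + 3 * (N * y) := by nlinarith
  have h3 : W * (1 - 4 * (N * y)) ≤ 1 + 3 * (N * y) := by nlinarith
  have h4 : 1 + 3 * (N * y) ≤ (1 + 20 * (N * y)) * (1 - 4 * (N * y)) := by
    nlinarith [mul_nonneg (by linarith : 0 ≤ N * y) (by linarith : 0 ≤ 1 / 20 - N * y)]
  have h5 : W ≤ 1 + 20 * (N * y) := le_of_mul_le_mul_right (h3.trans h4) (by linarith)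
  linarith

set_option maxHeartbeats 800000 in
theorem step2 {t τ x y : ℝ} (hτ : 0 < τ) (hτt : τ ≤ t) (hτt' : τ ≤ 1 - t)
    (hx : 0 < x) (hx1 : x ≤ τ / 4) (hy : 0 < y)
    (hNy : ((Module.finrank ℝ E : ℝ) + 1) * y ≤ 1 / 20)
    (hxy : 1200 * x ≤ y ^ (Module.finrank ℝ E + 2) * τ ^ (4 * Module.finrank ℝ E + 5))
    {A B : Set E} (hA : IsCompact A) (hB : IsCompact B)
    (hα : 1 - x ^ 2 ≤ μ.real A) (hα' : μ.real A ≤ 1 + x ^ 2)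
    (hβ : 1 - x ^ 2 ≤ μ.real B) (hβ' : μ.real B ≤ 1 + x ^ 2)
    (hS : μ.real (t • A + (1 - t) • B) ≤ 1 + x ^ 2) :
    ∃ A' ⊆ A, ∃ B' ⊆ B, IsCompact A' ∧ IsCompact B' ∧ 1 - 3 * y ≤ μ.real A' ∧
      1 - 3 * y ≤ μ.real B' ∧
      μ.real (convexHull ℝ A') ≤ 1 + 20 * ((Module.finrank ℝ E : ℝ) + 1) * y ∧
      μ.real (convexHull ℝ B') ≤ 1 + 20 * ((Module.finrank ℝ E : ℝ) + 1) * y ∧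
      μ.real (t • convexHull ℝ A' + (1 - t) • convexHull ℝ B') ≤
        1 + 20 * ((Module.finrank ℝ E : ℝ) + 1) * y := by
  have ht0 : 0 < t := by linarith
  have ht1 : t < 1 := by linarith
  have ht1' : 0 < 1 - t := by linarith
  have hτ2 : τ ≤ 1 / 2 := by linarith
  have hx2 : x ^ 2 ≤ 1 / 4 := by nlinarith
  set d := Module.finrank ℝ E with hd
  set N : ℝ := (d : ℝ) + 1 with hN
  have hN1 : 1 ≤ N := by rw [hN]; linarith [Nat.cast_nonneg (α := ℝ) d]
  have hy1 : y ≤ 1 / 20 := by nlinarith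
  have hS' : μ.real ((1 - t) • B + (1 - (1 - t)) • A) ≤ 1 + x ^ 2 := by
    rw [sub_sub_cancel, add_comm]; exact hS
  set η := 150 * x / τ ^ (2 * d + 5) with hη
  have hη0 : 0 < η := by positivity
  have ηA : ∀ h s, 0 ≤ s → s ≤ 1 → μ.real (badT A h s) ≤ η := fun h s h0 h1 =>
    step1 μ hτ hτt hτt' hx hx1 h0 h1 hA hB hα hα' hβ hβ' hS h
  have ηB : ∀ h s, 0 ≤ s → s ≤ 1 → μ.real (badT B h s) ≤ η := fun h s h0 h1 =>
    step1 μ (t := 1 - t) hτ hτt' (by linarith) hx hx1 h0 h1 hB hA hβ hβ' hα hα' hS' h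
  have hS2 : μ.real (t • A + (1 - t) • B) ^ 2 ≤ 2 := by
    have := measureReal_nonneg (μ := μ) (s := t • A + (1 - t) • B)
    nlinarith
  have τd : τ ^ (2 * d) ≤ t ^ d * (1 - t) ^ d := by
    rw [two_mul, pow_add]; gcongr
  have τd' : 0 < τ ^ (2 * d) := by positivity
  have DA : μ.real (A - A) * τ ^ (2 * d) ≤ 8 := by
    have h := diff_bound μ ht0 ht1 hA hB
    have n := measureReal_nonneg (μ := μ) (s := A - A)
    have h1 : μ.real (A - A) * τ ^ (2 * d) * (1 / 2) ≤
        μ.real (A - A) * (t ^ d * (1 - t) ^ d) * μ.real B := by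
      gcongr; linarith
    have h2 := h.trans hS2
    rw [← hd] at h2
    linarith
  have DB : μ.real (B - B) * τ ^ (2 * d) ≤ 8 := by
    have h := diff_bound μ ht1' (by linarith) hB hA
    rw [sub_sub_cancel, add_comm] at h
    have n := measureReal_nonneg (μ := μ) (s := B - B)
    have h1 : μ.real (B - B) * τ ^ (2 * d) * (1 / 2) ≤
        μ.real (B - B) * (t ^ d * (1 - t) ^ d) * μ.real A := by
      gcongr; linarith
    have h2 := h.trans hS2
    rw [← hd] at h2
    linarith
  have ηy : 8 * η ≤ y ^ (d + 2) * τ ^ (2 * d) := by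
    rw [hη, ← mul_div_assoc, div_le_iff₀ (by positivity)]
    calc 8 * (150 * x) = 1200 * x := by ring
      _ ≤ _ := hxy
      _ = _ := by ring
  have hyd : y ^ (d + 2) ≤ y ^ 2 := pow_le_pow_of_le_one hy.le (by linarith) (by omega)
  have lossA : η * μ.real (A - A) / y ≤ y := by
    rw [div_le_iff₀ hy]
    have h1 : η * μ.real (A - A) ≤ y ^ (d + 2) * τ ^ (2 * d) / 8 * μ.real (A - A) := by
      gcongr; linarith
    have h2 : y ^ (d + 2) * (μ.real (A - A) * τ ^ (2 * d)) ≤ y ^ (d + 2) * 8 := by gcongr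
    nlinarith
  have lossB : η * μ.real (B - B) / y ≤ y := by
    rw [div_le_iff₀ hy]
    have h1 : η * μ.real (B - B) ≤ y ^ (d + 2) * τ ^ (2 * d) / 8 * μ.real (B - B) := by
      gcongr; linarith
    have h2 : y ^ (d + 2) * (μ.real (B - B) * τ ^ (2 * d)) ≤ y ^ (d + 2) * 8 := by gcongr
    nlinarith
  have hηρ : (y ^ d)⁻¹ * η ≤ y := by
    rw [inv_mul_le_iff₀ (by positivity)]
    have h1 : y ^ (d + 2) * τ ^ (2 * d) ≤ y ^ (d + 1) * 1 := by
      apply mul_le_mul _ _ τd'.le (by positivity)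
      · exact pow_le_pow_of_le_one hy.le (by linarith) (by omega)
      · exact pow_le_one₀ hτ.le (by linarith)
    have e : y ^ (d + 1) = y ^ d * y := pow_succ _ _
    rw [e] at h1
    linarith
  have hbN : N * (y + (y ^ d)⁻¹ * η) ≤ 2 * N * y := by nlinarith
  have hxy2 : x ^ 2 ≤ y := by
    have h0 : y ^ (d + 2) * τ ^ (4 * d + 5) ≤ y ^ 2 * 1 := by
      gcongr
      exact pow_le_one₀ hτ.le (by linarith)
    nlinarith
  obtain ⟨A', hA'A, cA', mA', bA⟩ := step2_one μ hA hy (by linarith) hy ηA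
  obtain ⟨B', hB'B, cB', mB', bB⟩ := step2_one μ hB hy (by linarith) hy ηB
  rw [← hd, ← hN] at bA bB
  have hp : 1 - N * y ≤ (1 - y) ^ d := by
    have := one_add_mul_le_pow (a := -y) (by linarith) d
    rw [← sub_eq_add_neg] at this
    refine le_trans ?_ this
    rw [hN]; linarith
  set c := 1 - (2 * N + 1) * y with hc
  have hc0 : 0 < c := by rw [hc]; linarith
  have goodsub : ∀ {A : Set E} {z : E}, A \ badS A y z ⊆ {q | q ∈ A ∧ (1 - y) • z + y • q ∈ A} := by
    rintro A z q ⟨hq, hn⟩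
    refine ⟨hq, ?_⟩
    by_contra h
    exact hn ⟨hq, h⟩
  have gA : ∀ z ∈ convexHull ℝ A', ENNReal.ofReal c ≤ μ (A \ badS A y z) := fun z hz =>
    good_lb μ hA ((bA z hz).trans hbN) (by rw [hc]; linarith)
  have gB : ∀ z ∈ convexHull ℝ B', ENNReal.ofReal c ≤ μ (B \ badS B y z) := fun z hz =>
    good_lb μ hB ((bB z hz).trans hbN) (by rw [hc]; linarith)
  have hSc : IsCompact (t • A + (1 - t) • B) := (hA.smul t).add (hB.smul (1 - t))
  refine ⟨A', hA'A, B', hB'B, cA', cB', by linarith, by linarith, ?_, ?_, ?_⟩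
  · have h := (markov_hull μ (by linarith) hA.measurableSet hA.measure_lt_top.ne hc0
      (fun z hz => (gA z hz).trans (measure_mono goodsub))).2
    exact hull_arith hN1 hy hNy le_rfl hp measureReal_nonneg (by linarith) measureReal_nonneg h
  · have h := (markov_hull μ (by linarith) hB.measurableSet hB.measure_lt_top.ne hc0
      (fun z hz => (gB z hz).trans (measure_mono goodsub))).2
    exact hull_arith hN1 hy hNy le_rfl hp measureReal_nonneg (by linarith) measureReal_nonneg h
  · have h := (markov_hull μ (ρ := y) (W := t • convexHull ℝ A' + (1 - t) • convexHull ℝ B')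
      (by linarith) hSc.measurableSet hSc.measure_lt_top.ne hc0 ?_).2
    · exact hull_arith hN1 hy hNy le_rfl hp measureReal_nonneg (by linarith) measureReal_nonneg h
    · rintro _ ⟨_, ⟨z, hz, rfl⟩, _, ⟨w, hw, rfl⟩, rfl⟩
      refine bm_min μ ht0 ht1 (hA.measurableSet.diff (badS_meas hA.measurableSet _ _))
        (hB.measurableSet.diff (badS_meas hB.measurableSet _ _)) hc0 (gA z hz) (gB w hw) ?_
      intro a ha b hb
      obtain ⟨a1, a2⟩ := goodsub ha
      obtain ⟨b1, b2⟩ := goodsub hb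
      refine ⟨add_mem_add (smul_mem_smul_set a1) (smul_mem_smul_set b1), ?_⟩
      have : (1 - y) • (t • z + (1 - t) • w) + y • (t • a + (1 - t) • b) =
        t • ((1 - y) • z + y • a) + (1 - t) • ((1 - y) • w + y • b) := by module
      show (1 - y) • (t • z + (1 - t) • w) + y • (t • a + (1 - t) • b) ∈ _
      rw [this]
      exact add_mem_add (smul_mem_smul_set a2) (smul_mem_smul_set b2)
end


/-- Near-equality in Brunn-Minkowski at `t = 1/2`. -/
def NT {E : Type*} [NormedAddCommGroup E] [NormedSpace ℝ E] [MeasurableSpace E]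
    (μ : Measure E) (X Y : Set E) (ω : ℝ) : Prop :=
  0 < μ.real X ∧ 0 < μ.real Y ∧
    μ.real ((1 / 2 : ℝ) • X + (1 / 2 : ℝ) • Y) ≤ (1 + ω) * μ.real X ∧
    μ.real ((1 / 2 : ℝ) • X + (1 / 2 : ℝ) • Y) ≤ (1 + ω) * μ.real Y

theorem NT.symm {E : Type*} [NormedAddCommGroup E] [NormedSpace ℝ E] [MeasurableSpace E]
    {μ : Measure E} {X Y : Set E} {ω : ℝ} (h : NT μ X Y ω) : NT μ Y X ω := by
  unfold NT at *
  rw [add_comm ((1 / 2 : ℝ) • Y)]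
  tauto

theorem half_rpow {u v z : ℝ} (hu : 0 < u) (hv : 0 < v)
    (h : u ^ (1 / 2 : ℝ) * v ^ (1 - 1 / 2 : ℝ) ≤ z) : u * v ≤ z ^ 2 := by
  rw [show (1 - 1 / 2 : ℝ) = 1 / 2 by norm_num, ← Real.sqrt_eq_rpow, ← Real.sqrt_eq_rpow] at h
  have h1 : (√u * √v) ^ 2 ≤ z ^ 2 := by gcongr
  rwa [mul_pow, Real.sq_sqrt hu.le, Real.sq_sqrt hv.le] at h1

section
variable {F : Type*} [NormedAddCommGroup F] [NormedSpace ℝ F] [FiniteDimensional ℝ F]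
    [MeasurableSpace F] [BorelSpace F] (ν : Measure F) [ν.IsAddHaarMeasure]

theorem proj_PQ {x : ℝ} (hx : 0 < x) (hx1 : x ≤ 1 / 8) {X Y : Set (ℝ × F)} (hX : IsCompact X)
    (hY : IsCompact Y) (h : NT (volume.prod ν) X Y (x ^ 2)) :
    ν.real (Prod.snd '' X) - ν.real (Prod.snd '' Y) ≤
      4 * x * (ν.real (Prod.snd '' X) + ν.real (Prod.snd '' Y)) := by
  obtain ⟨hα, hβ, h1, h2⟩ := h
  have hP := proj_pos ν hX hα
  have hQ := proj_pos ν hY hβ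
  set P := ν.real (Prod.snd '' X) with hPd
  set Q := ν.real (Prod.snd '' Y) with hQd
  set α := (volume.prod ν).real X with hαd
  set β := (volume.prod ν).real Y with hβd
  set M := min α β with hM
  have hM0 : 0 < M := lt_min hα hβ
  have hZM : (volume.prod ν).real ((1 / 2 : ℝ) • X + (1 / 2 : ℝ) • Y) ≤ (1 + x ^ 2) * M := by
    rw [hM, mul_min_of_nonneg _ _ (by positivity)]
    exact le_min h1 h2
  set R := P + Q with hR
  have hR0 : 0 < R := by positivity
  set κ := x * M / R with hκ
  have hκ0 : 0 < κ := by positivity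
  have key := tilt ν (t := 1 / 2) (κ := κ) (c := 0) (ℓ := 0) (s := 0) (by norm_num) (by norm_num)
    hκ0.le le_rfl zero_le_one le_rfl (by norm_num) hX hY (by intro y; simp; positivity)
  have hZc : IsCompact ((1 / 2 : ℝ) • X + (1 - 1 / 2 : ℝ) • Y) := (hX.smul _).add (hY.smul _)
  have κQ : κ * Q = (x * (Q / R)) * M := by rw [hκ]; ring
  have κP : κ * P = (x * (P / R)) * M := by rw [hκ]; ring
  set p := x * (P / R) with hp
  set q := x * (Q / R) with hq
  have hpq : p + q = x := by rw [hp, hq, ← mul_add, ← add_div, div_self hR0.ne', mul_one]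
  have hp0 : 0 < p := by positivity
  have hq0 : 0 < q := by positivity
  have H := ennreal_bm (x := M + κ * P) (y := M - κ * Q) (z := (1 + x ^ 2) * M)
    (by norm_num : (0 : ℝ) < 1 / 2) (by norm_num) (by positivity) (by rw [κQ]; nlinarith) key
    ?_ ?_ ?_ (by positivity)
  · have H2 := half_rpow (by positivity) (by rw [κQ]; nlinarith) H
    rw [κP, κQ] at H2
    have H3 : (1 + p) * (1 - q) ≤ (1 + x ^ 2) ^ 2 := by
      have e1 : (M + p * M) * (M - q * M) = ((1 + p) * (1 - q)) * M ^ 2 := by ring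
      have e2 : ((1 + x ^ 2) * M) ^ 2 = (1 + x ^ 2) ^ 2 * M ^ 2 := by ring
      rw [e1, e2] at H2
      exact le_of_mul_le_mul_right H2 (by positivity)
    have H4 : p - q ≤ 4 * x ^ 2 := by
      have : p * q ≤ x ^ 2 := by nlinarith
      nlinarith
    have H5 : (P - Q) * x ≤ 4 * x * R * x := by
      have : p - q = (P - Q) * x / R := by rw [hp, hq]; ring
      rw [this, div_le_iff₀ hR0] at H4
      linarith
    exact le_of_mul_le_mul_right H5 hx
  · have e : (volume.prod ν) X + ENNReal.ofReal 0 * (volume.prod ν) (badT X (0, 0) 0) +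
        ENNReal.ofReal (κ * (1 - 1 / 2) / (1 / 2)) * ν (Prod.snd '' X) =
        ENNReal.ofReal (α + κ * P) := by
      rw [ENNReal.ofReal_add (by positivity) (by positivity), ENNReal.ofReal_mul hκ0.le, hPd,
        ofReal_measureReal (hX.image continuous_snd).measure_lt_top.ne, hαd,
        ofReal_measureReal hX.measure_lt_top.ne]
      have : κ * (1 - 1 / 2) / (1 / 2) = κ := by ring
      rw [this]; simp
    rw [e]
    apply ENNReal.ofReal_le_ofReal
    have := min_le_left α β
    linarith
  · have e : (volume.prod ν) Y - ENNReal.ofReal κ * ν (Prod.snd '' Y) =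
        ENNReal.ofReal (β - κ * Q) := by
      rw [ENNReal.ofReal_sub _ (by positivity), ENNReal.ofReal_mul hκ0.le, hQd,
        ofReal_measureReal (hY.image continuous_snd).measure_lt_top.ne, hβd,
        ofReal_measureReal hY.measure_lt_top.ne]
    rw [e]
    apply ENNReal.ofReal_le_ofReal
    have := min_le_right α β
    linarith
  · rw [← ofReal_measureReal hZc.measure_lt_top.ne]
    apply ENNReal.ofReal_le_ofReal
    rw [show (1 - 1 / 2 : ℝ) = 1 / 2 by norm_num]
    exact hZM

/-- Both heights are lowered by `κ`. -/
theorem tilt_down {κ : ℝ} (hκ : 0 ≤ κ) {X Y : Set (ℝ × F)} (hX : IsCompact X) (hY : IsCompact Y) :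
    ((volume.prod ν) X - ENNReal.ofReal κ * ν (Prod.snd '' X)) ^ (1 / 2 : ℝ) *
      ((volume.prod ν) Y - ENNReal.ofReal κ * ν (Prod.snd '' Y)) ^ (1 - 1 / 2 : ℝ) +
      ENNReal.ofReal κ * ν (Prod.snd '' ((1 / 2 : ℝ) • X + (1 / 2 : ℝ) • Y) ∩
        {z | κ ≤ fl ((1 / 2 : ℝ) • X + (1 / 2 : ℝ) • Y) z}) ≤
      (volume.prod ν) ((1 / 2 : ℝ) • X + (1 / 2 : ℝ) • Y) := by
  have hZ : IsCompact ((1 / 2 : ℝ) • X + (1 / 2 : ℝ) • Y) := (hX.smul _).add (hY.smul _)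
  set Z := (1 / 2 : ℝ) • X + (1 / 2 : ℝ) • Y with hZd
  have low : ∀ {B : Set (ℝ × F)}, IsCompact B →
      (volume.prod ν) B - ENNReal.ofReal κ * ν (Prod.snd '' B) ≤
      ∫⁻ y in Prod.snd '' B ∩ {y | κ ≤ fl B y}, ENNReal.ofReal (fl B y - κ) ∂ν := by
    intro B hB
    have mB := fl_meas hB.measurableSet
    have pB : MeasurableSet (Prod.snd '' B) := (hB.image continuous_snd).measurableSet
    have hVm : MeasurableSet (Prod.snd '' B ∩ {y | κ ≤ fl B y}) :=
      pB.inter (measurableSet_le measurable_const mB)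
    rw [tsub_le_iff_right]
    calc (volume.prod ν) B = ∫⁻ y in Prod.snd '' B, ENNReal.ofReal (fl B y) ∂ν :=
          (lint_fl ν hB.measurableSet hB subset_rfl).symm
      _ ≤ ∫⁻ y in Prod.snd '' B, ((Prod.snd '' B ∩ {y | κ ≤ fl B y}).indicator
            (fun y => ENNReal.ofReal (fl B y - κ)) y + ENNReal.ofReal κ) ∂ν := by
          apply setLIntegral_mono' pB
          intro y hy
          by_cases hyV : y ∈ Prod.snd '' B ∩ {y | κ ≤ fl B y}
          · rw [indicator_of_mem hyV, ← ENNReal.ofReal_add (sub_nonneg.2 hyV.2) hκ]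
            simp
          · rw [indicator_of_notMem hyV, zero_add]
            apply ENNReal.ofReal_le_ofReal
            by_contra h
            push Not at h
            exact hyV ⟨hy, h.le⟩
      _ = _ := by
          rw [lintegral_add_right _ measurable_const, lintegral_indicator hVm,
            Measure.restrict_restrict hVm, inter_eq_left.2 inter_subset_left, lintegral_const]
          simp only [Measure.restrict_apply_univ]
  have vm : ∀ {B : Set (ℝ × F)}, IsCompact B →
      MeasurableSet (Prod.snd '' B ∩ {y | κ ≤ fl B y}) := fun hB =>
    (hB.image continuous_snd).measurableSet.inter
      (measurableSet_le measurable_const (fl_meas hB.measurableSet))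
  have key := sub_bm ν (t := 1 / 2) (by norm_num) (by norm_num) (vm hX) (vm hY) (vm hZ)
    (p := fun y => fl X y - κ) (q := fun y => fl Y y - κ) (r := fun z => fl Z z - κ)
    ((fl_meas hX.measurableSet).sub_const _) ((fl_meas hY.measurableSet).sub_const _)
    ((fl_meas hZ.measurableSet).sub_const _) ?_
  · have k2 : ((volume.prod ν) X - ENNReal.ofReal κ * ν (Prod.snd '' X)) ^ (1 / 2 : ℝ) *
      ((volume.prod ν) Y - ENNReal.ofReal κ * ν (Prod.snd '' Y)) ^ (1 - 1 / 2 : ℝ) ≤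
        ∫⁻ z in Prod.snd '' Z ∩ {z | κ ≤ fl Z z}, ENNReal.ofReal (fl Z z - κ) ∂ν := by
      refine le_trans ?_ key
      have : (0 : ℝ) ≤ 1 - 1 / 2 := by norm_num
      gcongr
      · exact low hX
      · exact low hY
    refine (add_le_add_left k2 _).trans ?_
    calc _ = ∫⁻ z in Prod.snd '' Z ∩ {z | κ ≤ fl Z z},
          (ENNReal.ofReal (fl Z z - κ) + ENNReal.ofReal κ) ∂ν := by
          rw [lintegral_add_right _ measurable_const, lintegral_const]
          simp only [Measure.restrict_apply_univ]
      _ = ∫⁻ z in Prod.snd '' Z ∩ {z | κ ≤ fl Z z}, ENNReal.ofReal (fl Z z) ∂ν := by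
          apply setLIntegral_congr_fun (vm hZ)
          intro z hz
          simp only
          rw [← ENNReal.ofReal_add (sub_nonneg.2 hz.2) hκ]
          simp
      _ ≤ ∫⁻ z in Prod.snd '' Z, ENNReal.ofReal (fl Z z) ∂ν :=
          lintegral_mono_set inter_subset_left
      _ = _ := lint_fl ν hZ.measurableSet hZ subset_rfl
  · rintro _ ⟨⟨⟨r, y⟩, hy, rfl⟩, hκy⟩ _ ⟨⟨⟨r', y'⟩, hy', rfl⟩, hκy'⟩
    simp only [mem_ofPred_eq] at hκy hκy' ⊢
    rw [show (1 - 1 / 2 : ℝ) = 1 / 2 by norm_num]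
    have f1 : (1 / 2) * fl X y + (1 / 2) * fl Y y' ≤ fl Z ((1 / 2 : ℝ) • y + (1 / 2 : ℝ) • y') := by
      have sub : (1 / 2 : ℝ) • fib X y + (1 / 2 : ℝ) • fib Y y' ⊆
          fib Z ((1 / 2 : ℝ) • y + (1 / 2 : ℝ) • y') := by
        rintro _ ⟨_, ⟨u, hu, rfl⟩, _, ⟨w, hw, rfl⟩, rfl⟩
        exact ⟨_, smul_mem_smul_set hu, _, smul_mem_smul_set hw, by simp⟩
      have cX := (fib_compact hX y).smul (1 / 2 : ℝ)
      have cY := (fib_compact hY y').smul (1 / 2 : ℝ)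
      have b := bm1_compact cX cY (Nonempty.smul_set ⟨r, hy⟩) (Nonempty.smul_set ⟨r', hy'⟩)
      have b2 := ENNReal.toReal_mono (fib_compact hZ _).measure_lt_top.ne
        (b.trans (measure_mono sub))
      rw [ENNReal.toReal_add cX.measure_lt_top.ne cY.measure_lt_top.ne, Measure.addHaar_smul,
        Measure.addHaar_smul, ENNReal.toReal_mul, ENNReal.toReal_mul] at b2
      simp only [Module.finrank_self, pow_one] at b2
      rw [abs_of_pos (by norm_num), ENNReal.toReal_ofReal (by norm_num)] at b2
      exact b2
    refine ⟨⟨⟨_, add_mem_add (smul_mem_smul_set hy) (smul_mem_smul_set hy'), by simp⟩, ?_⟩, ?_⟩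
    · show κ ≤ fl Z _
      linarith
    · linarith
end


section
variable {F : Type*} [NormedAddCommGroup F] [NormedSpace ℝ F] [FiniteDimensional ℝ F]
    [MeasurableSpace F] [BorelSpace F] (ν : Measure F) [ν.IsAddHaarMeasure]

theorem fl_lb {Z : Set (ℝ × F)} (hZ : IsCompact Z) {z : F} {V : Set ℝ} {a c : ℝ} (hc : 0 < c)
    (h : ∀ r ∈ V, (a + c * r, z) ∈ Z) : c * volume.real V ≤ fl Z z := by
  have h1 : a +ᵥ (c • V) ⊆ fib Z z := by
    rintro _ ⟨_, ⟨r, hr, rfl⟩, rfl⟩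
    simpa [fib] using h r hr
  have h2 := measureReal_mono (μ := volume) h1 (fib_compact hZ z).measure_lt_top.ne
  rw [vadd_real, smul_real volume hc] at h2
  simpa [fl] using h2

set_option maxHeartbeats 800000 in
theorem proj_NT_prod {x : ℝ} (hx : 0 < x) (hx1 : x ≤ 1 / 8)
    (hmx : 8 * (Module.finrank ℝ F : ℝ) * x ≤ 1) {X Y : Set (ℝ × F)}
    (hX : IsCompact X) (hY : IsCompact Y) (cX : Convex ℝ X) (cY : Convex ℝ Y)
    (h : NT (volume.prod ν) X Y (x ^ 2)) :
    NT ν (Prod.snd '' X) (Prod.snd '' Y) (40 * ((Module.finrank ℝ F : ℝ) + 1) * x) := by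
  have hPQ := proj_PQ ν hx hx1 hX hY h
  have hQP := proj_PQ ν hx hx1 hY hX h.symm
  have down := tilt_down ν (κ := x * min ((volume.prod ν).real X) ((volume.prod ν).real Y) /
    (ν.real (Prod.snd '' X) + ν.real (Prod.snd '' Y))) (by positivity) hX hY
  obtain ⟨hα, hβ, h1, h2⟩ := h
  have hP := proj_pos ν hX hα
  have hQ := proj_pos ν hY hβ
  have hZc : IsCompact ((1 / 2 : ℝ) • X + (1 / 2 : ℝ) • Y) := (hX.smul _).add (hY.smul _)
  have cZ : Convex ℝ ((1 / 2 : ℝ) • X + (1 / 2 : ℝ) • Y) := (cX.smul _).add (cY.smul _)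
  have hπZ : (1 / 2 : ℝ) • (Prod.snd '' X) + (1 / 2 : ℝ) • (Prod.snd '' Y) =
      Prod.snd '' ((1 / 2 : ℝ) • X + (1 / 2 : ℝ) • Y) := by
    have := image_add (LinearMap.snd ℝ ℝ F) (s := (1 / 2 : ℝ) • X) (t := (1 / 2 : ℝ) • Y)
    rw [image_smul_set, image_smul_set] at this
    exact this.symm
  set m := Module.finrank ℝ F with hm
  set P := ν.real (Prod.snd '' X) with hPd
  set Q := ν.real (Prod.snd '' Y) with hQd
  set α := (volume.prod ν).real X with hαd
  set β := (volume.prod ν).real Y with hβd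
  set M := min α β with hM
  have hM0 : 0 < M := lt_min hα hβ
  have hZM : (volume.prod ν).real ((1 / 2 : ℝ) • X + (1 / 2 : ℝ) • Y) ≤ (1 + x ^ 2) * M := by
    rw [hM, mul_min_of_nonneg _ _ (by positivity)]
    exact le_min h1 h2
  set Z := (1 / 2 : ℝ) • X + (1 / 2 : ℝ) • Y with hZd
  set R := P + Q with hR
  have hR0 : 0 < R := by positivity
  set κ := x * M / R with hκ
  have hκ0 : 0 < κ := by positivity
  set W := Prod.snd '' Z ∩ {z | κ ≤ fl Z z} with hW
  have hπc : IsCompact (Prod.snd '' Z) := hZc.image continuous_snd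
  have hWf : ν W ≠ ⊤ := ((measure_mono inter_subset_left).trans_lt hπc.measure_lt_top).ne
  -- upper bound for W
  have κR : κ * R = x * M := by rw [hκ]; field_simp
  have hmaxR : max P Q ≤ R := max_le (by linarith) (by linarith)
  have hκm : κ * max P Q ≤ x * M := by rw [← κR]; gcongr
  have hpos : 0 < M - κ * max P Q := by nlinarith
  have low : ENNReal.ofReal (M - κ * max P Q) ≤
      ((volume.prod ν) X - ENNReal.ofReal κ * ν (Prod.snd '' X)) ^ (1 / 2 : ℝ) *
      ((volume.prod ν) Y - ENNReal.ofReal κ * ν (Prod.snd '' Y)) ^ (1 - 1 / 2 : ℝ) := by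
    have a1 : ENNReal.ofReal (M - κ * max P Q) ≤
        (volume.prod ν) X - ENNReal.ofReal κ * ν (Prod.snd '' X) := by
      rw [← ofReal_measureReal (μ := volume.prod ν) hX.measure_lt_top.ne,
        ← ofReal_measureReal (μ := ν) (hX.image continuous_snd).measure_lt_top.ne,
        ← ENNReal.ofReal_mul hκ0.le, ← ENNReal.ofReal_sub _ (by positivity)]
      apply ENNReal.ofReal_le_ofReal
      have : κ * P ≤ κ * max P Q := by gcongr; exact le_max_left _ _
      have := min_le_left α β
      linarith
    have a2 : ENNReal.ofReal (M - κ * max P Q) ≤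
        (volume.prod ν) Y - ENNReal.ofReal κ * ν (Prod.snd '' Y) := by
      rw [← ofReal_measureReal (μ := volume.prod ν) hY.measure_lt_top.ne,
        ← ofReal_measureReal (μ := ν) (hY.image continuous_snd).measure_lt_top.ne,
        ← ENNReal.ofReal_mul hκ0.le, ← ENNReal.ofReal_sub _ (by positivity)]
      apply ENNReal.ofReal_le_ofReal
      have : κ * Q ≤ κ * max P Q := by gcongr; exact le_max_right _ _
      have := min_le_right α β
      linarith
    calc ENNReal.ofReal (M - κ * max P Q) = ENNReal.ofReal (M - κ * max P Q) ^ (1 / 2 : ℝ) *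
          ENNReal.ofReal (M - κ * max P Q) ^ (1 - 1 / 2 : ℝ) := by
          rw [← ENNReal.rpow_add _ _ (by simpa using hpos) (by simp)]; simp
      _ ≤ _ := by
          have : (0 : ℝ) ≤ 1 - 1 / 2 := by norm_num
          gcongr
  have up : M - κ * max P Q + κ * ν.real W ≤ (1 + x ^ 2) * M := by
    have := (add_le_add_left low _).trans down
    rw [← ofReal_measureReal hWf, ← ofReal_measureReal hZc.measure_lt_top.ne,
      ← ENNReal.ofReal_mul hκ0.le, ← ENNReal.ofReal_add hpos.le (by positivity),
      ENNReal.ofReal_le_ofReal_iff (by positivity)] at this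
    linarith
  have up2 : ν.real W ≤ x * R + max P Q := by
    have : κ * ν.real W ≤ κ * (x * R + max P Q) := by
      have : κ * (x * R) = x ^ 2 * M := by
        calc κ * (x * R) = x * (κ * R) := by ring
          _ = _ := by rw [κR]; ring
      linarith
    exact le_of_mul_le_mul_left this hκ0
  have hmin0 : 0 < min P Q := lt_min hP hQ
  have hR4 : R ≤ 4 * min P Q := by
    have : 4 * x * R ≤ 1 / 2 * R := by nlinarith
    rcases le_total P Q with h | h
    · rw [min_eq_left h]; linarith
    · rw [min_eq_right h]; linarith
  have up3 : ν.real W ≤ (1 + 20 * x) * min P Q := by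
    have : max P Q ≤ min P Q + 4 * x * R := by
      rcases le_total P Q with h | h
      · rw [min_eq_left h, max_eq_right h]; linarith
      · rw [min_eq_right h, max_eq_left h]; linarith
    have : x * R ≤ x * (4 * min P Q) := by gcongr
    linarith
  -- lower bound for W
  obtain ⟨y1, hy1⟩ : ∃ y, α / (2 * P) < fl X y := by
    by_contra hc
    push Not at hc
    have := meas_le_sup ν hX hc
    rw [← hαd, ← hPd] at this
    have e : α / (2 * P) * P = α / 2 := by field_simp
    linarith
  have Yne : Y.Nonempty := by
    by_contra hc
    rw [not_nonempty_iff_eq_empty] at hc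
    rw [hβd, hc] at hβ
    simp at hβ
  obtain ⟨⟨b, y2⟩, hb⟩ := Yne
  have hy1X : y1 ∈ Prod.snd '' X := by
    by_contra hc
    rw [fl_zero hc] at hy1
    have : 0 < α / (2 * P) := by positivity
    linarith
  set y0 := (1 / 2 : ℝ) • y1 + (1 / 2 : ℝ) • y2 with hy0
  have f0 : α / (4 * P) ≤ fl Z y0 := by
    have : 1 / 2 * volume.real (fib X y1) ≤ fl Z y0 := by
      apply fl_lb hZc (a := 1 / 2 * b) (by norm_num)
      intro r hr
      refine ⟨_, smul_mem_smul_set (show (r, y1) ∈ X from hr), _, smul_mem_smul_set hb, ?_⟩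
      simp [hy0, add_comm]
    have e : α / (4 * P) = 1 / 2 * (α / (2 * P)) := by field_simp; norm_num
    rw [e]
    change 1 / 2 * fl X y1 ≤ _ at this
    linarith
  have hsub : {w | w ∈ W} ⊇ (4 * x) • y0 +ᵥ ((1 - 4 * x) • Prod.snd '' Z) := by
    rintro _ ⟨_, ⟨_, ⟨⟨a, w⟩, hw, rfl⟩, rfl⟩, rfl⟩
    have key : 4 * x * volume.real (fib Z y0) ≤ fl Z ((4 * x) • y0 + (1 - 4 * x) • w) := by
      apply fl_lb hZc (a := (1 - 4 * x) * a) (by positivity)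
      intro r hr
      have := cZ hw (show (r, y0) ∈ Z from hr) (a := 1 - 4 * x) (b := 4 * x) (by linarith)
        (by positivity) (by ring)
      simpa [add_comm] using this
    have k2 : κ ≤ fl Z ((4 * x) • y0 + (1 - 4 * x) • w) := by
      refine le_trans ?_ key
      change κ ≤ 4 * x * fl Z y0
      have : κ ≤ x * α / P := by
        rw [hκ]
        gcongr
        · exact min_le_left _ _
        · linarith
      have e : x * α / P = 4 * x * (α / (4 * P)) := by field_simp
      have : 4 * x * (α / (4 * P)) ≤ 4 * x * fl Z y0 := by gcongr
      linarith
    refine ⟨?_, k2⟩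
    by_contra hc
    simp only [vadd_eq_add] at hc
    rw [fl_zero hc] at k2
    linarith
  have lo := measureReal_mono (μ := ν) hsub hWf
  rw [vadd_real, smul_real ν (by linarith), ← hm] at lo
  have lo1 : (1 - 4 * (m : ℝ) * x) ≤ (1 - 4 * x) ^ m := by
    have := one_add_mul_le_pow (a := -(4 * x)) (by linarith) m
    have e : 1 + -(4 * x) = 1 - 4 * x := by ring
    rw [e] at this
    linarith
  have hfin : ν.real (Prod.snd '' Z) ≤ (1 + 40 * ((m : ℝ) + 1) * x) * min P Q := by
    have hZ0 : 0 ≤ ν.real (Prod.snd '' Z) := measureReal_nonneg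
    have hW2 : ν.real {w | w ∈ W} = ν.real W := rfl
    have l2 : (1 - 4 * (m : ℝ) * x) * ν.real (Prod.snd '' Z) ≤ (1 + 20 * x) * min P Q := by
      have := mul_le_mul_of_nonneg_right lo1 hZ0
      linarith
    have hm0 : (0 : ℝ) ≤ m := by positivity
    have l3 : (1 + 20 * x) ≤ (1 - 4 * (m : ℝ) * x) * (1 + 40 * ((m : ℝ) + 1) * x) := by
      set p := (m : ℝ) * x with hp
      have hp0 : 0 ≤ p := by positivity
      have e : 40 * ((m : ℝ) + 1) * x = 40 * p + 40 * x := by rw [hp]; ring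
      rw [e, mul_assoc, ← hp]
      rw [mul_assoc, ← hp] at hmx
      nlinarith
    have l4 : (1 - 4 * (m : ℝ) * x) * ν.real (Prod.snd '' Z) ≤
        (1 - 4 * (m : ℝ) * x) * ((1 + 40 * ((m : ℝ) + 1) * x) * min P Q) := by
      have := mul_le_mul_of_nonneg_right l3 hmin0.le
      linarith
    exact le_of_mul_le_mul_left l4 (by linarith)
  refine ⟨hP, hQ, ?_, ?_⟩
  · rw [hπZ]
    refine hfin.trans ?_
    gcongr
    exact min_le_left _ _
  · rw [hπZ]
    refine hfin.trans ?_
    gcongr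
    exact min_le_right _ _
end


theorem NT.mono {E : Type*} [NormedAddCommGroup E] [NormedSpace ℝ E] [MeasurableSpace E]
    {μ : Measure E} {X Y : Set E} {ω ω' : ℝ} (h : NT μ X Y ω) (hω : ω ≤ ω') : NT μ X Y ω' := by
  obtain ⟨h1, h2, h3, h4⟩ := h
  refine ⟨h1, h2, h3.trans ?_, h4.trans ?_⟩ <;> gcongr

theorem width_base {E : Type*}
    [NormedAddCommGroup E] [NormedSpace ℝ E] [FiniteDimensional ℝ E]
    [MeasurableSpace E] [BorelSpace E] (μ : Measure E) [μ.IsAddHaarMeasure]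
    (hd : Module.finrank ℝ E = 1) {ω : ℝ} {X Y : Set E} (hX : IsCompact X) (hY : IsCompact Y)
    (h : NT μ X Y ω) (f : E →L[ℝ] ℝ) (hf : f ≠ 0) :
    volume.real (f '' X) ≤ (1 + 2 * ω) * volume.real (f '' Y) := by
  obtain ⟨a, ha⟩ : ∃ a, f a ≠ 0 := by
    by_contra hc; push Not at hc; exact hf (ContinuousLinearMap.ext hc)
  have hf1 : f ((f a)⁻¹ • a) = 1 := by simp [ha]
  obtain ⟨ν, hν, L, hL, hL1, hL2⟩ := decomp μ f _ hf1
  have hfr := finrank_ker_f f _ hf1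
  have hs : Subsingleton (f : E →ₗ[ℝ] ℝ).ker := (Module.finrank_zero_iff (R := ℝ)).1 (by omega)
  have mr : ∀ X : Set E, μ.real X = volume.real (f '' X) * ν.real univ := by
    intro X
    have me : MeasurableEmbedding L := L.toHomeomorph.measurableEmbedding
    have e : L '' X = (f '' X) ×ˢ univ := by
      ext ⟨r, y⟩
      constructor
      · rintro ⟨x, hx, hxe⟩
        refine ⟨⟨x, hx, ?_⟩, trivial⟩
        rw [← hL1, hxe]
      · rintro ⟨⟨x, hx, hxe⟩, -⟩
        exact ⟨x, hx, Prod.ext ((hL1 x).trans hxe) (Subsingleton.elim _ _)⟩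
    unfold Measure.real
    rw [← ENNReal.toReal_mul, ← Measure.prod_prod, ← e, ← hL.measure_preimage_emb me,
      preimage_image_eq _ L.injective]
  obtain ⟨h1, h2, h3, h4⟩ := h
  rw [mr] at h1 h2 h3 h4
  rw [mr Y] at h4
  have hc : 0 < ν.real univ := by
    rcases (measureReal_nonneg (μ := ν) (s := univ)).eq_or_lt with h | h
    · rw [← h] at h1; simp at h1
    · exact h
  have h4' : volume.real (f '' ((1 / 2 : ℝ) • X + (1 / 2 : ℝ) • Y)) ≤
      (1 + ω) * volume.real (f '' Y) := by
    rw [← mul_assoc] at h4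
    exact le_of_mul_le_mul_right h4 hc
  have Xn : X.Nonempty := by
    by_contra hc
    rw [not_nonempty_iff_eq_empty] at hc
    simp [hc] at h1
  have Yn : Y.Nonempty := by
    by_contra hc
    rw [not_nonempty_iff_eq_empty] at hc
    simp [hc] at h2
  have cX := (hX.image f.continuous).smul (1 / 2 : ℝ)
  have cY := (hY.image f.continuous).smul (1 / 2 : ℝ)
  have b := bm1_compact cX cY (Xn.image f).smul_set (Yn.image f).smul_set
  rw [image_add f, image_smul_set, image_smul_set] at h4'
  have b2 := ENNReal.toReal_mono (cX.add cY).measure_lt_top.ne b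
  rw [ENNReal.toReal_add cX.measure_lt_top.ne cY.measure_lt_top.ne] at b2
  change volume.real _ + volume.real _ ≤ volume.real _ at b2
  rw [smul_real volume (by norm_num), smul_real volume (by norm_num)] at b2
  simp only [Module.finrank_self, pow_one] at b2
  linarith

theorem width.{u} (n : ℕ) (hn : 1 ≤ n) {u : ℝ} (hu : 0 < u) (hu1 : 320 * (n : ℝ) ^ 2 * u ≤ 1)
    (k : ℕ) : ∀ {E : Type u}
    [NormedAddCommGroup E] [NormedSpace ℝ E] [FiniteDimensional ℝ E]
    [MeasurableSpace E] [BorelSpace E] (μ : Measure E) [μ.IsAddHaarMeasure]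
    (_ : Module.finrank ℝ E = k + 1) (_ : k + 1 ≤ n)
    {X Y : Set E} (_ : IsCompact X) (_ : IsCompact Y) (_ : Convex ℝ X) (_ : Convex ℝ Y)
    (_ : NT μ X Y ((40 * n) ^ 2 * u ^ 2 ^ k)) (f : E →L[ℝ] ℝ) (_ : f ≠ 0),
    volume.real (f '' X) ≤ (1 + 2 * ((40 * n) ^ 2 * u)) * volume.real (f '' Y) := by
  have hn1 : (1 : ℝ) ≤ n := by exact_mod_cast hn
  have hu' : u ≤ 1 := by nlinarith
  induction k with
  | zero =>
    intro E _ _ _ _ _ μ _ hd _ X Y hX hY _ _ h f hf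
    simp only [pow_zero, pow_one] at h
    exact width_base μ hd hX hY h f hf
  | succ k ih =>
    intro E _ _ _ _ _ μ _ hd hkn X Y hX hY cX cY h f hf
    obtain ⟨a, ha⟩ : ∃ a, f a ≠ 0 := by
      by_contra hc; push Not at hc; exact hf (ContinuousLinearMap.ext hc)
    have hf1 : f ((f a)⁻¹ • a) = 1 := by simp [ha]
    have hfr := finrank_ker_f f _ hf1
    have : Nontrivial (f : E →ₗ[ℝ] ℝ).ker :=
      Module.nontrivial_of_finrank_pos (R := ℝ) (by omega)
    obtain ⟨⟨h0, hh0⟩, hne⟩ := exists_ne (0 : (f : E →ₗ[ℝ] ℝ).ker)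
    have hne' : h0 ≠ 0 := by simpa using hne
    have hfh : f h0 = 0 := hh0
    obtain ⟨g, hg⟩ := SeparatingDual.exists_eq_one (R := ℝ) hne'
    obtain ⟨ν, hν, L, hL, hL1, hL2⟩ := decomp μ g h0 hg
    have hfr2 := finrank_ker_f g h0 hg
    have hdk : Module.finrank ℝ (g : E →ₗ[ℝ] ℝ).ker = k + 1 := by omega
    have mr : ∀ X : Set E, (volume.prod ν).real (L '' X) = μ.real X := by
      intro X
      unfold Measure.real
      have me : MeasurableEmbedding L := L.toHomeomorph.measurableEmbedding
      rw [← hL.measure_preimage_emb me, preimage_image_eq _ L.injective]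
    have hupow : u ^ 2 ^ k ≤ u := pow_le_of_le_one hu.le hu' (by positivity)
    have hupow0 : 0 < u ^ 2 ^ k := by positivity
    have hk : ((k : ℝ) + 1) ≤ n := by
      have : ((k + 1 : ℕ) : ℝ) ≤ n := by exact_mod_cast (by omega : k + 1 ≤ n)
      simpa using this
    have hup2 : 320 * (n : ℝ) ^ 2 * u ^ 2 ^ k ≤ 1 := by
      refine le_trans ?_ hu1
      gcongr
    have key := proj_NT_prod ν (x := 40 * n * u ^ 2 ^ k) (by positivity) (by nlinarith) (by
        rw [hdk]; push_cast
        have : ((k : ℝ) + 1) * (n * u ^ 2 ^ k) ≤ n * (n * u ^ 2 ^ k) := by gcongr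
        nlinarith)
      (hX.image L.continuous) (hY.image L.continuous)
      (cX.is_linear_image (f := L) L.toLinearMap.isLinear)
      (cY.is_linear_image (f := L) L.toLinearMap.isLinear) (by
        have : NT μ X Y ((40 * n * u ^ 2 ^ k) ^ 2) := by
          convert h using 1
          rw [mul_pow, pow_succ 2 k, pow_mul]
        unfold NT at this ⊢
        have e : (1 / 2 : ℝ) • (L '' X) + (1 / 2 : ℝ) • (L '' Y) =
            L '' ((1 / 2 : ℝ) • X + (1 / 2 : ℝ) • Y) := by
          rw [image_add L, image_smul_set, image_smul_set]
        rw [e, mr, mr, mr]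
        exact this)
    have key2 := ih ν hdk (by omega) ((hX.image L.continuous).image continuous_snd)
      ((hY.image L.continuous).image continuous_snd)
      ((cX.is_linear_image (f := L) L.toLinearMap.isLinear).is_linear_image
        (LinearMap.snd ℝ ℝ _).isLinear)
      ((cY.is_linear_image (f := L) L.toLinearMap.isLinear).is_linear_image
        (LinearMap.snd ℝ ℝ _).isLinear)
      (key.mono (by
        rw [hdk]; push_cast
        have h2 : (k : ℝ) + 1 + 1 ≤ n := by
          have : ((k + 1 + 1 : ℕ) : ℝ) ≤ n := by exact_mod_cast hkn
          push_cast at this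
          exact this
        calc 40 * ((k : ℝ) + 1 + 1) * (40 * n * u ^ 2 ^ k) ≤ 40 * n * (40 * n * u ^ 2 ^ k) := by
              gcongr
          _ = _ := by ring)) (f.comp (g : E →ₗ[ℝ] ℝ).ker.subtypeL) (by
        intro hc
        apply ha
        have := congrArg (fun (φ : (g : E →ₗ[ℝ] ℝ).ker →L[ℝ] ℝ) => φ (L a).2) hc
        simpa [hL2, hfh] using this)
    have im : ∀ T : Set E, (f.comp (g : E →ₗ[ℝ] ℝ).ker.subtypeL) '' (Prod.snd '' (L '' T)) =
        f '' T := by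
      intro T
      rw [image_image, image_image]
      apply image_congr
      intro x _
      simp [hL2, hfh]
    rwa [im, im] at key2


theorem log_half {s ω z : ℝ} (hs : 0 < s) (hs1 : s ≤ 1) (hω : 0 ≤ ω) (hω1 : 3 * ω ≤ s)
    (hz : 0 < z)
    (h : z ^ s * (1 - ω) ^ (1 - s) ≤ 1 + ω) : z ≤ 1 + 6 * ω / s := by
  have h1 : 0 < 1 - ω := by linarith
  have l1 := Real.log_le_log (by positivity) h
  rw [Real.log_mul (by positivity) (by positivity), Real.log_rpow hz, Real.log_rpow h1] at l1
  have l2 : Real.log (1 + ω) ≤ ω := by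
    have := Real.log_le_sub_one_of_pos (x := 1 + ω) (by linarith)
    linarith
  have l3 := log_lb (u := -ω) (by linarith)
  rw [← sub_eq_add_neg] at l3
  have l4 : -(2 * ω) ≤ Real.log (1 - ω) := by nlinarith
  have l5 : -(2 * ω) ≤ (1 - s) * Real.log (1 - ω) := by
    have : (1 - s) * (-(2 * ω)) ≤ (1 - s) * Real.log (1 - ω) := by
      apply mul_le_mul_of_nonneg_left l4; linarith
    nlinarith
  have l6 : Real.log z ≤ 3 * ω / s := by
    rw [le_div_iff₀ hs]; linarith
  have l7 : z ≤ Real.exp (3 * ω / s) := by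
    rw [← Real.exp_log hz]
    exact Real.exp_le_exp.2 l6
  have hle : 3 * ω / s ≤ 1 := by rw [div_le_one hs]; exact hω1
  have h0 : 0 ≤ 3 * ω / s := by positivity
  have := Real.abs_exp_sub_one_le (x := 3 * ω / s) (by rw [abs_of_nonneg h0]; exact hle)
  rw [abs_of_nonneg h0] at this
  have := (abs_le.1 this).2
  have e : 6 * ω / s = 2 * (3 * ω / s) := by ring
  linarith

section
variable {E : Type*} [NormedAddCommGroup E] [NormedSpace ℝ E] [FiniteDimensional ℝ E]
    [MeasurableSpace E] [BorelSpace E] (μ : Measure E) [μ.IsAddHaarMeasure]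

theorem to_half_aux {t ω : ℝ} (ht0 : 0 < t) (ht1 : t < 1 / 2) (hω : 0 ≤ ω) (hω1 : 3 * ω ≤ 2 * t)
    {X Y : Set E} (hX : IsCompact X) (hY : IsCompact Y) (cY : Convex ℝ Y)
    (hβ : 1 - ω ≤ μ.real Y) (hT : μ.real (t • X + (1 - t) • Y) ≤ 1 + ω) :
    μ.real ((1 / 2 : ℝ) • X + (1 / 2 : ℝ) • Y) ≤ 1 + 3 * ω / t := by
  set Z := (1 / 2 : ℝ) • X + (1 / 2 : ℝ) • Y with hZ
  have hZc : IsCompact Z := (hX.smul _).add (hY.smul _)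
  have hTc : IsCompact (t • X + (1 - t) • Y) := (hX.smul _).add (hY.smul _)
  rcases (measureReal_nonneg (μ := μ) (s := Z)).eq_or_lt with h | h
  · rw [← h]; positivity
  have key := bm μ (t := 2 * t) (by linarith) (by linarith) hZc.measurableSet hY.measurableSet
    (S := t • X + (1 - t) • Y) (by
      rintro _ ⟨_, ⟨x, hx, rfl⟩, _, ⟨y, hy, rfl⟩, rfl⟩ y' hy'
      have hm := cY hy hy' (a := t / (1 - t)) (b := (1 - 2 * t) / (1 - t))
        (div_nonneg (by linarith) (by linarith)) (div_nonneg (by linarith) (by linarith)) (by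
          rw [← add_div, div_eq_one_iff_eq (by linarith)]; ring)
      refine ⟨_, smul_mem_smul_set hx, _, smul_mem_smul_set hm, ?_⟩
      have e1 : (1 - t) * (t / (1 - t)) = t := by
        field_simp [show (1 - t) ≠ 0 by linarith]
      have e2 : (1 - t) * ((1 - 2 * t) / (1 - t)) = 1 - 2 * t := by
        field_simp [show (1 - t) ≠ 0 by linarith]
      simp only [smul_add, smul_smul, e1, e2]
      module)
  have k2 := ennreal_bm (x := μ.real Z) (y := 1 - ω) (z := 1 + ω) (by linarith) (by linarith) h
    (by linarith) key
    (by rw [ofReal_measureReal hZc.measure_lt_top.ne])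
    (by rw [← ofReal_measureReal hY.measure_lt_top.ne]; exact ENNReal.ofReal_le_ofReal hβ)
    (by rw [← ofReal_measureReal hTc.measure_lt_top.ne]; exact ENNReal.ofReal_le_ofReal hT)
    (by linarith)
  have := log_half (by linarith) (by linarith) hω hω1 h k2
  have e : 6 * ω / (2 * t) = 3 * ω / t := by field_simp; ring
  rwa [e] at this

theorem to_half {t τ ω : ℝ} (hτ : 0 < τ) (hτt : τ ≤ t) (hτt' : τ ≤ 1 - t) (hω : 0 ≤ ω)
    (hω1 : 3 * ω ≤ 2 * τ)
    {X Y : Set E} (hX : IsCompact X) (hY : IsCompact Y) (cX : Convex ℝ X) (cY : Convex ℝ Y)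
    (hα : 1 - ω ≤ μ.real X) (hβ : 1 - ω ≤ μ.real Y)
    (hT : μ.real (t • X + (1 - t) • Y) ≤ 1 + ω) :
    μ.real ((1 / 2 : ℝ) • X + (1 / 2 : ℝ) • Y) ≤ 1 + 3 * ω / τ := by
  rcases lt_trichotomy t (1 / 2) with h | h | h
  · refine (to_half_aux μ (by linarith) h hω (by linarith) hX hY cY hβ hT).trans ?_
    gcongr
  · rw [h, show (1 - 1 / 2 : ℝ) = 1 / 2 by norm_num] at hT
    refine hT.trans ?_
    have : ω ≤ 3 * ω / τ := by
      rw [le_div_iff₀ hτ]; nlinarith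
    linarith
  · have := to_half_aux μ (t := 1 - t) (ω := ω) (by linarith) (by linarith) hω (by linarith) hY hX cX hα
      (by rw [sub_sub_cancel, add_comm]; exact hT)
    rw [add_comm]
    refine this.trans ?_
    gcongr
end


section
variable {E : Type*} [NormedAddCommGroup E] [NormedSpace ℝ E] [FiniteDimensional ℝ E]
    [MeasurableSpace E] [BorelSpace E] (μ : Measure E) [μ.IsAddHaarMeasure]

theorem cap_NT {ω θ0 : ℝ} (hω : 0 ≤ ω) (hθ0 : 0 < θ0) {X Y : Set E} (hX : IsCompact X)
    (hY : IsCompact Y) (hα : 1 - ω ≤ μ.real X) (hβ : 1 - ω ≤ μ.real Y)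
    (hZ : μ.real ((1 / 2 : ℝ) • X + (1 / 2 : ℝ) • Y) ≤ 1 + ω) (f : E →L[ℝ] ℝ) {s s' : ℝ}
    (h : μ.real (Y ∩ {x | s' ≤ f x}) = min (μ.real (X ∩ {x | s ≤ f x})) (μ.real Y))
    (h0 : θ0 ≤ μ.real (Y ∩ {x | s' ≤ f x})) :
    NT μ (X ∩ {x | s ≤ f x}) (Y ∩ {x | s' ≤ f x}) (2 * ω / θ0) := by
  set Xs := X ∩ {x | s ≤ f x} with hXs
  set Ys := Y ∩ {x | s' ≤ f x} with hYs
  set Z := (1 / 2 : ℝ) • X + (1 / 2 : ℝ) • Y with hZd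
  have hZc : IsCompact Z := (hX.smul _).add (hY.smul _)
  have cl : ∀ s : ℝ, IsClosed {x | s ≤ f x} := fun s => isClosed_le continuous_const f.continuous
  have hXc : IsCompact Xs := hX.inter_right (cl s)
  have hYc : IsCompact Ys := hY.inter_right (cl s')
  have hVc : IsCompact ((1 / 2 : ℝ) • Xs + (1 / 2 : ℝ) • Ys) := (hXc.smul _).add (hYc.smul _)
  have sub : (1 / 2 : ℝ) • Xs + (1 / 2 : ℝ) • Ys ⊆ Z :=
    add_subset_add (smul_set_mono inter_subset_left) (smul_set_mono inter_subset_left)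
  have hle : μ.real Ys ≤ μ.real Xs := by rw [h]; exact min_le_left _ _
  have main : μ.real ((1 / 2 : ℝ) • Xs + (1 / 2 : ℝ) • Ys) ≤ μ.real Ys + 2 * ω := by
    have triv : μ.real ((1 / 2 : ℝ) • Xs + (1 / 2 : ℝ) • Ys) ≤ 1 + ω :=
      (measureReal_mono sub hZc.measure_lt_top.ne).trans hZ
    rcases le_total (μ.real Y) (μ.real Xs) with hc | hc
    · rw [min_eq_right hc] at h
      linarith
    rw [min_eq_left hc] at h
    rcases le_or_gt (1 - ω - μ.real Xs) 0 with hc2 | hc2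
    · linarith
    have cX : μ.real (X \ Xs) = μ.real X - μ.real Xs :=
      measureReal_sdiff inter_subset_left hXc.measurableSet hX.measure_lt_top.ne
    have cY : μ.real (Y \ Ys) = μ.real Y - μ.real Ys :=
      measureReal_sdiff inter_subset_left hYc.measurableSet hY.measure_lt_top.ne
    have b := bm_min μ (t := 1 / 2) (by norm_num) (by norm_num)
      (hX.measurableSet.diff hXc.measurableSet) (hY.measurableSet.diff hYc.measurableSet) hc2
      (S := Z \ ((1 / 2 : ℝ) • Xs + (1 / 2 : ℝ) • Ys))
      (by
        rw [← ofReal_measureReal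
          ((measure_mono sdiff_subset).trans_lt hX.measure_lt_top).ne]
        apply ENNReal.ofReal_le_ofReal
        rw [cX]; linarith)
      (by
        rw [← ofReal_measureReal
          ((measure_mono sdiff_subset).trans_lt hY.measure_lt_top).ne]
        apply ENNReal.ofReal_le_ofReal
        rw [cY]; linarith)
      (by
        rintro a ⟨haX, ha⟩ b ⟨hbY, hb⟩
        have ha' : f a < s := by
          by_contra hc; exact ha ⟨haX, not_lt.1 hc⟩
        have hb' : f b < s' := by
          by_contra hc; exact hb ⟨hbY, not_lt.1 hc⟩
        rw [show (1 - 1 / 2 : ℝ) = 1 / 2 by norm_num]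
        refine ⟨add_mem_add (smul_mem_smul_set haX) (smul_mem_smul_set hbY), ?_⟩
        rintro ⟨_, ⟨p, ⟨-, hp⟩, rfl⟩, _, ⟨q, ⟨-, hq⟩, rfl⟩, he⟩
        have := congrArg f he
        simp only [map_add, map_smul, smul_eq_mul] at this
        simp only [mem_ofPred_eq] at hp hq
        linarith)
    have fin : μ (Z \ ((1 / 2 : ℝ) • Xs + (1 / 2 : ℝ) • Ys)) ≠ ⊤ :=
      ((measure_mono sdiff_subset).trans_lt hZc.measure_lt_top).ne
    rw [← ofReal_measureReal fin, ENNReal.ofReal_le_ofReal_iff measureReal_nonneg,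
      measureReal_sdiff sub hVc.measurableSet hZc.measure_lt_top.ne] at b
    linarith
  have e : 2 * ω ≤ 2 * ω / θ0 * μ.real Ys := by
    calc 2 * ω = 2 * ω / θ0 * θ0 := by field_simp
      _ ≤ _ := by gcongr
  have e2 : 2 * ω / θ0 * μ.real Ys ≤ 2 * ω / θ0 * μ.real Xs := by gcongr
  exact ⟨by linarith, by linarith, by linarith, by linarith⟩

theorem level_cont {Y : Set E} (hY : IsCompact Y) (f : E →L[ℝ] ℝ) (hf : f ≠ 0) :
    Continuous (fun s : ℝ => μ.real (Y ∩ {x | s ≤ f x})) := by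
  obtain ⟨a, ha⟩ : ∃ a, f a ≠ 0 := by
    by_contra hc; push Not at hc; exact hf (ContinuousLinearMap.ext hc)
  have mS : ∀ s : ℝ, MeasurableSet {x | s ≤ f x} := fun s =>
    (isClosed_le continuous_const f.continuous).measurableSet
  have e : (fun s : ℝ => μ.real (Y ∩ {x | s ≤ f x})) =
      fun s : ℝ => ∫ x in Y, ({x | s ≤ f x}.indicator (fun _ => (1 : ℝ))) x ∂μ := by
    funext s
    rw [integral_indicator (mS s), Measure.restrict_restrict (mS s)]
    simp [Measure.real, inter_comm]
  rw [e, continuous_iff_continuousAt]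
  intro s0
  have hfin : IsFiniteMeasure (μ.restrict Y) := ⟨by simpa using hY.measure_lt_top⟩
  apply continuousAt_of_dominated (bound := fun _ => (1 : ℝ))
  · filter_upwards with s
    exact (measurable_const.indicator (mS s)).aestronglyMeasurable
  · filter_upwards with s
    filter_upwards with x
    by_cases hx : x ∈ {x | s ≤ f x}
    · simp [indicator_of_mem hx]
    · simp [indicator_of_notMem hx]
  · exact integrable_const _
  · have nul : μ {x | f x = s0} = 0 := by
      have h2 : {x | f x = s0} = ((s0 / f a) • a) +ᵥ ((f : E →ₗ[ℝ] ℝ).ker : Set E) := by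
        ext x
        rw [mem_vadd_set_iff_neg_vadd_mem]
        simp only [mem_ofPred_eq, SetLike.mem_coe, LinearMap.mem_ker, vadd_eq_add,
          ContinuousLinearMap.coe_coe, map_add, map_neg, map_smul, smul_eq_mul,
          div_mul_cancel₀ _ ha]
        constructor <;> intro h <;> linarith
      rw [h2, measure_vadd]
      apply Measure.addHaar_submodule
      intro hc
      have : a ∈ (f : E →ₗ[ℝ] ℝ).ker := by rw [hc]; trivial
      exact ha this
    have : ∀ᵐ x ∂(μ.restrict Y), f x ≠ s0 := by
      apply ae_restrict_of_ae
      rw [ae_iff]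
      simpa using nul
    filter_upwards [this] with x hx
    rcases lt_or_gt_of_ne hx with h | h
    · have : (fun s => ({x | s ≤ f x}.indicator (fun _ => (1 : ℝ))) x) =ᶠ[nhds s0] fun _ => 0 := by
        filter_upwards [lt_mem_nhds h] with s hs
        rw [indicator_of_notMem]
        simpa using hs
      exact this.continuousAt
    · have : (fun s => ({x | s ≤ f x}.indicator (fun _ => (1 : ℝ))) x) =ᶠ[nhds s0] fun _ => 1 := by
        filter_upwards [gt_mem_nhds h] with s hs
        rw [indicator_of_mem]
        exact hs.le
      exact this.continuousAt

theorem level_exists {Y : Set E} (hY : IsCompact Y) (f : E →L[ℝ] ℝ) (hf : f ≠ 0) {θ : ℝ}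
    (h0 : 0 ≤ θ) (h1 : θ ≤ μ.real Y) : ∃ s, μ.real (Y ∩ {x | s ≤ f x}) = θ := by
  have hc := level_cont μ hY f hf
  have hb := (hY.image f.continuous).isBounded
  obtain ⟨M, hM⟩ := hb.exists_norm_le
  have hbd : ∀ y ∈ Y, -M ≤ f y ∧ f y ≤ M := fun y hy => by
    have := hM _ (mem_image_of_mem f hy)
    rw [Real.norm_eq_abs] at this
    exact abs_le.1 this
  have e1 : Y ∩ {x | M + 1 ≤ f x} = ∅ := by
    ext y; simp only [mem_inter_iff, mem_ofPred_eq, mem_empty_iff_false, iff_false, not_and]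
    intro hy; have := (hbd y hy).2; linarith
  have e2 : Y ∩ {x | -M ≤ f x} = Y := inter_eq_left.2 fun y hy => (hbd y hy).1
  have := mem_range_of_exists_le_of_exists_ge hc (c := θ) ⟨M + 1, by rw [e1]; simpa using h0⟩
    ⟨-M, by rw [e2]; exact h1⟩
  exact this
end


section
variable {E : Type*} [NormedAddCommGroup E] [NormedSpace ℝ E] [FiniteDimensional ℝ E]
    [MeasurableSpace E] [BorelSpace E] (μ : Measure E) [μ.IsAddHaarMeasure]

/-- Conclusion of the width lemma, at fixed parameters. -/
def WP (ω' ζ : ℝ) : Prop := ∀ {X Y : Set E}, IsCompact X → IsCompact Y → Convex ℝ X → Convex ℝ Y →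
    NT μ X Y ω' → ∀ f : E →L[ℝ] ℝ, f ≠ 0 →
    volume.real (f '' X) ≤ (1 + ζ) * volume.real (f '' Y)

theorem img_le {X : Set E} (f : E →L[ℝ] ℝ) {a b : ℝ} (hab : a ≤ b)
    (h : ∀ x ∈ X, a ≤ f x ∧ f x ≤ b) : volume.real (f '' X) ≤ b - a := by
  have : f '' X ⊆ Icc a b := by rintro _ ⟨x, hx, rfl⟩; exact h x hx
  have := measureReal_mono (μ := volume) this measure_Icc_lt_top.ne
  rwa [Real.volume_real_Icc_of_le hab] at this

theorem le_img {X : Set E} (hX : IsCompact X) (cX : Convex ℝ X) (f : E →L[ℝ] ℝ) {x y : E}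
    (hx : x ∈ X) (hy : y ∈ X) : f y - f x ≤ volume.real (f '' X) := by
  have c : Convex ℝ (f '' X) := cX.is_linear_image f.toLinearMap.isLinear
  have : Icc (f x) (f y) ⊆ f '' X :=
    c.ordConnected.out (mem_image_of_mem f hx) (mem_image_of_mem f hy)
  have := measureReal_mono (μ := volume) this (hX.image f.continuous).measure_lt_top.ne
  rw [Real.volume_real_Icc] at this
  exact (le_max_left _ _).trans this

theorem tail {ω θ0 ζ : ℝ} (hω : 0 ≤ ω) (hω1 : ω ≤ 1 / 2) (hθ0 : 0 < θ0) (hθ1 : θ0 ≤ 1 / 2)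
    (hζ : 0 ≤ ζ)
    (W : WP μ (2 * ω / θ0) ζ) {X Y : Set E} (hX : IsCompact X) (hY : IsCompact Y)
    (cX : Convex ℝ X) (cY : Convex ℝ Y)
    (hα : 1 - ω ≤ μ.real X) (hβ : 1 - ω ≤ μ.real Y) (hβ' : μ.real Y ≤ 1 + ω)
    (hZ : μ.real ((1 / 2 : ℝ) • X + (1 / 2 : ℝ) • Y) ≤ 1 + ω) (f : E →L[ℝ] ℝ) (hf : f ≠ 0)
    {p q p' : E} (hp' : p' ∈ Y)
    (hmp : ∀ x ∈ X, f x ≤ f p) (hmp' : ∀ y ∈ Y, f y ≤ f p')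
    {r : ℝ} (hr : 0 ≤ r) (hrw : r ≤ f p - f q) :
    μ.real (Y ∩ {y | r + ζ * (f p - f q) < f p' - f y}) ≤
      μ.real (X ∩ {x | r < f p - f x}) + (θ0 + 2 * ω) := by
  have cl : ∀ s : ℝ, IsClosed {x | s ≤ f x} := fun s => isClosed_le continuous_const f.continuous
  have cv : ∀ s : ℝ, Convex ℝ {x | s ≤ f x} := fun s => convex_halfSpace_ge f.isLinear s
  set s := f p - r with hs
  have eX : X ∩ {x | r < f p - f x} = X \ (X ∩ {x | s ≤ f x}) := by
    ext x
    simp only [mem_inter_iff, mem_ofPred_eq, mem_sdiff, not_and, not_le, hs]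
    constructor
    · rintro ⟨h1, h2⟩; exact ⟨h1, fun _ => by linarith⟩
    · rintro ⟨h1, h2⟩; exact ⟨h1, by have := h2 h1; linarith⟩
  have hXc : IsCompact (X ∩ {x | s ≤ f x}) := hX.inter_right (cl s)
  rw [eX, measureReal_sdiff inter_subset_left hXc.measurableSet hX.measure_lt_top.ne]
  set θ := μ.real (X ∩ {x | s ≤ f x}) with hθ
  have tY : μ.real (Y ∩ {y | r + ζ * (f p - f q) < f p' - f y}) ≤ μ.real Y :=
    measureReal_mono inter_subset_left hY.measure_lt_top.ne
  rcases lt_or_ge θ θ0 with hlt | hge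
  · linarith
  have hθn : 0 ≤ θ := measureReal_nonneg
  obtain ⟨s', hs'⟩ := level_exists μ hY f hf (θ := min θ (μ.real Y))
    (le_min hθn measureReal_nonneg) (min_le_right _ _)
  have hYc : IsCompact (Y ∩ {x | s' ≤ f x}) := hY.inter_right (cl s')
  have hcap := cap_NT μ hω hθ0 hX hY hα hβ hZ f hs' (by
    rw [hs']; exact le_min hge (by linarith))
  have w := W hYc hXc (cY.inter (cv s')) (cX.inter (cv s)) hcap.symm f hf
  have w2 : volume.real (f '' (X ∩ {x | s ≤ f x})) ≤ r := by
    have := img_le f (X := X ∩ {x | s ≤ f x}) (a := s) (b := f p) (by linarith)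
      (fun x hx => ⟨hx.2, hmp x hx.1⟩)
    linarith
  have w3 : ∀ y ∈ Y ∩ {x | s' ≤ f x}, f p' - f y ≤ r + ζ * (f p - f q) := by
    intro y hy
    have h1 := le_img hYc (cY.inter (cv s')) f hy (y := p')
      ⟨hp', by have h2 := hmp' y hy.1; have h3 : s' ≤ f y := hy.2; exact h3.trans h2⟩
    have h2 : (1 + ζ) * volume.real (f '' (X ∩ {x | s ≤ f x})) ≤ (1 + ζ) * r := by gcongr
    have h3 : ζ * r ≤ ζ * (f p - f q) := by gcongr
    linarith
  have sub : Y ∩ {y | r + ζ * (f p - f q) < f p' - f y} ⊆ Y \ (Y ∩ {x | s' ≤ f x}) := by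
    rintro y ⟨hy, hy2⟩
    refine ⟨hy, fun hc => ?_⟩
    have := w3 y hc
    simp only [mem_ofPred_eq] at hy2
    linarith
  have m := measureReal_mono (μ := μ) sub
    ((measure_mono sdiff_subset).trans_lt hY.measure_lt_top).ne
  rw [measureReal_sdiff inter_subset_left hYc.measurableSet hY.measure_lt_top.ne, hs'] at m
  rcases le_total θ (μ.real Y) with h | h
  · rw [min_eq_left h] at m; linarith
  · rw [min_eq_right h] at m
    have : θ ≤ μ.real X := measureReal_mono inter_subset_left hX.measure_lt_top.ne
    linarith

theorem full_NT {ω θ0 : ℝ} (hω : 0 ≤ ω) (hω1 : ω ≤ 1 / 2) (hθ0 : 0 < θ0) (hθ1 : θ0 ≤ 1 / 2)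
    {X Y : Set E}
    (hα : 1 - ω ≤ μ.real X) (hβ : 1 - ω ≤ μ.real Y)
    (hZ : μ.real ((1 / 2 : ℝ) • X + (1 / 2 : ℝ) • Y) ≤ 1 + ω) : NT μ X Y (2 * ω / θ0) := by
  have h4 : 4 * ω ≤ 2 * ω / θ0 := by
    rw [le_div_iff₀ hθ0]; nlinarith
  have : ∀ {a : ℝ}, 1 - ω ≤ a → 1 + ω ≤ (1 + 2 * ω / θ0) * a := by
    intro a ha
    have h5 : (1 + 4 * ω) * (1 - ω) ≤ (1 + 2 * ω / θ0) * a := by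
      gcongr
      linarith
    nlinarith
  exact ⟨by linarith, by linarith, hZ.trans (this hα), hZ.trans (this hβ)⟩

theorem moment {ω θ0 ζ : ℝ} (hω : 0 ≤ ω) (hω1 : ω ≤ 1 / 2) (hθ0 : 0 < θ0) (hθ1 : θ0 ≤ 1 / 2)
    (hζ : 0 ≤ ζ)
    (W : WP μ (2 * ω / θ0) ζ) {X Y : Set E} (hX : IsCompact X) (hY : IsCompact Y)
    (cX : Convex ℝ X) (cY : Convex ℝ Y)
    (hα : 1 - ω ≤ μ.real X) (hβ : 1 - ω ≤ μ.real Y) (hβ' : μ.real Y ≤ 1 + ω)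
    (hZ : μ.real ((1 / 2 : ℝ) • X + (1 / 2 : ℝ) • Y) ≤ 1 + ω) (f : E →L[ℝ] ℝ) (hf : f ≠ 0)
    {p q p' : E} (hp' : p' ∈ Y) (hq : q ∈ X)
    (hmp : ∀ x ∈ X, f x ≤ f p) (hmq : ∀ x ∈ X, f q ≤ f x) (hmp' : ∀ y ∈ Y, f y ≤ f p') :
    ∫ y in Y, (f p' - f y) ∂μ ≤ ∫ x in X, (f p - f x) ∂μ +
      (ζ * μ.real Y + (θ0 + 2 * ω)) * (f p - f q) := by
  set w := f p - f q with hw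
  have hw0 : 0 ≤ w := sub_nonneg.2 (hmp q hq)
  have iX : IntegrableOn (fun x => f p - f x) X μ :=
    (continuous_const.sub f.continuous).continuousOn.integrableOn_compact hX
  have iY : IntegrableOn (fun y => f p' - f y) Y μ :=
    (continuous_const.sub f.continuous).continuousOn.integrableOn_compact hY
  have cg : Continuous (fun y => max (f p' - f y - ζ * w) 0) :=
    ((continuous_const.sub f.continuous).sub continuous_const).max continuous_const
  have iG : IntegrableOn (fun y => max (f p' - f y - ζ * w) 0) Y μ :=
    cg.continuousOn.integrableOn_compact hY
  have hwY : ∀ y ∈ Y, f p' - f y ≤ (1 + ζ) * w := by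
    intro y hy
    have h1 := W hY hX cY cX (full_NT μ hω hω1 hθ0 hθ1 hα hβ hZ).symm f hf
    have h2 := le_img hY cY f hy hp'
    have h3 := img_le f (X := X) (a := f q) (b := f p) (hmp q hq) fun x hx => ⟨hmq x hx, hmp x hx⟩
    have : (1 + ζ) * volume.real (f '' X) ≤ (1 + ζ) * w := by gcongr
    linarith
  have key : ∫⁻ y in Y, ENNReal.ofReal (max (f p' - f y - ζ * w) 0) ∂μ ≤
      ∫⁻ x in X, ENNReal.ofReal (f p - f x) ∂μ + ENNReal.ofReal (θ0 + 2 * ω) * ENNReal.ofReal w := by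
    have lc := lintegral_eq_lintegral_meas_lt (μ.restrict Y)
      (f := fun y => max (f p' - f y - ζ * w) 0)
      (Filter.Eventually.of_forall fun y => le_max_right _ _) cg.measurable.aemeasurable
    rw [lc, lintegral_eq_lintegral_meas_lt (μ.restrict X)
        (ae_restrict_of_forall_mem hX.measurableSet fun x hx => sub_nonneg.2 (hmp x hx))
        (continuous_const.sub f.continuous).measurable.aemeasurable]
    have e : ENNReal.ofReal (θ0 + 2 * ω) * ENNReal.ofReal w =
        ∫⁻ r in Ioi (0 : ℝ), (Ioc 0 w).indicator (fun _ => ENNReal.ofReal (θ0 + 2 * ω)) r := by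
      rw [lintegral_indicator measurableSet_Ioc, Measure.restrict_restrict measurableSet_Ioc,
        inter_eq_left.2 Ioc_subset_Ioi_self]
      simp
    rw [e, ← lintegral_add_right _ (measurable_const.indicator measurableSet_Ioc)]
    apply setLIntegral_mono' measurableSet_Ioi
    intro r hr
    have hr0 : 0 < r := hr
    have m1 : MeasurableSet {y | r < max (f p' - f y - ζ * w) 0} :=
      measurableSet_lt measurable_const cg.measurable
    have m2 : MeasurableSet {x | r < f p - f x} :=
      measurableSet_lt measurable_const (continuous_const.sub f.continuous).measurable
    rw [Measure.restrict_apply m1, Measure.restrict_apply m2]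
    have e2 : {y | r < max (f p' - f y - ζ * w) 0} ∩ Y = Y ∩ {y | r + ζ * w < f p' - f y} := by
      ext y
      simp only [mem_inter_iff, mem_ofPred_eq, lt_max_iff]
      constructor
      · rintro ⟨h | h, hy⟩
        · exact ⟨hy, by linarith⟩
        · linarith
      · rintro ⟨hy, h⟩
        exact ⟨Or.inl (by linarith), hy⟩
    rw [e2, inter_comm _ X]
    have f1 : μ (Y ∩ {y | r + ζ * w < f p' - f y}) ≠ ⊤ :=
      ((measure_mono inter_subset_left).trans_lt hY.measure_lt_top).ne
    have f2 : μ (X ∩ {x | r < f p - f x}) ≠ ⊤ :=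
      ((measure_mono inter_subset_left).trans_lt hX.measure_lt_top).ne
    rcases le_or_gt r w with hrw | hrw
    · rw [indicator_of_mem (show r ∈ Ioc 0 w from ⟨hr0, hrw⟩), ← ofReal_measureReal f1, ← ofReal_measureReal f2,
        ← ENNReal.ofReal_add measureReal_nonneg (by positivity)]
      apply ENNReal.ofReal_le_ofReal
      exact tail μ hω hω1 hθ0 hθ1 hζ W hX hY cX cY hα hβ hβ' hZ f hf hp' hmp hmp' hr0.le hrw
    · have : Y ∩ {y | r + ζ * w < f p' - f y} = ∅ := by
        ext y
        simp only [mem_inter_iff, mem_ofPred_eq, mem_empty_iff_false, iff_false, not_and, not_lt]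
        intro hy
        have := hwY y hy
        linarith
      rw [this]; simp
  have lG := ofReal_integral_eq_lintegral_ofReal iG
    (Filter.Eventually.of_forall fun y => le_max_right _ _)
  rw [← lG, ← ofReal_integral_eq_lintegral_ofReal iX
      (ae_restrict_of_forall_mem hX.measurableSet fun x hx => sub_nonneg.2 (hmp x hx)),
    ← ENNReal.ofReal_mul (by positivity), ← ENNReal.ofReal_add
      (setIntegral_nonneg hX.measurableSet fun x hx => sub_nonneg.2 (hmp x hx)) (by positivity),
    ENNReal.ofReal_le_ofReal_iff (add_nonneg
      (setIntegral_nonneg hX.measurableSet fun x hx => sub_nonneg.2 (hmp x hx)) (by positivity))]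
    at key
  have k2 : ∫ y in Y, (f p' - f y) ∂μ - ζ * w * μ.real Y ≤
      ∫ y in Y, max (f p' - f y - ζ * w) 0 ∂μ := by
    have e : ∫ y in Y, (f p' - f y - ζ * w) ∂μ =
        ∫ y in Y, (f p' - f y) ∂μ - ζ * w * μ.real Y := by
      rw [integral_sub iY (integrableOn_const hY.measure_lt_top.ne)]
      simp [mul_comm]
    rw [← e]
    apply integral_mono (iY.sub (integrableOn_const hY.measure_lt_top.ne)) iG
    intro y
    exact le_max_left _ _
  have e3 : (ζ * μ.real Y + (θ0 + 2 * ω)) * w = ζ * w * μ.real Y + (θ0 + 2 * ω) * w := by ring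
  rw [e3]
  linarith
end


section
variable {E : Type*} [NormedAddCommGroup E] [NormedSpace ℝ E] [FiniteDimensional ℝ E]
    [MeasurableSpace E] [BorelSpace E] (μ : Measure E) [μ.IsAddHaarMeasure]

theorem bary_mem {X : Set E} (hX : IsCompact X) (cX : Convex ℝ X) (h : 0 < μ.real X) :
    (μ.real X)⁻¹ • ∫ x in X, x ∂μ ∈ X := by
  have := cX.set_average_mem (μ := μ) (t := X) (f := fun x => x) hX.isClosed (by
    intro h0; simp [Measure.real, h0] at h) hX.measure_lt_top.ne
    (ae_restrict_of_forall_mem hX.measurableSet fun x hx => hx)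
    (continuous_id.continuousOn.integrableOn_compact hX)
  rwa [setAverage_eq] at this

theorem f_bary {X : Set E} (hX : IsCompact X) (h : 0 < μ.real X) (f : E →L[ℝ] ℝ) (c : ℝ) :
    ∫ x in X, (c - f x) ∂μ = μ.real X * (c - f ((μ.real X)⁻¹ • ∫ x in X, x ∂μ)) := by
  have i1 : IntegrableOn (fun x : E => x) X μ := continuous_id.continuousOn.integrableOn_compact hX
  have i2 : IntegrableOn (fun x : E => f x) X μ := f.continuous.continuousOn.integrableOn_compact hX
  have i3 : IntegrableOn (fun _ : E => c) X μ := integrableOn_const hX.measure_lt_top.ne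
  rw [integral_sub i3 i2,
    f.integral_comp_comm i1]
  simp only [integral_const, map_smul, smul_eq_mul, measureReal_restrict_apply_univ]
  field_simp

theorem depth_lb {X : Set E} (hX : IsCompact X) (cX : Convex ℝ X) (f : E →L[ℝ] ℝ) {p q : E}
    (hp : ∀ x ∈ X, f x ≤ f p) (hq : q ∈ X) :
    μ.real X * (f p - f q) ≤ 2 ^ (Module.finrank ℝ E + 1) * ∫ x in X, (f p - f x) ∂μ := by
  set d := Module.finrank ℝ E with hd
  have i : IntegrableOn (fun x => f p - f x) X μ :=
    (continuous_const.sub f.continuous).continuousOn.integrableOn_compact hX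
  set V := ((1 / 2 : ℝ) • q) +ᵥ ((1 / 2 : ℝ) • X) with hV
  have sub : V ⊆ X := by
    rintro _ ⟨_, ⟨x, hx, rfl⟩, rfl⟩
    exact cX hq hx (by norm_num) (by norm_num) (by norm_num)
  have hVc : IsCompact V := (hX.smul _).vadd _
  have mV : μ.real V = (1 / 2) ^ d * μ.real X := by
    rw [hV, vadd_real, smul_real μ (by norm_num)]
  have h1 : ∫ x in V, (f p - f q) / 2 ∂μ ≤ ∫ x in V, (f p - f x) ∂μ := by
    apply setIntegral_mono_on (integrableOn_const hVc.measure_lt_top.ne) (i.mono_set sub)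
      hVc.measurableSet
    rintro _ ⟨_, ⟨x, hx, rfl⟩, rfl⟩
    have := hp x hx
    simp only [vadd_eq_add, map_add, map_smul, smul_eq_mul]
    linarith
  have h2 : ∫ x in V, (f p - f x) ∂μ ≤ ∫ x in X, (f p - f x) ∂μ := by
    apply setIntegral_mono_set i
    · exact ae_restrict_of_forall_mem hX.measurableSet fun x hx => sub_nonneg.2 (hp x hx)
    · exact sub.eventuallyLE
  simp only [integral_const, smul_eq_mul, measureReal_restrict_apply_univ] at h1
  rw [mV] at h1
  have e : μ.real X * (f p - f q) =
      2 ^ (d + 1) * ((1 / 2) ^ d * μ.real X * ((f p - f q) / 2)) := by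
    rw [pow_succ, one_div, inv_pow]
    field_simp
  rw [e]
  have := h1.trans h2
  gcongr

set_option maxHeartbeats 800000 in
theorem conv_translate {ω θ0 ζ ρ : ℝ} (hω : 0 ≤ ω) (hω1 : ω ≤ 1 / 2) (hθ0 : 0 < θ0) (hθ1 : θ0 ≤ 1 / 2)
    (hζ : 0 ≤ ζ) (hζ1 : ζ ≤ 1)
    (hρ : 2 ^ (Module.finrank ℝ E + 2) * (ζ + 8 * ω + 2 * θ0) ≤ ρ) (hρ1 : ρ < 1)
    (W : WP μ (2 * ω / θ0) ζ) {X Y : Set E} (hX : IsCompact X) (hY : IsCompact Y)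
    (cX : Convex ℝ X) (cY : Convex ℝ Y)
    (hα : 1 - ω ≤ μ.real X) (hα' : μ.real X ≤ 1 + ω)
    (hβ : 1 - ω ≤ μ.real Y) (hβ' : μ.real Y ≤ 1 + ω)
    (hZ : μ.real ((1 / 2 : ℝ) • X + (1 / 2 : ℝ) • Y) ≤ 1 + ω) :
    ∃ v : E, (1 - ρ) ^ Module.finrank ℝ E * μ.real X ≤ μ.real (X ∩ (v +ᵥ Y)) := by
  set d := Module.finrank ℝ E with hd
  have hα0 : 1 / 2 ≤ μ.real X := by linarith
  have hβ0 : 1 / 2 ≤ μ.real Y := by linarith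
  have hρ0 : 0 ≤ ρ := le_trans (by positivity) hρ
  set bX := (μ.real X)⁻¹ • ∫ x in X, x ∂μ with hbX
  set bY := (μ.real Y)⁻¹ • ∫ x in Y, x ∂μ with hbY
  have mX : bX ∈ X := bary_mem μ hX cX (by linarith)
  have mY : bY ∈ Y := bary_mem μ hY cY (by linarith)
  set α := μ.real X with hαd
  set β := μ.real Y with hβd
  have hZ' : μ.real ((1 / 2 : ℝ) • Y + (1 / 2 : ℝ) • X) ≤ 1 + ω := by rwa [add_comm]
  have incl : ∀ x ∈ X, (1 - ρ) • x + ρ • bX ∈ (bX - bY) +ᵥ Y := by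
    intro x hx
    by_contra hc
    obtain ⟨f, c, hlt, hgt⟩ := geometric_hahn_banach_closed_point (cY.vadd (bX - bY))
      ((hY.vadd (bX - bY)).isClosed) hc
    have hf : f ≠ 0 := by
      rintro rfl
      have := hlt _ (vadd_mem_vadd_set (a := bX - bY) mY)
      simp at this hgt
      linarith
    obtain ⟨p, hpX, hp⟩ := hX.exists_isMaxOn ⟨bX, mX⟩ f.continuous.continuousOn
    obtain ⟨q, hqX, hq⟩ := hX.exists_isMinOn ⟨bX, mX⟩ f.continuous.continuousOn
    obtain ⟨p', hpY, hp'⟩ := hY.exists_isMaxOn ⟨bY, mY⟩ f.continuous.continuousOn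
    obtain ⟨q', hqY, hq'⟩ := hY.exists_isMinOn ⟨bY, mY⟩ f.continuous.continuousOn
    rw [isMaxOn_iff] at hp hp'
    rw [isMinOn_iff] at hq hq'
    have M := moment μ hω hω1 hθ0 hθ1 hζ W hY hX cY cX hβ hα hα' hZ' f hf hpX hqY hp' hq' hp
    have Dlb := depth_lb μ hX cX f hp hqX
    rw [f_bary μ hX (by linarith) f, f_bary μ hY (by linarith) f] at M
    rw [f_bary μ hX (by linarith) f] at Dlb
    rw [← hbX, ← hαd] at M Dlb
    rw [← hbY, ← hβd] at M
    rw [← hd] at Dlb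
    have hwYX : f p' - f q' ≤ 2 * (f p - f q) := by
      have h1 := W hY hX cY cX (full_NT μ hω hω1 hθ0 hθ1 hα hβ hZ).symm f hf
      have h2 := le_img hY cY f hqY hpY
      have h3 := img_le f (X := X) (a := f q) (b := f p) (hp q hqX) fun x hx => ⟨hq x hx, hp x hx⟩
      have h0 : 0 ≤ volume.real (f '' X) := measureReal_nonneg
      have : (1 + ζ) * volume.real (f '' X) ≤ 2 * volume.real (f '' X) := by
        gcongr; linarith
      linarith
    have hDY : f p' - f bY ≤ f p' - f q' := by have := hq' bY mY; linarith
    have hDY0 : 0 ≤ f p' - f bY := by have := hp' bY mY; linarith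
    have hDX0 : 0 ≤ f p - f bX := by have := hp bX mX; linarith
    set DX := f p - f bX with hDX
    set DY := f p' - f bY with hDYd
    set w := f p - f q with hw
    set w' := f p' - f q' with hw'
    have hw0 : 0 ≤ w := by have := hp q hqX; linarith
    have key : DX - DY ≤ (2 * ζ + 16 * ω + 4 * θ0) * w := by
      have a1 : β * DY ≤ (α * (1 + 4 * ω)) * DY := by gcongr; nlinarith
      have a2 : (ζ * α + (θ0 + 2 * ω)) * w' ≤ (α * (ζ + 2 * (θ0 + 2 * ω))) * (2 * w) := by
        have b1 : ζ * α + (θ0 + 2 * ω) ≤ α * (ζ + 2 * (θ0 + 2 * ω)) := by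
          have : (θ0 + 2 * ω) * (1 / 2) ≤ (θ0 + 2 * ω) * α := by gcongr
          linarith
        have b2 : 0 ≤ α * (ζ + 2 * (θ0 + 2 * ω)) :=
          mul_nonneg (by linarith) (by positivity)
        exact mul_le_mul b1 hwYX (hDY0.trans hDY) b2
      have a3 : α * DX ≤ α * ((1 + 4 * ω) * DY + (ζ + 2 * (θ0 + 2 * ω)) * (2 * w)) := by linarith
      have a4 := le_of_mul_le_mul_left a3 (by linarith)
      have a5 : ω * DY ≤ ω * (2 * w) := by gcongr; linarith
      linarith
    have Dlb' : w ≤ 2 ^ (d + 1) * DX := by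
      have : α * w ≤ α * (2 ^ (d + 1) * DX) := by linarith
      exact le_of_mul_le_mul_left this (by linarith)
    have k2 : DX - DY ≤ ρ * DX := by
      calc DX - DY ≤ (2 * ζ + 16 * ω + 4 * θ0) * w := key
        _ ≤ (2 * ζ + 16 * ω + 4 * θ0) * (2 ^ (d + 1) * DX) := by gcongr
        _ = (2 ^ (d + 2) * (ζ + 8 * ω + 2 * θ0)) * DX := by ring
        _ ≤ ρ * DX := by gcongr
    have l1 := hlt _ (vadd_mem_vadd_set (a := bX - bY) hpY)
    have l2 := hp x hx
    simp only [vadd_eq_add, map_add, map_sub, map_smul, smul_eq_mul] at l1 hgt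
    have l3 : (1 - ρ) * f x ≤ (1 - ρ) * f p := by gcongr
    have l4 : (1 - ρ) * f p = (1 - ρ) * DX + (1 - ρ) * f bX := by rw [hDX]; ring
    linarith
  refine ⟨bX - bY, ?_⟩
  have sub : ρ • bX +ᵥ ((1 - ρ) • X) ⊆ X ∩ ((bX - bY) +ᵥ Y) := by
    rintro _ ⟨_, ⟨x, hx, rfl⟩, rfl⟩
    have e : (ρ • bX) +ᵥ ((fun x => (1 - ρ) • x) x) = (1 - ρ) • x + ρ • bX := by
      simp [add_comm]
    change (ρ • bX) +ᵥ ((fun x => (1 - ρ) • x) x) ∈ _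
    rw [e]
    exact ⟨cX hx mX (by linarith) hρ0 (by ring), incl x hx⟩
  have := measureReal_mono (μ := μ) sub
    ((measure_mono inter_subset_left).trans_lt hX.measure_lt_top).ne
  rwa [vadd_real, smul_real μ (by linarith)] at this
end


theorem pow_choice {c τ ρ : ℝ} (hτ : 0 < τ) (hc : τ ≤ c) (hc1 : c ≤ 1 - τ) (hρ : 0 < ρ)
    (hρ1 : ρ < 1) : ∃ k : ℕ, ρ * τ ≤ c ^ k ∧ c ^ k ≤ ρ ∧ (k : ℝ) ≤ 1 / (ρ * τ) := by
  have hc0 : 0 < c := by linarith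
  have hτ1 : τ < 1 := by linarith
  have ex : ∃ k : ℕ, c ^ k ≤ ρ := by
    obtain ⟨k, hk⟩ := exists_pow_lt_of_lt_one hρ (by linarith : c < 1)
    exact ⟨k, hk.le⟩
  classical
  set k := Nat.find ex with hk
  have h1 : c ^ k ≤ ρ := Nat.find_spec ex
  have hk0 : k ≠ 0 := by
    intro h; rw [h, pow_zero] at h1; linarith
  obtain ⟨j, hj⟩ := Nat.exists_eq_succ_of_ne_zero hk0
  have h2 : ρ < c ^ j := by
    have := Nat.find_min ex (m := j) (by omega)
    exact not_le.1 this
  refine ⟨k, ?_, h1, ?_⟩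
  · rw [hj, Nat.succ_eq_add_one, pow_succ]
    gcongr
  · have b1 : 1 + (j : ℝ) * τ ≤ (1 + τ) ^ j := one_add_mul_le_pow (by linarith) j
    have b2 : c ^ j * (1 + τ) ^ j ≤ 1 := by
      rw [← mul_pow]
      apply pow_le_one₀ (by positivity)
      nlinarith
    have b3 : ρ * (1 + (j : ℝ) * τ) ≤ 1 := by
      calc ρ * (1 + (j : ℝ) * τ) ≤ c ^ j * (1 + τ) ^ j := by gcongr
        _ ≤ 1 := b2
    rw [le_div_iff₀ (by positivity), hj]
    push_cast
    have : ρ * τ ≤ ρ := by nlinarith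
    linarith

section
variable {E : Type*} [NormedAddCommGroup E] [NormedSpace ℝ E] [FiniteDimensional ℝ E]
    [MeasurableSpace E] [BorelSpace E] (μ : Measure E) [μ.IsAddHaarMeasure]

theorem badS_ne {K : Set E} (hK : IsCompact K) (ρ : ℝ) (z : E) : μ (badS K ρ z) ≠ ⊤ :=
  ((measure_mono (t := K) fun _ h => h.1).trans_lt hK.measure_lt_top).ne

theorem badS_iter {K : Set E} (hK : IsCompact K) {c θ : ℝ} (hc0 : 0 < c) (hc1 : c ≤ 1)
    {z : E} (h : μ.real (badS K c z) ≤ θ) (k : ℕ) :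
    μ.real (badS K (c ^ k) z) ≤ k * (((c ^ k) ^ Module.finrank ℝ E)⁻¹ * θ) := by
  have hθ : 0 ≤ θ := measureReal_nonneg.trans h
  set d := Module.finrank ℝ E with hd
  induction k with
  | zero =>
    have : badS K (c ^ 0) z = ∅ := by ext q; simp [badS]
    rw [this]; simp
  | succ k ih =>
    have sub : badS K (c ^ (k + 1)) z ⊆
        badS K (c ^ k) z ∪ {q | (1 - c ^ k) • z + (c ^ k) • q ∈ badS K c z} := by
      rintro q ⟨hq, hq2⟩
      by_cases h1 : (1 - c ^ k) • z + (c ^ k) • q ∈ K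
      · right
        refine ⟨h1, ?_⟩
        have e : (1 - c) • z + c • ((1 - c ^ k) • z + (c ^ k) • q) =
            (1 - c ^ (k + 1)) • z + (c ^ (k + 1)) • q := by
          rw [pow_succ]; module
        rw [e]; exact hq2
      · left; exact ⟨hq, h1⟩
    have f2 : μ {q | (1 - c ^ k) • z + (c ^ k) • q ∈ badS K c z} ≠ ⊤ := by
      rw [pre_real μ (by positivity)]
      exact ENNReal.mul_ne_top ENNReal.ofReal_ne_top (badS_ne μ hK c z)
    have m := (measureReal_mono (μ := μ) sub
      (measure_union_ne_top (badS_ne μ hK _ z) f2)).trans (measureReal_union_le _ _)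
    rw [pre_real' μ (by positivity), ← hd] at m
    have e1 : ((c ^ k) ^ d)⁻¹ * μ.real (badS K c z) ≤ ((c ^ k) ^ d)⁻¹ * θ := by gcongr
    have e2 : ((c ^ k) ^ d)⁻¹ * θ ≤ ((c ^ (k + 1)) ^ d)⁻¹ * θ := by
      have : c ^ (k + 1) ≤ c ^ k := pow_le_pow_of_le_one hc0.le hc1 (by omega)
      gcongr
    push_cast
    have e3 : (k : ℝ) * (((c ^ k) ^ d)⁻¹ * θ) ≤ k * (((c ^ (k + 1)) ^ d)⁻¹ * θ) := by gcongr
    linarith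

theorem badS_rho {K : Set E} (hK : IsCompact K) (cK : Convex ℝ K) {c τ ρ θ : ℝ} (hτ : 0 < τ)
    (hc : τ ≤ c) (hc1 : c ≤ 1 - τ) (hρ : 0 < ρ) (hρ1 : ρ < 1) {z : E}
    (h : μ.real (badS K c z) ≤ θ) :
    μ.real (badS K ρ z) ≤ θ / (ρ * τ) ^ (Module.finrank ℝ E + 1) := by
  have hθ : 0 ≤ θ := measureReal_nonneg.trans h
  set d := Module.finrank ℝ E with hd
  obtain ⟨k, h1, h2, h3⟩ := pow_choice hτ hc hc1 hρ hρ1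
  have hc0 : 0 < c := by linarith
  have it := badS_iter μ hK hc0 (by linarith) h k
  set σ := c ^ k with hσ
  have hσ0 : 0 < σ := by positivity
  have sub : badS K ρ z ⊆ badS K σ z := by
    rintro q ⟨hq, hq2⟩
    refine ⟨hq, fun hc => hq2 ?_⟩
    have h1σ : 0 < 1 - σ := by linarith
    have := cK hc hq (a := (1 - ρ) / (1 - σ)) (b := 1 - (1 - ρ) / (1 - σ))
      (div_nonneg (by linarith) h1σ.le) (by
        rw [sub_nonneg, div_le_one h1σ]; linarith) (by ring)
    convert this using 1
    have e : (1 - ρ) = (1 - ρ) / (1 - σ) * (1 - σ) := by field_simp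
    set l := (1 - ρ) / (1 - σ)
    have e' : ρ = 1 - l * (1 - σ) := by linarith
    rw [e']
    module
  refine (measureReal_mono sub (badS_ne μ hK _ z)).trans (it.trans ?_)
  have g1 : ((σ) ^ d)⁻¹ * θ ≤ (((ρ * τ)) ^ d)⁻¹ * θ := by gcongr
  have e : θ / (ρ * τ) ^ (d + 1) = 1 / (ρ * τ) * (((ρ * τ) ^ d)⁻¹ * θ) := by
    rw [pow_succ]; field_simp
  rw [e]
  gcongr

theorem badS_one {K C S : Set E} {η c τ : ℝ} (hτ : 0 < τ) (hη : 0 ≤ η)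
    (hc : τ ≤ c) (hc1 : c ≤ 1) (hK : IsCompact K)
    (hC : IsCompact C) (hCK : C ⊆ K) (hCS : C ⊆ S) (hSf : μ S ≠ ⊤)
    (hS : μ.real S ≤ 1 + η) (hC1 : 1 - η ≤ μ.real C) (hK1 : μ.real K ≤ 1 + η) {z : E}
    (hz : ∀ q ∈ C, (1 - c) • z + c • q ∈ S) :
    μ.real (badS K c z) ≤ 4 * η / τ ^ Module.finrank ℝ E := by
  set d := Module.finrank ℝ E with hd
  have hc0 : 0 < c := by linarith
  have sub : badS K c z ⊆ (K \ C) ∪ {q | (1 - c) • z + c • q ∈ S \ C} := by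
    rintro q ⟨hq, hq2⟩
    by_cases h : q ∈ C
    · right
      exact ⟨hz q h, fun h' => hq2 (hCK h')⟩
    · left; exact ⟨hq, h⟩
  have f1 : μ (K \ C) ≠ ⊤ := ((measure_mono sdiff_subset).trans_lt hK.measure_lt_top).ne
  have f3 : μ (S \ C) ≠ ⊤ := ((measure_mono sdiff_subset).trans_lt hSf.lt_top).ne
  have f2 : μ {q | (1 - c) • z + c • q ∈ S \ C} ≠ ⊤ := by
    rw [pre_real μ hc0]
    exact ENNReal.mul_ne_top ENNReal.ofReal_ne_top f3
  have m := (measureReal_mono (μ := μ) sub (measure_union_ne_top f1 f2)).trans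
    (measureReal_union_le _ _)
  rw [pre_real' μ hc0, ← hd, measureReal_sdiff hCK hC.measurableSet hK.measure_lt_top.ne,
    measureReal_sdiff hCS hC.measurableSet hSf] at m
  have hτ1 : τ ≤ 1 := hc.trans hc1
  have g1 : (c ^ d)⁻¹ * (μ.real S - μ.real C) ≤ (τ ^ d)⁻¹ * (2 * η) := by
    have : μ.real S - μ.real C ≤ 2 * η := by linarith
    have h0 : 0 ≤ μ.real S - μ.real C := sub_nonneg.2 (measureReal_mono hCS hSf)
    gcongr
  have g2 : 2 * η ≤ (τ ^ d)⁻¹ * (2 * η) := by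
    have : 1 ≤ (τ ^ d)⁻¹ := (one_le_inv₀ (by positivity)).2 (pow_le_one₀ hτ.le hτ1)
    nlinarith
  have e : 4 * η / τ ^ d = (τ ^ d)⁻¹ * (2 * η) + (τ ^ d)⁻¹ * (2 * η) := by ring
  rw [e]
  linarith

/-- Final hull estimate. -/
theorem final_hull {A B K C : Set E} {t τ η ρ : ℝ} (hτ : 0 < τ) (hη : 0 ≤ η)
    (hτt : τ ≤ t) (hτt' : τ ≤ 1 - t) (hρ : 0 < ρ) (hρ1 : ρ < 1) (hK : IsCompact K)
    (cK : Convex ℝ K)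
    (hC : IsCompact C) (hCK : C ⊆ K) (hCA : C ⊆ A) (hCB : C ⊆ B)
    (hSf : μ (t • A + (1 - t) • B) ≠ ⊤)
    (hS : μ.real (t • A + (1 - t) • B) ≤ 1 + η) (hC1 : 1 - η ≤ μ.real C) (hK1 : μ.real K ≤ 1 + η)
    (hc : 0 < 1 - η - (Module.finrank ℝ E + 1) *
      (4 * η / τ ^ Module.finrank ℝ E / (ρ * τ) ^ (Module.finrank ℝ E + 1))) :
    μ (convexHull ℝ (A ∪ B)) ≠ ⊤ ∧
    μ.real (convexHull ℝ (A ∪ B)) * (1 - η - (Module.finrank ℝ E + 1) *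
      (4 * η / τ ^ Module.finrank ℝ E / (ρ * τ) ^ (Module.finrank ℝ E + 1))) *
        (1 - ρ) ^ Module.finrank ℝ E ≤ (1 + η) ^ 2 := by
  set d := Module.finrank ℝ E with hd
  set θ := 4 * η / τ ^ d / (ρ * τ) ^ (d + 1) with hθ
  have hCS : C ⊆ t • A + (1 - t) • B := fun x hx =>
    ⟨_, smul_mem_smul_set (hCA hx), _, smul_mem_smul_set (hCB hx), by simp only; module⟩
  have hb : ∀ z ∈ A ∪ B, μ.real (badS K ρ z) ≤ θ := by
    rintro z (hz | hz)
    · refine badS_rho μ hK cK (c := 1 - t) hτ hτt' (by linarith) hρ hρ1 ?_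
      refine badS_one μ hτ hη hτt' (by linarith) hK hC hCK hCS hSf hS hC1 hK1 ?_
      intro q hq
      rw [sub_sub_cancel]
      exact ⟨_, smul_mem_smul_set hz, _, smul_mem_smul_set (hCB hq), rfl⟩
    · refine badS_rho μ hK cK (c := t) hτ hτt (by linarith) hρ hρ1 ?_
      refine badS_one μ hτ hη hτt (by linarith) hK hC hCK hCS hSf hS hC1 hK1 ?_
      intro q hq
      exact ⟨_, smul_mem_smul_set (hCA hq), _, smul_mem_smul_set hz, add_comm _ _⟩
  have hh := quasi_hull (φ := fun z => μ.real (badS K ρ z)) (c := 0) (ε := θ) le_rfl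
    (by positivity) (by
      intro z z' s hs hs1
      have sub : badS K ρ ((1 - s) • z + s • z') ⊆ badS K ρ z ∪ badS K ρ z' := by
        rintro q ⟨hq, hq2⟩
        by_contra hn
        simp only [mem_union, not_or] at hn
        have h1 : (1 - ρ) • z + ρ • q ∈ K := by
          by_contra h; exact hn.1 ⟨hq, h⟩
        have h2 : (1 - ρ) • z' + ρ • q ∈ K := by
          by_contra h; exact hn.2 ⟨hq, h⟩
        apply hq2
        have := cK h1 h2 (a := 1 - s) (b := s) (by linarith) hs (by ring)
        convert this using 1
        module
      have := (measureReal_mono (μ := μ) sub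
        (measure_union_ne_top (badS_ne μ hK _ _) (badS_ne μ hK _ _))).trans
        (measureReal_union_le _ _)
      simpa using this) hb
  rw [add_zero] at hh
  have CK : μ.real C ≤ μ.real K := measureReal_mono hCK hK.measure_lt_top.ne
  obtain ⟨m1, m2⟩ := markov_hull μ (W := convexHull ℝ (A ∪ B)) hρ1 hK.measurableSet
    hK.measure_lt_top.ne hc (by
      intro z hz
      have e : {q | q ∈ K ∧ (1 - ρ) • z + ρ • q ∈ K} = K \ badS K ρ z := by
        ext q
        simp only [badS, mem_sdiff, mem_ofPred_eq, not_and, not_not]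
        constructor
        · rintro ⟨h1, h2⟩; exact ⟨h1, fun _ => h2⟩
        · rintro ⟨h1, h2⟩; exact ⟨h1, h2 h1⟩
      rw [e, ← ofReal_measureReal ((measure_mono sdiff_subset).trans_lt hK.measure_lt_top).ne,
        measureReal_sdiff (fun _ h => h.1) (badS_meas hK.measurableSet ρ z) hK.measure_lt_top.ne]
      apply ENNReal.ofReal_le_ofReal
      have := hh z hz
      simp only [← hd] at this
      linarith)
  refine ⟨m1, m2.trans ?_⟩
  gcongr
end


section
variable {E : Type*} [NormedAddCommGroup E] [NormedSpace ℝ E] [FiniteDimensional ℝ E]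
    [MeasurableSpace E] [BorelSpace E] (μ : Measure E) [μ.IsAddHaarMeasure]

theorem inner_cpt {A : Set E} (hA : MeasurableSet A) (hf : μ A ≠ ⊤) {δ : ℝ} (hδ : 0 < δ) :
    ∃ A0 ⊆ A, IsCompact A0 ∧ μ.real A - δ ≤ μ.real A0 := by
  obtain ⟨A0, h1, h2, h3⟩ := hA.exists_isCompact_lt_add hf (ε := ENNReal.ofReal δ)
    (by simpa using hδ)
  refine ⟨A0, h1, h2, ?_⟩
  have f0 := h2.measure_lt_top (μ := μ)
  rw [← ofReal_measureReal hf, ← ofReal_measureReal f0.ne, ← ENNReal.ofReal_add measureReal_nonneg hδ.le] at h3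
  have := (ENNReal.ofReal_lt_ofReal_iff_of_nonneg measureReal_nonneg).1 h3
  linarith

theorem conv_closure {W : Set E} (c : Convex ℝ W) : μ.real (closure W) = μ.real W := by
  unfold Measure.real
  congr 1
  apply le_antisymm _ (measure_mono subset_closure)
  have : closure W ⊆ W ∪ frontier W := closure_eq_self_union_frontier W ▸ subset_rfl
  refine (measure_mono this).trans ((measure_union_le _ _).trans ?_)
  rw [c.addHaar_frontier μ, add_zero]

theorem hull_cpt {W : Set E} (c : IsCompact W) : IsCompact (closure (convexHull ℝ W)) := by
  apply Metric.isCompact_of_isClosed_isBounded isClosed_closure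
  exact ((isBounded_convexHull (s := W)).2 c.isBounded).closure

set_option maxHeartbeats 1600000 in
theorem combine1 {k : ℕ} (hd : Module.finrank ℝ E = k + 1) {t τ δ x y ω u θ0 ρ η : ℝ}
    (hτ : 0 < τ) (hτ1 : τ ≤ 1) (hτt : τ ≤ t) (hτt' : τ ≤ 1 - t) (hδ : 0 < δ)
    (hx : 0 < x) (hx1 : x ≤ τ / 4) (hδx : 2 * δ ≤ x ^ 2) (hy : 0 < y)
    (hxy : 1200 * x ≤ y ^ (k + 3) * τ ^ (4 * k + 9))
    (hyω : 60 * (k + 2) * y ≤ ω * τ) (hω1 : ω ≤ 1 / 2) (hu : 0 < u)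
    (hu1 : 3200 * (k + 1 : ℝ) ^ 2 * u ≤ 1) (hθ0 : 0 < θ0) (hθ1 : θ0 ≤ 1 / 2)
    (hωu : 2 * ω / θ0 ≤ (40 * (k + 1 : ℝ)) ^ 2 * u ^ 2 ^ k)
    (hρ : 2 ^ (k + 3) * (3200 * (k + 1 : ℝ) ^ 2 * u + 8 * ω + 2 * θ0) ≤ ρ) (hρ1 : ρ < 1)
    (hη : (k + 1) * ρ + 49 * (k + 2) * y ≤ η)
    {A B : Set E} (hA : MeasurableSet A) (hB : MeasurableSet B) (fA : μ A ≠ ⊤) (fB : μ B ≠ ⊤)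
    (fS : μ (t • A + (1 - t) • B) ≠ ⊤)
    (hα : 1 - δ ≤ μ.real A) (hα' : μ.real A ≤ 1 + δ)
    (hβ : 1 - δ ≤ μ.real B) (hβ' : μ.real B ≤ 1 + δ)
    (hS : μ.real (t • A + (1 - t) • B) ≤ 1 + δ) :
    ∃ (v : E) (C K : Set E), IsCompact K ∧ Convex ℝ K ∧ IsCompact C ∧ C ⊆ K ∧ C ⊆ A ∧ C ⊆ v +ᵥ B ∧
      1 - η ≤ μ.real C ∧ μ.real K ≤ 1 + η := by
  have hdR : (Module.finrank ℝ E : ℝ) = k + 1 := by rw [hd]; push_cast; rfl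
  have hk : (0 : ℝ) ≤ k := Nat.cast_nonneg k
  obtain ⟨A0, hA0, cA0, mA0⟩ := inner_cpt μ hA fA hδ
  obtain ⟨B0, hB0, cB0, mB0⟩ := inner_cpt μ hB fB hδ
  have a1 : μ.real A0 ≤ μ.real A := measureReal_mono hA0 fA
  have b1 : μ.real B0 ≤ μ.real B := measureReal_mono hB0 fB
  have s1 : μ.real (t • A0 + (1 - t) • B0) ≤ μ.real (t • A + (1 - t) • B) :=
    measureReal_mono (add_subset_add (smul_set_mono hA0) (smul_set_mono hB0)) fS
  have hω0 : 0 < ω := by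
    have : 0 < ω * τ := lt_of_lt_of_le (by positivity) hyω
    exact pos_of_mul_pos_left this hτ.le
  have hωτ : ω * τ ≤ ω := by nlinarith
  have hy1 : (k + 2) * y ≤ 1 / 120 := by nlinarith
  obtain ⟨A', hA', B', hB', cA', cB', mA', mB', hX1, hY1, hT1⟩ :=
    step2 μ (t := t) (τ := τ) (x := x) (y := y) hτ hτt hτt' hx hx1 hy
    (by rw [hdR]; linarith) (by
      rw [hd]; convert hxy using 3; ring) cA0 cB0
    (by linarith) (by linarith) (by linarith) (by linarith) (by linarith)
  rw [hdR] at hX1 hY1 hT1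
  have cT : Convex ℝ (t • convexHull ℝ A' + (1 - t) • convexHull ℝ B') :=
    ((convex_convexHull ℝ A').smul t).add ((convex_convexHull ℝ B').smul (1 - t))
  have hTf : μ (closure (t • convexHull ℝ A' + (1 - t) • convexHull ℝ B')) ≠ ⊤ := by
    refine ((measure_mono ?_).trans_lt (IsCompact.measure_lt_top (μ := μ)
      (((hull_cpt cA').smul t).add ((hull_cpt cB').smul (1 - t))))).ne
    apply closure_minimal (add_subset_add (smul_set_mono subset_closure)
      (smul_set_mono subset_closure))
    exact (((hull_cpt cA').smul t).add ((hull_cpt cB').smul (1 - t))).isClosed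
  rw [← conv_closure μ (convex_convexHull ℝ _)] at hX1 hY1
  rw [← conv_closure μ cT] at hT1
  replace hT1 := le_trans (measureReal_mono (s₁ := t • closure (convexHull ℝ A') +
    (1 - t) • closure (convexHull ℝ B')) (by
      rw [← closure_smul₀, ← closure_smul₀]
      rintro _ ⟨p, hp, q, hq, rfl⟩
      exact map_mem_closure₂ continuous_add hp hq fun a ha b hb => ⟨a, ha, b, hb, rfl⟩) hTf) hT1
  have cvX : Convex ℝ (closure (convexHull ℝ A')) := (convex_convexHull ℝ _).closure
  have cvY' : Convex ℝ (closure (convexHull ℝ B')) := (convex_convexHull ℝ _).closure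
  have cX : IsCompact (closure (convexHull ℝ A')) := hull_cpt cA'
  have cY : IsCompact (closure (convexHull ℝ B')) := hull_cpt cB'
  have xX : A' ⊆ closure (convexHull ℝ A') := (subset_convexHull ℝ A').trans subset_closure
  have xY : B' ⊆ closure (convexHull ℝ B') := (subset_convexHull ℝ B').trans subset_closure
  generalize closure (convexHull ℝ A') = X at *
  generalize closure (convexHull ℝ B') = Y at *
  have mX := measureReal_mono (μ := μ) xX cX.measure_lt_top.ne
  have mY := measureReal_mono (μ := μ) xY cY.measure_lt_top.ne
  have hky : y ≤ (k + 2) * y := by nlinarith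
  have hZ := to_half μ (t := t) (τ := τ) (ω := 20 * (k + 1 + 1) * y) hτ hτt hτt'
    (by positivity) (by nlinarith) cX cY cvX cvY'
    (by nlinarith) (by nlinarith) hT1
  have hZ2 : 3 * (20 * ((k : ℝ) + 1 + 1) * y) / τ ≤ ω := by
    rw [div_le_iff₀ hτ]; linarith
  have W : WP μ (2 * ω / θ0) (3200 * (k + 1 : ℝ) ^ 2 * u) := by
    intro P Q hP hQ cP cQ hNT f hf
    have := width (k + 1) (by omega) hu (by push_cast; nlinarith [sq_nonneg (k + 1 : ℝ)]) k μ hd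
      le_rfl hP hQ cP cQ (hNT.mono (by push_cast; exact hωu)) f hf
    push_cast at this
    refine this.trans (le_of_eq ?_)
    ring
  obtain ⟨v, hv⟩ := conv_translate μ (ω := ω) (θ0 := θ0) (ζ := 3200 * (k + 1 : ℝ) ^ 2 * u)
    (ρ := ρ) hω0.le hω1 hθ0 hθ1 (by positivity) hu1 (by rw [hd]; exact hρ) hρ1 W cX cY
    cvX cvY' (by linarith) (by linarith) (by linarith)
    (by linarith) (by linarith)
  have cC : IsCompact (A' ∩ (v +ᵥ B')) := cA'.inter (cB'.vadd v)
  have hρ0 : 0 ≤ ρ := le_trans (by positivity) hρ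
  refine ⟨v, A' ∩ (v +ᵥ B'), X, cX, cvX, cC, inter_subset_left.trans xX,
    inter_subset_left.trans (hA'.trans hA0),
    inter_subset_right.trans (vadd_set_mono (hB'.trans hB0)), ?_, ?_⟩
  · have sub : X ∩ (v +ᵥ Y) ⊆ (A' ∩ (v +ᵥ B')) ∪ ((X \ A') ∪ ((v +ᵥ Y) \ (v +ᵥ B'))) := by
      rintro q ⟨h1, h2⟩
      by_cases h3 : q ∈ A'
      · by_cases h4 : q ∈ v +ᵥ B'
        · exact Or.inl ⟨h3, h4⟩
        · exact Or.inr (Or.inr ⟨h2, h4⟩)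
      · exact Or.inr (Or.inl ⟨h1, h3⟩)
    have cvY : IsCompact (v +ᵥ Y) := cY.vadd v
    have f1 : μ (X \ A') ≠ ⊤ := ((measure_mono sdiff_subset).trans_lt cX.measure_lt_top).ne
    have f2 : μ ((v +ᵥ Y) \ (v +ᵥ B')) ≠ ⊤ :=
      ((measure_mono sdiff_subset).trans_lt cvY.measure_lt_top).ne
    have m1 := (measureReal_mono (μ := μ) sub (measure_union_ne_top cC.measure_lt_top.ne
      (measure_union_ne_top f1 f2))).trans (measureReal_union_le _ _)
    have m2 := measureReal_union_le (μ := μ) (X \ A') ((v +ᵥ Y) \ (v +ᵥ B'))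
    rw [measureReal_sdiff xX cA'.measurableSet cX.measure_lt_top.ne,
      measureReal_sdiff (vadd_set_mono xY) (cB'.vadd v).measurableSet cvY.measure_lt_top.ne,
      vadd_real, vadd_real] at m2
    have bern : 1 - (k + 1) * ρ ≤ (1 - ρ) ^ Module.finrank ℝ E := by
      have := one_add_mul_le_pow (a := -ρ) (by linarith) (Module.finrank ℝ E)
      rw [hdR] at this
      calc _ = 1 + ((k : ℝ) + 1) * -ρ := by ring
        _ ≤ _ := this
    have pw : (1 - ρ) ^ Module.finrank ℝ E ≤ 1 := pow_le_one₀ (by linarith) (by linarith)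
    have pw0 : 0 ≤ (1 - ρ) ^ Module.finrank ℝ E := pow_nonneg (by linarith) _
    have l1 : (1 - ρ) ^ Module.finrank ℝ E * (1 - 3 * y) ≤ (1 - ρ) ^ Module.finrank ℝ E * μ.real X :=
      mul_le_mul_of_nonneg_left (by linarith) pw0
    have l2 : (1 - ρ) ^ Module.finrank ℝ E * y ≤ y := by nlinarith
    linarith
  · have : 0 ≤ (k + 1) * ρ := by positivity
    nlinarith

theorem combine2 {k : ℕ} (hd : Module.finrank ℝ E = k + 1) {t τ η ρ δ z : ℝ}
    (hτ : 0 < τ) (hτt : τ ≤ t) (hτt' : τ ≤ 1 - t) (hη : 0 ≤ η) (hδη : δ ≤ η)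
    (hρ : 0 < ρ) (hρ1 : ρ < 1)
    (hz0 : 0 ≤ z)
    (hz : η + (k + 2) * (4 * η / τ ^ (k + 1) / (ρ * τ) ^ (k + 2)) + (k + 1) * ρ ≤ z / 16)
    (hz1 : z ≤ 1)
    {A B C K : Set E} (hA : MeasurableSet A) (hB : MeasurableSet B)
    (fS : μ (t • A + (1 - t) • B) ≠ ⊤)
    (hα : 1 - δ ≤ μ.real A) (hβ : 1 - δ ≤ μ.real B)
    (hS : μ.real (t • A + (1 - t) • B) ≤ 1 + δ) {v : E}
    (hK : IsCompact K) (cK : Convex ℝ K) (hC : IsCompact C) (hCK : C ⊆ K) (hCA : C ⊆ A)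
    (hCB : C ⊆ v +ᵥ B) (hC1 : 1 - η ≤ μ.real C) (hK1 : μ.real K ≤ 1 + η) :
    μ (convexHull ℝ (A ∪ (v +ᵥ B)) \ A) + μ (convexHull ℝ (A ∪ (v +ᵥ B)) \ (v +ᵥ B)) ≤
      ENNReal.ofReal z := by
  have hdR : (Module.finrank ℝ E : ℝ) = k + 1 := by rw [hd]; push_cast; rfl
  have hk : (0 : ℝ) ≤ k := Nat.cast_nonneg k
  have eS : t • A + (1 - t) • (v +ᵥ B) = ((1 - t) • v) +ᵥ (t • A + (1 - t) • B) := by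
    ext q
    simp only [mem_add, mem_smul_set, mem_vadd_set, vadd_eq_add]
    constructor
    · rintro ⟨_, ⟨a, ha, rfl⟩, _, ⟨_, ⟨b, hb, rfl⟩, rfl⟩, rfl⟩
      exact ⟨_, ⟨_, ⟨a, ha, rfl⟩, _, ⟨b, hb, rfl⟩, rfl⟩, by module⟩
    · rintro ⟨_, ⟨_, ⟨a, ha, rfl⟩, _, ⟨b, hb, rfl⟩, rfl⟩, rfl⟩
      exact ⟨_, ⟨a, ha, rfl⟩, _, ⟨_, ⟨b, hb, rfl⟩, rfl⟩, by module⟩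
  have h0 : 0 ≤ (k + 1) * ρ := by positivity
  set θ := (k + 2) * (4 * η / τ ^ (k + 1) / (ρ * τ) ^ (k + 2)) with hθ
  have hθ0 : 0 ≤ θ := by positivity
  have fh := final_hull μ (B := v +ᵥ B) (ρ := ρ) hτ hη hτt hτt' hρ hρ1 hK cK hC hCK hCA hCB
    (by rw [eS, measure_vadd]; exact fS) (by rw [eS, vadd_real]; linarith) hC1 hK1 (by
      rw [hdR, hd, show ((k : ℝ) + 1 + 1) = k + 2 by ring]
      show 0 < 1 - η - θ
      linarith)
  rw [hdR, hd, show ((k : ℝ) + 1 + 1) = k + 2 by ring] at fh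
  obtain ⟨fW, hW⟩ := fh
  change μ.real _ * (1 - η - θ) * _ ≤ _ at hW
  set W := convexHull ℝ (A ∪ (v +ᵥ B)) with hWd
  have bern : 1 - (k + 1) * ρ ≤ (1 - ρ) ^ (k + 1) := by
    have := one_add_mul_le_pow (a := -ρ) (by linarith) (k + 1)
    push_cast at this
    calc _ = 1 + ((k : ℝ) + 1) * -ρ := by ring
      _ ≤ _ := this
  set r := (k + 1) * ρ with hr
  have w0 : 0 ≤ μ.real W := measureReal_nonneg
  have g1 : μ.real W * (1 - z / 16) ≤ (1 + η) ^ 2 := by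
    refine le_trans ?_ hW
    rw [mul_assoc]
    apply mul_le_mul_of_nonneg_left _ w0
    calc 1 - z / 16 ≤ (1 - η - θ) * (1 - r) := by nlinarith [mul_nonneg (add_nonneg hη hθ0) h0]
      _ ≤ _ := by
        apply mul_le_mul_of_nonneg_left bern
        linarith
  have g2 : μ.real W ≤ 1 + z / 4 := by
    by_contra hn
    push Not at hn
    have h1 : (1 + z / 4) * (1 - z / 16) < μ.real W * (1 - z / 16) :=
      mul_lt_mul_of_pos_right hn (by linarith)
    have h2 : (1 + η) ^ 2 ≤ (1 + z / 16) ^ 2 := by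
      gcongr; linarith
    nlinarith
  have sA : A ⊆ W := subset_union_left.trans (subset_convexHull ℝ _)
  have sB : v +ᵥ B ⊆ W := subset_union_right.trans (subset_convexHull ℝ _)
  have f1 : μ (W \ A) ≠ ⊤ := ((measure_mono sdiff_subset).trans_lt fW.lt_top).ne
  have f2 : μ (W \ (v +ᵥ B)) ≠ ⊤ := ((measure_mono sdiff_subset).trans_lt fW.lt_top).ne
  rw [← ofReal_measureReal f1, ← ofReal_measureReal f2,
    ← ENNReal.ofReal_add measureReal_nonneg measureReal_nonneg]
  apply ENNReal.ofReal_le_ofReal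
  rw [measureReal_sdiff sA hA fW, measureReal_sdiff sB (hB.const_vadd v) fW, vadd_real]
  linarith
end


/-- exponents -/
def expQ (k : ℕ) : ℕ := (4 * k + 12) * 2 ^ k + (4 * k + 12)

def expR (k : ℕ) : ℕ := (expQ k + 2) * (k + 3) + (4 * k + 10)

theorem zpow_gain {z H c : ℝ} (hz : 0 < z) (hH : H * z ≤ 1) (hc : c ≤ H) (m : ℕ) :
    c * z ^ (m + 1) ≤ z ^ m := by
  have : c * z ≤ 1 := by nlinarith
  calc c * z ^ (m + 1) = (c * z) * z ^ m := by ring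
    _ ≤ 1 * z ^ m := by gcongr
    _ = z ^ m := one_mul _

section
variable {E : Type*} [NormedAddCommGroup E] [NormedSpace ℝ E] [FiniteDimensional ℝ E]
    [MeasurableSpace E] [BorelSpace E] (μ : Measure E) [μ.IsAddHaarMeasure]

set_option maxHeartbeats 1600000 in
theorem main_pos {k : ℕ} (hd : Module.finrank ℝ E = k + 1) {t τ δ z : ℝ}
    (hτ1 : τ ≤ 1) (hτt : τ ≤ t) (hτt' : τ ≤ 1 - t) (hδ : 0 < δ)
    (hz : 0 < z) (hzτ : z ≤ τ) (hzH : 10 ^ 6 * (k + 2 : ℝ) ^ 2 * 2 ^ (k + 3) * z ≤ 1)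
    (hδz : 2 * δ ≤ z ^ (2 * expR k))
    {A B : Set E} (hA : MeasurableSet A) (hB : MeasurableSet B) (fA : μ A ≠ ⊤) (fB : μ B ≠ ⊤)
    (fS : μ (t • A + (1 - t) • B) ≠ ⊤)
    (hα : 1 - δ ≤ μ.real A) (hα' : μ.real A ≤ 1 + δ)
    (hβ : 1 - δ ≤ μ.real B) (hβ' : μ.real B ≤ 1 + δ)
    (hS : μ.real (t • A + (1 - t) • B) ≤ 1 + δ) :
    ∃ v : E, μ (convexHull ℝ (A ∪ (v +ᵥ B)) \ A) + μ (convexHull ℝ (A ∪ (v +ᵥ B)) \ (v +ᵥ B)) ≤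
      ENNReal.ofReal z := by
  have hk : (0 : ℝ) ≤ k := Nat.cast_nonneg k
  have hτ : 0 < τ := hz.trans_le hzτ
  set H : ℝ := 10 ^ 6 * (k + 2 : ℝ) ^ 2 * 2 ^ (k + 3) with hH
  have p1 : (1 : ℝ) ≤ 2 ^ (k + 3) := one_le_pow₀ (by norm_num)
  have p2 : (1 : ℝ) ≤ (k + 2) ^ 2 := by nlinarith
  have p3 : (k + 2 : ℝ) ≤ (k + 2) ^ 2 := by nlinarith
  have p4 : (k + 2 : ℝ) ^ 2 ≤ (k + 2) ^ 2 * 2 ^ (k + 3) := le_mul_of_one_le_right (by positivity) p1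
  have p5 : (2 : ℝ) ^ (k + 3) ≤ (k + 2) ^ 2 * 2 ^ (k + 3) := le_mul_of_one_le_left (by positivity) p2
  have hH' : H = 10 ^ 6 * ((k + 2 : ℝ) ^ 2 * 2 ^ (k + 3)) := by rw [hH]; ring
  have H0 : 10 ^ 6 ≤ H := by rw [hH']; nlinarith
  have H1 : 10 ^ 6 * (k + 2 : ℝ) ≤ H := by rw [hH']; nlinarith
  have H2 : 10 ^ 6 * (k + 2 : ℝ) ^ 2 ≤ H := by rw [hH']; nlinarith
  have H3 : 10 ^ 6 * (2 : ℝ) ^ (k + 3) ≤ H := by rw [hH']; nlinarith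
  have G := fun {c : ℝ} (hc : c ≤ H) (m : ℕ) => zpow_gain hz hzH hc m
  clear_value H
  have z1 : z ≤ 1 := hzτ.trans hτ1
  have hz6 : 10 ^ 6 * z ≤ 1 := by nlinarith
  have hm : ∀ {a b : ℕ}, a ≤ b → z ^ b ≤ z ^ a := fun h => pow_le_pow_of_le_one hz.le z1 h
  set m := 4 * k + 9 with hmd
  set Q := expQ k with hQ
  have hQm : m + 3 ≤ Q := by simp only [hQ, expQ, hmd]; omega
  have hQ1 : 1 ≤ Q := by omega
  have yz : z ^ (Q + 2) ≤ z ^ (m + 1) := hm (by omega)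
  have hzz : z ^ 1 = z := pow_one z
  have zs : z ^ 2 ≤ z / 4 := by nlinarith
  have half : ∀ {b : ℕ}, 1 ≤ b → z ^ b ≤ 1 / 2 := fun {b} hb => by
    have := hm hb; rw [hzz] at this; linarith
  obtain ⟨v, C, K, hK, cK, hC, hCK, hCA, hCB, hC1, hK1⟩ := combine1 μ hd (t := t) (τ := τ) (δ := δ)
    (x := z ^ expR k) (y := z ^ (Q + 2)) (ω := z ^ Q) (u := z ^ (m + 3)) (θ0 := z ^ (m + 2))
    (ρ := z ^ (m + 1)) (η := z ^ m) hτ hτ1 hτt hτt' hδ (by positivity)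
    (by
      have : z ^ expR k ≤ z ^ 2 := hm (by unfold expR; nlinarith)
      linarith)
    (by rw [← pow_mul, mul_comm (expR k)]; exact hδz) (by positivity)
    (by
      have e : expR k = (Q + 2) * (k + 3) + m + 1 := by simp only [expR, hmd, hQ]; ring
      rw [e]
      refine (G (by linarith) _).trans ?_
      rw [pow_add, pow_mul]
      gcongr)
    (by
      refine (G (c := 60 * (k + 2)) (by linarith) (Q + 1)).trans ?_
      rw [pow_succ]
      gcongr)
    (half hQ1) (by positivity)
    (by
      have h1 : ((k : ℝ) + 1) ^ 2 ≤ (k + 2) ^ 2 := by gcongr; linarith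
      refine (G (c := 3200 * (k + 1) ^ 2) (by linarith) (m + 2)).trans ?_
      exact pow_le_one₀ hz.le z1)
    (by positivity) (half (by omega))
    (by
      rw [div_le_iff₀ (by positivity), ← pow_mul]
      have e : Q = (m + 3) * 2 ^ k + (m + 2) + 1 := by simp only [hQ, expQ, hmd]; ring
      rw [e]
      refine (G (by linarith) _).trans ?_
      rw [pow_add]
      have h1 : (1 : ℝ) ≤ (40 * (k + 1)) ^ 2 := by nlinarith
      have h2 : 0 < z ^ ((m + 3) * 2 ^ k) := by positivity
      have h3 : 0 < z ^ (m + 2) := by positivity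
      apply mul_le_mul_of_nonneg_right _ h3.le
      exact le_mul_of_one_le_left h2.le h1)
    (by
      have h1 : ((k : ℝ) + 1) ^ 2 ≤ (k + 2) ^ 2 := by gcongr; linarith
      have g1 := (G (c := 3200 * (k + 1) ^ 2) (by linarith) (m + 2))
      have g2 : z ^ Q ≤ z ^ (m + 2) := hm (by omega)
      have g3 := (G (c := 11 * 2 ^ (k + 3)) (by linarith) (m + 1))
      refine le_trans ?_ g3
      rw [show m + 1 + 1 = m + 2 by ring]
      calc _ ≤ (2 : ℝ) ^ (k + 3) * (z ^ (m + 2) + 8 * z ^ (m + 2) + 2 * z ^ (m + 2)) := by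
            gcongr
        _ = _ := by ring)
    (by
      have := half (b := m + 1) (by omega)
      linarith)
    (by
      have g1 := (G (c := 50 * (k + 2)) (by linarith) m)
      have g2 : 49 * ((k : ℝ) + 2) * z ^ (Q + 2) ≤ 49 * ((k : ℝ) + 2) * z ^ (m + 1) := by gcongr
      have g3 : 0 < z ^ (m + 1) := by positivity
      linarith)
    hA hB fA fB fS hα hα' hβ hβ' hS
  refine ⟨v, ?_⟩
  refine combine2 μ hd (t := t) (τ := τ) (η := z ^ m) (ρ := z ^ 2) (δ := δ) (z := z) hτ hτt hτt'
    (by positivity) ?_ (by positivity) ?_ hz.le ?_ z1 hA hB fS hα hβ hS hK cK hC hCK hCA hCB hC1 hK1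
  · have : z ^ (2 * expR k) ≤ z ^ m := hm (by simp only [expR, hmd]; nlinarith)
    linarith
  · linarith
  · have e1 : 4 * z ^ m / τ ^ (k + 1) / (z ^ 2 * τ) ^ (k + 2) ≤ 4 * z ^ 2 := by
      rw [div_div, div_le_iff₀ (by positivity)]
      have : z ^ (k + 1) * (z ^ 2 * z) ^ (k + 2) ≤ τ ^ (k + 1) * (z ^ 2 * τ) ^ (k + 2) := by gcongr
      calc 4 * z ^ m = 4 * z ^ 2 * (z ^ (k + 1) * (z ^ 2 * z) ^ (k + 2)) := by
            rw [hmd, show z ^ 2 * z = z ^ 3 by ring, ← pow_mul, ← pow_add, mul_assoc, ← pow_add]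
            congr 2; ring
        _ ≤ _ := by gcongr
    have e2 : (k + 2) * (4 * z ^ m / τ ^ (k + 1) / (z ^ 2 * τ) ^ (k + 2)) ≤ (k + 2) * (4 * z ^ 2) := by
      gcongr
    have e3 : z ^ m ≤ z ^ 2 := hm (by omega)
    have g1 := (G (c := 16 * (6 * (k + 2))) (by linarith) 1)
    rw [hzz] at g1
    norm_num at g1
    have e4 : 0 ≤ z ^ 2 := by positivity
    linarith
end


section
variable {E : Type*} [NormedAddCommGroup E] [NormedSpace ℝ E] [FiniteDimensional ℝ E]
    [MeasurableSpace E] [BorelSpace E] (μ : Measure E) [μ.IsAddHaarMeasure]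

theorem main_zero {z0 : ℝ} (hz0 : 0 < z0) {A B : Set E} (hA : MeasurableSet A)
    (hB : MeasurableSet B) (mA : μ A = 1) (mB : μ B = 1)
    (h : ∀ z : ℝ, 0 < z → z ≤ z0 → ∃ v : E, μ (convexHull ℝ (A ∪ (v +ᵥ B)) \ A) +
      μ (convexHull ℝ (A ∪ (v +ᵥ B)) \ (v +ᵥ B)) ≤ ENNReal.ofReal z) :
    ∃ (v : E) (K : Set E), Convex ℝ K ∧ A ⊆ K ∧ v +ᵥ B ⊆ K ∧
      μ (K \ A) + μ (K \ (v +ᵥ B)) = 0 := by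
  obtain ⟨A0, hA0, cA0, mA0⟩ := inner_cpt μ hA (by rw [mA]; simp) (δ := 1 / 4) (by norm_num)
  obtain ⟨B0, hB0, cB0, mB0⟩ := inner_cpt μ hB (by rw [mB]; simp) (δ := 1 / 4) (by norm_num)
  have rA : μ.real A = 1 := by simp [Measure.real, mA]
  have rB : μ.real B = 1 := by simp [Measure.real, mB]
  rw [rA] at mA0
  rw [rB] at mB0
  -- the sequence
  set z : ℕ → ℝ := fun j => min z0 (1 / 4) / (j + 1) with hzd
  have hm0 : 0 < min z0 (1 / 4) := by positivity
  have hz : ∀ j, 0 < z j := fun j => by positivity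
  have hzm : ∀ j, z j ≤ min z0 (1 / 4) := fun j =>
    div_le_self hm0.le (by have : (0 : ℝ) ≤ j := Nat.cast_nonneg j
                           linarith)
  have hzl : Filter.Tendsto z Filter.atTop (nhds 0) := by
    have := (tendsto_one_div_add_atTop_nhds_zero_nat (𝕜 := ℝ)).const_mul (min z0 (1 / 4))
    simp only [mul_zero] at this
    convert this using 2
    simp only [hzd]; ring
  choose v hv using fun j => h (z j) (hz j) ((hzm j).trans (min_le_left _ _))
  have hvK : ∀ j, v j ∈ A0 - B0 := by
    intro j
    by_contra hn
    have dis : Disjoint A0 (v j +ᵥ B0) := by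
      rw [Set.disjoint_left]
      rintro q hq ⟨b, hb, rfl⟩
      apply hn
      exact ⟨_, hq, b, hb, by simp⟩
    have hsub : A0 ∪ (v j +ᵥ B0) ⊆ A ∪ (convexHull ℝ (A ∪ (v j +ᵥ B)) \ A) := by
      rintro q hq
      by_cases hqA : q ∈ A
      · exact Or.inl hqA
      · right
        refine ⟨subset_convexHull ℝ _ ?_, hqA⟩
        rcases hq with hq | hq
        · exact Or.inl (hA0 hq)
        · exact Or.inr (vadd_set_mono hB0 hq)
    have h1 : μ (convexHull ℝ (A ∪ (v j +ᵥ B)) \ A) ≤ ENNReal.ofReal (1 / 4) :=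
      (le_self_add.trans (hv j)).trans (ENNReal.ofReal_le_ofReal ((hzm j).trans (min_le_right _ _)))
    have h2 := (measure_mono (μ := μ) hsub).trans (measure_union_le _ _)
    rw [measure_union dis (cB0.vadd _).measurableSet, measure_vadd, mA,
      ← ofReal_measureReal cA0.measure_lt_top.ne, ← ofReal_measureReal cB0.measure_lt_top.ne,
      ← ENNReal.ofReal_add measureReal_nonneg measureReal_nonneg] at h2
    have h3 := h2.trans (add_le_add_right h1 1)
    rw [← ENNReal.ofReal_one, ← ENNReal.ofReal_add (by norm_num) (by norm_num),
      ENNReal.ofReal_le_ofReal_iff (by norm_num)] at h3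
    linarith
  have cD : IsCompact (A0 - B0) := by rw [sub_eq_add_neg]; exact cA0.add cB0.neg
  obtain ⟨w, -, φ, hφ, hw⟩ := cD.tendsto_subseq hvK
  have hzφ : Filter.Tendsto (fun j => ENNReal.ofReal (z (φ j))) Filter.atTop (nhds 0) := by
    have := (ENNReal.tendsto_ofReal hzl).comp hφ.tendsto_atTop
    rw [ENNReal.ofReal_zero] at this
    exact this
  have small : ∀ (P : Set E) , (∀ᶠ j in Filter.atTop, μ P ≤ ENNReal.ofReal (z (φ j))) → μ P = 0 := by
    intro P hP
    exact le_antisymm (ge_of_tendsto hzφ hP) (zero_le)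
  set X := closure (convexHull ℝ A) with hX
  set Y := convexHull ℝ B with hY
  have nA : μ (convexHull ℝ A \ A) = 0 := by
    apply small
    refine Filter.Eventually.of_forall fun j => ?_
    refine (measure_mono ?_).trans (le_self_add.trans (hv (φ j)))
    exact sdiff_le_sdiff_right (convexHull_mono subset_union_left)
  have mX : μ X = 1 := by
    have h1 : X ⊆ A ∪ ((convexHull ℝ A \ A) ∪ frontier (convexHull ℝ A)) := by
      intro q hq
      rw [hX, closure_eq_self_union_frontier] at hq
      by_cases hqA : q ∈ A
      · exact Or.inl hqA
      · rcases hq with hq | hq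
        · exact Or.inr (Or.inl ⟨hq, hqA⟩)
        · exact Or.inr (Or.inr hq)
    apply le_antisymm
    · refine (measure_mono h1).trans ((measure_union_le _ _).trans ?_)
      refine (add_le_add_right (measure_union_le _ _) _).trans ?_
      rw [nA, (convex_convexHull ℝ A).addHaar_frontier μ, mA]; simp
    · rw [← mA]; exact measure_mono ((subset_convexHull ℝ A).trans subset_closure)
  have sAX : A ⊆ X := (subset_convexHull ℝ A).trans subset_closure
  have cY : Convex ℝ Y := convex_convexHull ℝ B
  have intY : (interior Y).Nonempty := by
    by_contra hn
    rw [not_nonempty_iff_eq_empty] at hn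
    have : Y ⊆ frontier Y := by
      intro q hq; rw [frontier, hn, sdiff_empty]; exact subset_closure hq
    have h0 := measure_mono_null ((subset_convexHull ℝ B).trans this) (cY.addHaar_frontier μ)
    rw [mB] at h0
    exact one_ne_zero h0
  have key : interior Y ⊆ (fun y => w + y) ⁻¹' X := by
    intro y hy
    by_contra hn
    have hn' : w + y ∈ Xᶜ := hn
    have o1 : IsOpen Xᶜ := isClosed_closure.isOpen_compl
    obtain ⟨r1, hr1, b1⟩ := Metric.isOpen_iff.1 o1 _ hn'
    obtain ⟨r2, hr2, b2⟩ := Metric.isOpen_iff.1 isOpen_interior _ hy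
    have hr : 0 < min r1 (r2 / 2) := by positivity
    have h0 : μ (Metric.ball (w + y) (min r1 (r2 / 2))) = 0 := by
      apply small
      have ev := (Metric.tendsto_atTop.1 hw) (r2 / 2) (by linarith)
      obtain ⟨N, hN⟩ := ev
      filter_upwards [Filter.eventually_ge_atTop N] with j hj
      refine (measure_mono ?_).trans (le_self_add.trans (hv (φ j)))
      intro q hq
      rw [Metric.mem_ball] at hq
      refine ⟨?_, fun hqA => ?_⟩
      · have hsub : v (φ j) +ᵥ Y ⊆ convexHull ℝ (A ∪ (v (φ j) +ᵥ B)) := by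
          have e : v (φ j) +ᵥ Y = convexHull ℝ (v (φ j) +ᵥ B) := (convexHull_vadd _ _).symm
          rw [e]
          exact convexHull_mono subset_union_right
        apply hsub
        rw [mem_vadd_set_iff_neg_vadd_mem]
        apply interior_subset
        apply b2
        have d1 := hN j hj
        rw [Metric.mem_ball, dist_eq_norm, vadd_eq_add]
        rw [dist_eq_norm] at d1 hq
        have e : -v (φ j) + q - y = (q - (w + y)) - ((v ∘ φ) j - w) := by
          simp only [Function.comp]; abel
        rw [e]
        have := norm_sub_le (q - (w + y)) ((v ∘ φ) j - w)
        have := min_le_right r1 (r2 / 2)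
        linarith
      · have : q ∈ Xᶜ := b1 (Metric.mem_ball.2 (hq.trans_le (min_le_left _ _)))
        exact this (sAX hqA)
    exact (Metric.measure_ball_pos μ _ hr).ne' h0
  have sB : w +ᵥ B ⊆ X := by
    have cl : IsClosed ((fun y => w + y) ⁻¹' X) :=
      isClosed_closure.preimage (continuous_const.add continuous_id)
    have h1 := closure_minimal key cl
    rw [cY.closure_interior_eq_closure_of_nonempty_interior intY] at h1
    rintro _ ⟨b, hb, rfl⟩
    exact h1 (subset_closure (subset_convexHull ℝ B hb))
  refine ⟨w, X, (convex_convexHull ℝ A).closure, sAX, sB, ?_⟩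
  rw [measure_sdiff sAX hA.nullMeasurableSet (by rw [mA]; simp),
    measure_sdiff sB (hB.const_vadd w).nullMeasurableSet (by rw [measure_vadd, mB]; simp),
    measure_vadd, mX, mA, mB]
  simp
end


theorem three_pow_ge (k : ℕ) (hk : 1 ≤ k) : k + 8 ≤ 3 ^ (k + 1) := by
  induction k, hk using Nat.le_induction with
  | base => norm_num
  | succ k _ ih => rw [pow_succ]; omega

theorem exp_bound (k : ℕ) (hk : 1 ≤ k) : 2 * expR k + 1 ≤ (8 * (k + 1)) ^ 3 ^ (k + 1) := by
  have h1 : (8 * (k + 1)) ^ (k + 8) ≤ (8 * (k + 1)) ^ 3 ^ (k + 1) :=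
    Nat.pow_le_pow_right (by omega) (three_pow_ge k hk)
  refine le_trans ?_ h1
  have h2 : (8 * (k + 1)) ^ (k + 8) = (8 * (k + 1)) ^ k * (8 * (k + 1)) ^ 8 := pow_add _ _ _
  have h3 : 2 ^ k ≤ (8 * (k + 1)) ^ k := Nat.pow_le_pow_left (by omega) k
  have h4 : (8 * (k + 1)) ^ 2 * 8 ^ 6 ≤ (8 * (k + 1)) ^ 8 := by
    calc _ ≤ (8 * (k + 1)) ^ 2 * (8 * (k + 1)) ^ 6 :=
          Nat.mul_le_mul_left _ (Nat.pow_le_pow_left (by omega) 6)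
      _ = _ := by ring
  rw [h2]
  refine le_trans ?_ (Nat.mul_le_mul h3 h4)
  unfold expR expQ
  have h5 : 1 ≤ 2 ^ k := Nat.one_le_two_pow
  generalize 2 ^ k = P at h5
  nlinarith [Nat.mul_le_mul_right (k ^ 2) h5, Nat.mul_le_mul_right k h5]

theorem J_bound (k : ℕ) (hk : 1 ≤ k) : 3 * k + 40 ≤ 64 ^ 3 ^ (k + 1) - 1 := by
  have h := three_pow_ge k hk
  have h2 := one_add_mul_le_pow (a := (63 : ℤ)) (by norm_num) (3 ^ (k + 1))
  have h3 : 1 + 63 * 3 ^ (k + 1) ≤ 64 ^ 3 ^ (k + 1) := by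
    have h2' : (1 : ℤ) + 63 * 3 ^ (k + 1) ≤ 64 ^ 3 ^ (k + 1) := by
      push_cast at h2; norm_num at h2; linarith
    exact_mod_cast h2'
  generalize 64 ^ 3 ^ (k + 1) = P at *
  omega

theorem H_bound (k : ℕ) : (10 : ℝ) ^ 6 * (k + 2 : ℝ) ^ 2 * 2 ^ (k + 3) ≤ 2 ^ (3 * k + 40) := by
  have h1 : (k + 2 : ℝ) ≤ 2 ^ (k + 2) := by
    exact_mod_cast (Nat.lt_two_pow_self (n := k + 2)).le
  calc (10 : ℝ) ^ 6 * (k + 2 : ℝ) ^ 2 * 2 ^ (k + 3) ≤ 2 ^ 20 * (2 ^ (k + 2)) ^ 2 * 2 ^ (k + 3) := by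
        gcongr; norm_num
    _ = 2 ^ (20 + (k + 2) * 2 + (k + 3)) := by rw [← pow_mul, ← pow_add, ← pow_add]
    _ ≤ _ := by
        apply pow_le_pow_right₀ (by norm_num)
        omega

theorem log_bounds {τ : ℝ} (hτ : 0 < τ) (hτ1 : τ ≤ 1 / 2) :
    |Real.log τ| = -Real.log τ ∧ Real.log 2 ≤ -Real.log τ ∧ τ ≤ |Real.log τ| := by
  have h1 : Real.log τ ≤ Real.log (1 / 2) := Real.log_le_log hτ hτ1
  rw [one_div, Real.log_inv] at h1
  have h2 := Real.log_two_gt_d9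
  have h3 : |Real.log τ| = -Real.log τ := abs_of_neg (by linarith)
  refine ⟨h3, by linarith, by rw [h3]; linarith⟩

/-- Choice of the base variable. -/
theorem z_choice {k : ℕ} (hk : 1 ≤ k) {τ δ : ℝ} (hτ : 0 < τ) (hτ1 : τ ≤ 1 / 2) (hδ : 0 < δ)
    (h : δ ≤ Real.exp (-((2 : ℝ) ^ 3 ^ (k + 1 + 2) * ((k + 1 : ℕ) : ℝ) ^ 3 ^ (k + 1) *
      |Real.log τ| ^ 3 ^ (k + 1) / τ ^ 3 ^ (k + 1)))) :
    ∃ z : ℝ, 0 < z ∧ z ≤ τ ∧ 10 ^ 6 * (k + 2 : ℝ) ^ 2 * 2 ^ (k + 3) * z ≤ 1 ∧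
      2 * δ ≤ z ^ (2 * expR k) ∧
      z ≤ δ ^ (τ ^ 3 ^ (k + 1) / ((2 : ℝ) ^ 3 ^ (k + 1 + 1) * ((k + 1 : ℕ) : ℝ) ^ 3 ^ (k + 1) *
        |Real.log τ| ^ 3 ^ (k + 1))) := by
  obtain ⟨l1, l2, l3⟩ := log_bounds hτ hτ1
  set m := 3 ^ (k + 1) with hm
  have e1 : (2 : ℝ) ^ 3 ^ (k + 1 + 2) = 512 ^ m := by
    rw [show 3 ^ (k + 1 + 2) = 9 * m by rw [hm]; ring, pow_mul]; norm_num
  have e2 : (2 : ℝ) ^ 3 ^ (k + 1 + 1) = 8 ^ m := by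
    rw [show 3 ^ (k + 1 + 1) = 3 * m by rw [hm]; ring, pow_mul]; norm_num
  rw [e1] at h
  rw [e2]
  set l := |Real.log τ| with hl
  have hl0 : 0 < l := hτ.trans_le l3
  set p : ℕ := (8 * (k + 1)) ^ m with hp
  have hp0 : 0 < p := by positivity
  have hpR : (p : ℝ) = 8 ^ m * ((k + 1 : ℕ) : ℝ) ^ m := by
    rw [hp]; push_cast; rw [mul_pow]
  have hpb : 2 * expR k + 1 ≤ p := exp_bound k hk
  have hpR0 : (0 : ℝ) < p := by exact_mod_cast hp0
  set J := 64 ^ m - 1 with hJ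
  have hJR : (64 : ℝ) ^ m = J + 1 := by
    have : 64 ^ m = J + 1 := by
      rw [hJ]; have : 1 ≤ 64 ^ m := Nat.one_le_pow _ _ (by norm_num)
      omega
    exact_mod_cast this
  have hJb : 3 * k + 40 ≤ J := J_bound k hk
  have hm0 : m ≠ 0 := by positivity
  -- M ≥ p * 64^m * l
  have hM : (p : ℝ) * (64 ^ m * l) ≤ 512 ^ m * ((k + 1 : ℕ) : ℝ) ^ m * l ^ m / τ ^ m := by
    have hlτ : l ≤ (l / τ) ^ m := by
      calc l ≤ l / τ := by rw [le_div_iff₀ hτ]; nlinarith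
        _ ≤ (l / τ) ^ m := le_self_pow₀ (by rw [le_div_iff₀ hτ]; linarith) hm0
    rw [mul_div_assoc, ← div_pow, hpR, show (512 : ℝ) = 8 * 64 by norm_num, mul_pow]
    calc _ = 8 ^ m * 64 ^ m * ((k + 1 : ℕ) : ℝ) ^ m * l := by ring
      _ ≤ _ := by gcongr
  have hlogδ : Real.log δ ≤ -((p : ℝ) * (64 ^ m * l)) := by
    have := Real.log_le_log hδ h
    rw [Real.log_exp] at this
    linarith
  set z := δ ^ ((p : ℝ)⁻¹) with hz
  have hz0 : 0 < z := Real.rpow_pos_of_pos hδ _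
  have hzp : z ^ p = δ := Real.rpow_inv_natCast_pow hδ.le hp0.ne'
  have hlogz : Real.log z ≤ -(64 ^ m * l) := by
    rw [hz, Real.log_rpow hδ, inv_mul_le_iff₀ hpR0]
    linarith
  have hzJ : z * 2 ^ J ≤ τ := by
    rw [← Real.log_le_log_iff (by positivity) hτ, Real.log_mul hz0.ne' (by positivity),
      Real.log_pow]
    have : (J : ℝ) * Real.log 2 ≤ J * l := by
      apply mul_le_mul_of_nonneg_left _ (Nat.cast_nonneg J)
      rw [l1]; exact l2
    rw [hJR] at hlogz
    linarith
  have h2J : (1 : ℝ) ≤ 2 ^ J := one_le_pow₀ (by norm_num)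
  have hzτ : z ≤ τ := by nlinarith
  have z12 : z ≤ 1 / 2 := hzτ.trans hτ1
  refine ⟨z, hz0, hzτ, ?_, ?_, ?_⟩
  · have : (10 : ℝ) ^ 6 * (k + 2 : ℝ) ^ 2 * 2 ^ (k + 3) ≤ 2 ^ J :=
      (H_bound k).trans (pow_le_pow_right₀ (by norm_num) hJb)
    calc _ ≤ 2 ^ J * z := by gcongr
      _ ≤ 1 := by linarith
  · rw [← hzp]
    have h1 : z ^ p ≤ z ^ (2 * expR k + 1) := pow_le_pow_of_le_one hz0.le (by linarith) hpb
    rw [pow_succ] at h1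
    have h2 : 0 < z ^ (2 * expR k) := by positivity
    nlinarith
  · rw [hz]
    have hδ1 : δ ≤ 1 := by
      rw [← hzp]; exact pow_le_one₀ hz0.le (by linarith)
    apply Real.rpow_le_rpow_of_exponent_ge hδ hδ1
    rw [← hpR, div_le_iff₀ (by positivity)]
    rw [inv_mul_cancel_left₀ hpR0.ne']
    gcongr


theorem statement2 (n : ℕ) (hn : 2 ≤ n) :
    ∃ N : ℝ, ∀ (τ t δ : ℝ) (A B : Set (EuclideanSpace ℝ (Fin n))),
      MeasurableSet A → MeasurableSet B →
      0 < τ → τ ≤ 1 / 2 → t ∈ Set.Icc τ (1 - τ) →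
      |(volume A).toReal - 1| + |(volume B).toReal - 1| +
        |(volume (t • A + (1 - t) • B)).toReal - 1| ≤ δ →
      δ ≤ Real.exp
        (-((2 : ℝ) ^ 3 ^ (n + 2) * (n : ℝ) ^ 3 ^ n * |Real.log τ| ^ 3 ^ n / τ ^ 3 ^ n)) →
      ∃ (v : EuclideanSpace ℝ (Fin n)) (K : Set (EuclideanSpace ℝ (Fin n))),
        Convex ℝ K ∧ A ⊆ K ∧ (· + v) '' B ⊆ K ∧
        volume (K \ A) + volume (K \ ((· + v) '' B)) ≤
          ENNReal.ofReal (τ ^ (-N) *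
            δ ^ (τ ^ 3 ^ n / ((2 : ℝ) ^ 3 ^ (n + 1) * (n : ℝ) ^ 3 ^ n * |Real.log τ| ^ 3 ^ n))) := by
  obtain ⟨k, rfl⟩ : ∃ k, n = k + 1 := ⟨n - 1, by omega⟩
  have hk : 1 ≤ k := by omega
  refine ⟨0, ?_⟩
  intro τ t δ A B hA hB hτ hτ1 ht hδ hM
  have hτt : τ ≤ t := ht.1
  have hτt' : τ ≤ 1 - t := by linarith [ht.2]
  obtain ⟨l1, l2, l3⟩ := log_bounds hτ hτ1
  have hl0 : 0 < |Real.log τ| := hτ.trans_le l3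
  have hM0 : 0 < (2 : ℝ) ^ 3 ^ (k + 1 + 2) * ((k + 1 : ℕ) : ℝ) ^ 3 ^ (k + 1) *
      |Real.log τ| ^ 3 ^ (k + 1) / τ ^ 3 ^ (k + 1) := by positivity
  have hδ1 : δ < 1 := by
    refine hM.trans_lt ?_
    rw [Real.exp_lt_one_iff]
    linarith
  have a0 := abs_nonneg ((volume A).toReal - 1)
  have b0 := abs_nonneg ((volume B).toReal - 1)
  have s0 := abs_nonneg ((volume (t • A + (1 - t) • B)).toReal - 1)
  have ha : |(volume A).toReal - 1| ≤ δ := by linarith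
  have hb : |(volume B).toReal - 1| ≤ δ := by linarith
  have hs : |(volume (t • A + (1 - t) • B)).toReal - 1| ≤ δ := by linarith
  have hδ0 : 0 ≤ δ := by linarith
  have fin : ∀ {P : Set (EuclideanSpace ℝ (Fin (k + 1)))}, |(volume P).toReal - 1| ≤ δ →
      volume P ≠ ⊤ := by
    intro P hP hT
    rw [hT] at hP
    norm_num at hP
    linarith
  have fA := fin ha
  have fB := fin hb
  have fS := fin hs
  rw [abs_le] at ha hb hs
  have img : ∀ v : EuclideanSpace ℝ (Fin (k + 1)), (· + v) '' B = v +ᵥ B := by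
    intro v
    ext q
    simp only [mem_image, mem_vadd_set, vadd_eq_add, add_comm]
  have hd : Module.finrank ℝ (EuclideanSpace ℝ (Fin (k + 1))) = k + 1 := by simp
  simp only [img, neg_zero, Real.rpow_zero, one_mul]
  rcases hδ0.eq_or_lt with h0 | hpos
  · subst h0
    obtain ⟨z0, hz0, hzτ, hzH, -, -⟩ := z_choice hk hτ hτ1 (Real.exp_pos _) le_rfl
    have one : ∀ {P : Set (EuclideanSpace ℝ (Fin (k + 1)))}, volume P ≠ ⊤ →
        (volume P).toReal = 1 → volume P = 1 := by
      intro P hP h1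
      rw [← ENNReal.ofReal_toReal hP, h1, ENNReal.ofReal_one]
    obtain ⟨v, K, c1, c2, c3, c4⟩ := main_zero volume hz0 hA hB (one fA (by linarith [ha.1, ha.2]))
      (one fB (by linarith [hb.1, hb.2])) (by
        intro z hz hzz
        have hp : 0 < z ^ (2 * expR k) := by positivity
        refine main_pos volume hd (t := t) (τ := τ) (δ := z ^ (2 * expR k) / 2) (by linarith)
          hτt hτt' (by positivity) hz (by linarith) (le_trans ?_ hzH) (by linarith) hA hB fA fB fS
          ?_ ?_ ?_ ?_ ?_
        · gcongr
        all_goals simp only [Measure.real]; linarith [ha.1, ha.2, hb.1, hb.2, hs.1, hs.2])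
    exact ⟨v, K, c1, c2, c3, by rw [c4]; exact zero_le⟩
  · obtain ⟨z, hz, hzτ, hzH, hδz, hzδ⟩ := z_choice hk hτ hτ1 hpos hM
    obtain ⟨v, hv⟩ := main_pos volume hd (t := t) (τ := τ) (δ := δ) (by linarith)
      hτt hτt' hpos hz hzτ hzH hδz hA hB fA fB fS
      (by simp only [Measure.real]; linarith) (by simp only [Measure.real]; linarith)
      (by simp only [Measure.real]; linarith) (by simp only [Measure.real]; linarith)
      (by simp only [Measure.real]; linarith)
    exact ⟨v, _, convex_convexHull ℝ _, subset_union_left.trans (subset_convexHull ℝ _),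
      subset_union_right.trans (subset_convexHull ℝ _),
      hv.trans (ENNReal.ofReal_le_ofReal hzδ)⟩
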